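/- Let d ∈ ℕ, α ∈ (0, min(2,d)) and δ ∈ (0, (d-α)/2]. For every T > 0 there exists a constant c > 0 such that for all t ∈ (0,T] and x ∈ ℝ^d \ {0}, ∫_{ℝ^d} p̃(t,x,y) dy ≤ c H(t,x), where H(t,x) = 1 + h_δ(x)/h_δ(t^{1/α}) and h_δ(t^{1/α}) denotes the value of the radial profile of h_δ at t^{1/α}. -/

import Mathlib

open MeasureTheory Real Set Filter RealInnerProductSpace

noncomputable section

/-- Euclidean space `ℝ^d`. -/
abbrev Ed (d : ℕ) := EuclideanSpace ℝ (Fin d)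

/-- Modified Bessel function of the second kind `K_ν(r)`. -/
def besselK (ν r : ℝ) : ℝ :=
  (1 / 2) * (r / 2) ^ ν * ∫ u in Ioi (0 : ℝ), u ^ (-ν - 1) * Real.exp (-u - r ^ 2 / (4 * u))

/-- Relativistic `α`-stable heat kernel with mass parameter `m`:
`p^m(t,x,y) = (2π)^{-d} ∫ exp(-i⟨y-x,z⟩) exp(-t(|z|²+m^{2/α})^{α/2}) dz`
(the integral is real, and equals the cosine integral below). -/
def relKernel (d : ℕ) (α m t : ℝ) (x y : Ed d) : ℝ :=
  (2 * π) ^ (-(d : ℝ)) *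
    ∫ z : Ed d, Real.cos ⟪y - x, z⟫ * Real.exp (-t * (‖z‖ ^ 2 + m ^ (2 / α)) ^ (α / 2))

/-- Fractional (`α`-stable) heat kernel `p⁰(t,x,y)`. -/
def fracKernel (d : ℕ) (α t : ℝ) (x y : Ed d) : ℝ :=
  (2 * π) ^ (-(d : ℝ)) * ∫ z : Ed d, Real.cos ⟪y - x, z⟫ * Real.exp (-t * ‖z‖ ^ α)

/-- The summands of the perturbation series. -/
def pertN (d : ℕ) (k : ℝ → Ed d → Ed d → ℝ) (q : Ed d → ℝ) : ℕ → ℝ → Ed d → Ed d → ℝ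
  | 0 => k
  | n + 1 => fun t x y =>
      ∫ s in Ioo (0 : ℝ) t, ∫ z : Ed d, pertN d k q n s x z * q z * k (t - s) z y

/-- Schrödinger perturbation of a transition density `k` by a potential `q`. -/
def pert (d : ℕ) (k : ℝ → Ed d → Ed d → ℝ) (q : Ed d → ℝ) (t : ℝ) (x y : Ed d) : ℝ :=
  ∑' n : ℕ, pertN d k q n t x y

/-- Radial profile of the potential `V_β`. -/
def VProf (d : ℕ) (α β r : ℝ) : ℝ :=
  2 ^ (α / 2) * Real.Gamma (((d : ℝ) - β) / 2) / Real.Gamma (((d : ℝ) - β - α) / 2) *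
    (besselK ((β + α) / 2) r / besselK (β / 2) r) * r ^ (-(α / 2))

/-- The potential `V_β(x)`. -/
def Vbeta (d : ℕ) (α β : ℝ) (x : Ed d) : ℝ := VProf d α β ‖x‖

/-- The Hardy constant `κ_β` for the fractional Laplacian. -/
def kappa (d : ℕ) (α β : ℝ) : ℝ :=
  2 ^ α * Real.Gamma ((β + α) / 2) * Real.Gamma (((d : ℝ) - β) / 2) /
    (Real.Gamma (β / 2) * Real.Gamma (((d : ℝ) - β - α) / 2))

/-- `h^m_β(x) = ∫_0^∞ t^{(d-α-β)/α} p^m(t,x,0) dt`. -/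
def hBetaM (d : ℕ) (α m β : ℝ) (x : Ed d) : ℝ :=
  ∫ t in Ioi (0 : ℝ), t ^ (((d : ℝ) - α - β) / α) * relKernel d α m t x 0

/-- `h_β = h^1_β`. -/
def hBeta (d : ℕ) (α β : ℝ) (x : Ed d) : ℝ := hBetaM d α 1 β x

/-- `V^m_β(x) = ((d-α-β)/α) h^m_{β+α}(x)/h^m_β(x)`. -/
def VbetaM (d : ℕ) (α m β : ℝ) (x : Ed d) : ℝ :=
  (((d : ℝ) - α - β) / α) * hBetaM d α m (β + α) x / hBetaM d α m β x

/-- The function `H⁰(t,x)`. -/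
def Hzero (d : ℕ) (α δ t : ℝ) (x : Ed d) : ℝ :=
  if δ ≤ ((d : ℝ) - α) / 2 then 1 + t ^ (δ / α) * ‖x‖ ^ (-δ)
  else 1 + t ^ (((d : ℝ) - α - δ) / α) * ‖x‖ ^ (-((d : ℝ) - α - δ))

/-- Density of the Lévy measure of the relativistic `α`-stable operator (mass 1). -/
def levyNu (d : ℕ) (α : ℝ) (x : Ed d) : ℝ :=
  2 ^ ((α - (d : ℝ)) / 2 + 1) * π ^ (-(d : ℝ) / 2) * |Real.Gamma (-α / 2)|⁻¹ *
    besselK (((d : ℝ) + α) / 2) ‖x‖ / ‖x‖ ^ (((d : ℝ) + α) / 2)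

open scoped ENNReal NNReal

namespace HardyAux

section Abstract

set_option linter.unusedSectionVars false

variable {E : Type*} [MeasurableSpace E]

/-- Extended nonnegative version of the perturbation series, with fixed starting point. -/
def mN (k : ℝ → E → E → ℝ≥0∞) (q : E → ℝ≥0∞) (μ : Measure E) (x : E) : ℕ → ℝ → E → ℝ≥0∞
  | 0 => fun t y => k t x y
  | n + 1 => fun t y => ∫⁻ s in Ioo (0 : ℝ) t, ∫⁻ z, mN k q μ x n s z * q z * k (t - s) z y ∂μ

/-- integral of `F` against the `n`-th term -/
def br (k : ℝ → E → E → ℝ≥0∞) (q : E → ℝ≥0∞) (μ : Measure E) (x : E) (n : ℕ) (F : E → ℝ≥0∞)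
    (t : ℝ) : ℝ≥0∞ := ∫⁻ y, mN k q μ x n t y * F y ∂μ

/-- time integral of `br` -/
def ib (k : ℝ → E → E → ℝ≥0∞) (q : E → ℝ≥0∞) (μ : Measure E) (x : E) (n : ℕ) (F : E → ℝ≥0∞)
    (t : ℝ) : ℝ≥0∞ := ∫⁻ s in Ioo (0 : ℝ) t, br k q μ x n F s

lemma meas_setLIntegral_Ioo {X : Type*} [MeasurableSpace X] {G : X → ℝ → ℝ≥0∞}
    (hG : Measurable (Function.uncurry G)) {τ : X → ℝ} (hτ : Measurable τ) :
    Measurable (fun p : X => ∫⁻ s in Ioo (0 : ℝ) (τ p), G p s) := by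
  have : (fun p : X => ∫⁻ s in Ioo (0 : ℝ) (τ p), G p s) =
      fun p : X => ∫⁻ s, {a : X × ℝ | 0 < a.2 ∧ a.2 < τ a.1}.indicator (Function.uncurry G) (p, s) := by
    ext p
    rw [← lintegral_indicator measurableSet_Ioo]
    congr 1
  rw [this]
  apply Measurable.lintegral_prod_right'
  apply hG.indicator
  exact (measurableSet_lt measurable_const measurable_snd).inter
    (measurableSet_lt measurable_snd (hτ.comp measurable_fst))

variable {k : ℝ → E → E → ℝ≥0∞} {q : E → ℝ≥0∞} {μ : Measure E} [SFinite μ] {x : E}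

lemma meas_mN (hk : Measurable fun p : ℝ × E × E => k p.1 p.2.1 p.2.2) (hq : Measurable q) (n : ℕ) :
    Measurable (fun p : ℝ × E => mN k q μ x n p.1 p.2) := by
  induction n with
  | zero =>
    simp only [mN]
    exact hk.comp (by fun_prop : Measurable fun p : ℝ × E => (p.1, x, p.2))
  | succ n ih =>
    simp only [mN]
    refine meas_setLIntegral_Ioo (X := ℝ × E)
      (G := fun p s => ∫⁻ z, mN k q μ x n s z * q z * k (p.1 - s) z p.2 ∂μ) ?_ measurable_fst
    apply Measurable.lintegral_prod_right'
      (f := fun a : ((ℝ × E) × ℝ) × E => mN k q μ x n a.1.2 a.2 * q a.2 * k (a.1.1.1 - a.1.2) a.2 a.1.1.2)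
    refine ((ih.comp (by fun_prop : Measurable fun a : ((ℝ × E) × ℝ) × E => (a.1.2, a.2))).mul
      (hq.comp measurable_snd)).mul
      (hk.comp (by fun_prop : Measurable fun a : ((ℝ × E) × ℝ) × E => (a.1.1.1 - a.1.2, a.2, a.1.1.2)))

lemma meas_br (hk : Measurable fun p : ℝ × E × E => k p.1 p.2.1 p.2.2) (hq : Measurable q) (n : ℕ)
    {F : E → ℝ≥0∞} (hF : Measurable F) : Measurable (br k q μ x n F) := by
  unfold br
  apply Measurable.lintegral_prod_right' (f := fun a : ℝ × E => mN k q μ x n a.1 a.2 * F a.2)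
  exact (meas_mN hk hq n).mul (hF.comp measurable_snd)

lemma meas_P (hk : Measurable fun p : ℝ × E × E => k p.1 p.2.1 p.2.2)
    {F : E → ℝ≥0∞} (hF : Measurable F) :
    Measurable (fun p : ℝ × E => ∫⁻ y, k p.1 p.2 y * F y ∂μ) := by
  apply Measurable.lintegral_prod_right' (f := fun a : (ℝ × E) × E => k a.1.1 a.1.2 a.2 * F a.2)
  exact (hk.comp (by fun_prop : Measurable fun a : (ℝ × E) × E => (a.1.1, a.1.2, a.2))).mul
    (hF.comp measurable_snd)

lemma br_succ (hk : Measurable fun p : ℝ × E × E => k p.1 p.2.1 p.2.2) (hq : Measurable q) (n : ℕ)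
    {F : E → ℝ≥0∞} (hF : Measurable F) (t : ℝ) :
    br k q μ x (n + 1) F t = ∫⁻ s in Ioo (0 : ℝ) t, ∫⁻ z, mN k q μ x n s z * q z *
      (∫⁻ y, k (t - s) z y * F y ∂μ) ∂μ := by
  have hm := meas_mN (μ := μ) (x := x) hk hq n
  have hj : Measurable (fun a : ((ℝ × E) × E) =>
      mN k q μ x n a.1.1 a.2 * q a.2 * k (t - a.1.1) a.2 a.1.2) := by
    refine ((hm.comp (by fun_prop : Measurable fun a : (ℝ × E) × E => (a.1.1, a.2))).mul
      (hq.comp measurable_snd)).mul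
      (hk.comp (by fun_prop : Measurable fun a : (ℝ × E) × E => (t - a.1.1, a.2, a.1.2)))
  have hj1 : Measurable (fun a : ℝ × E =>
      ∫⁻ z, mN k q μ x n a.1 z * q z * k (t - a.1) z a.2 ∂μ) := hj.lintegral_prod_right'
  unfold br
  simp only [mN]
  calc ∫⁻ y, (∫⁻ s in Ioo (0 : ℝ) t, ∫⁻ z, mN k q μ x n s z * q z * k (t - s) z y ∂μ) * F y ∂μ
      = ∫⁻ y, (∫⁻ s in Ioo (0 : ℝ) t, (∫⁻ z, mN k q μ x n s z * q z * k (t - s) z y ∂μ) * F y) ∂μ := by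
        congr 1; ext y
        rw [lintegral_mul_const]
        exact hj1.comp (by fun_prop : Measurable fun s : ℝ => (s, y))
    _ = ∫⁻ s in Ioo (0 : ℝ) t, ∫⁻ y, (∫⁻ z, mN k q μ x n s z * q z * k (t - s) z y ∂μ) * F y ∂μ := by
        rw [lintegral_lintegral_swap]
        apply Measurable.aemeasurable
        exact (hj1.comp measurable_swap).mul (hF.comp measurable_fst)
    _ = _ := by
        congr 1
        ext s
        have hs : Measurable (fun a : E × E => mN k q μ x n s a.2 * q a.2 * k (t - s) a.2 a.1) :=
          hj.comp (by fun_prop : Measurable fun a : E × E => ((s, a.1), a.2))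
        calc
        ∫⁻ y, (∫⁻ z, mN k q μ x n s z * q z * k (t - s) z y ∂μ) * F y ∂μ
          = ∫⁻ y, (∫⁻ z, mN k q μ x n s z * q z * k (t - s) z y * F y ∂μ) ∂μ := by
            congr 1; ext y
            rw [lintegral_mul_const]
            exact hs.comp (by fun_prop : Measurable fun z : E => (y, z))
        _ = ∫⁻ z, ∫⁻ y, mN k q μ x n s z * q z * k (t - s) z y * F y ∂μ ∂μ := by
            rw [lintegral_lintegral_swap]
            exact (hs.mul (hF.comp measurable_fst)).aemeasurable
        _ = _ := by
            congr 1; ext z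
            simp_rw [mul_assoc]
            rw [lintegral_const_mul, lintegral_const_mul]
            · exact ((hk.comp (by fun_prop : Measurable fun y : E => (t - s, z, y))).mul hF)
            · exact (((hk.comp (by fun_prop : Measurable fun y : E => (t - s, z, y))).mul hF)).const_mul _

/-- Triangular change of variables. -/
lemma tri_swap {H : ℝ → ℝ → ℝ≥0∞} (hH : Measurable (Function.uncurry H)) (t : ℝ) :
    ∫⁻ r in Ioo (0 : ℝ) t, ∫⁻ s in Ioo (0 : ℝ) r, H s (r - s) =
      ∫⁻ s in Ioo (0 : ℝ) t, ∫⁻ u in Ioo (0 : ℝ) (t - s), H s u := by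
  have e1 : ∀ r s : ℝ, (Ioo (0 : ℝ) t).indicator (fun r => (Ioo (0:ℝ) r).indicator (fun s => H s (r - s)) s) r
      = (Ioo (0:ℝ) t).indicator (fun s => (Ioo (0:ℝ) (t - s)).indicator (fun u => H s u) (r - s)) s := by
    intro r s
    simp only [indicator, mem_Ioo]
    by_cases h1 : 0 < s <;> by_cases h2 : s < r <;> by_cases h3 : r < t
    all_goals
      simp only [h1, h2, h3, true_and, and_true, false_and, and_false, if_false, ite_self, if_true]
      try split_ifs
    all_goals first | rfl | (exfalso; grind)
  calc _ = ∫⁻ r, ∫⁻ s, (Ioo (0 : ℝ) t).indicator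
        (fun r => (Ioo (0:ℝ) r).indicator (fun s => H s (r - s)) s) r := by
        rw [← lintegral_indicator measurableSet_Ioo]
        congr 1; ext r
        by_cases hr : r ∈ Ioo (0 : ℝ) t
        · simp only [indicator_of_mem hr]
          rw [← lintegral_indicator measurableSet_Ioo]
        · simp only [indicator_of_notMem hr]; simp
    _ = ∫⁻ r, ∫⁻ s, (Ioo (0:ℝ) t).indicator
        (fun s => (Ioo (0:ℝ) (t - s)).indicator (fun u => H s u) (r - s)) s := by
        simp_rw [e1]
    _ = ∫⁻ s, ∫⁻ r, (Ioo (0:ℝ) t).indicator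
        (fun s => (Ioo (0:ℝ) (t - s)).indicator (fun u => H s u) (r - s)) s := by
        rw [lintegral_lintegral_swap]
        apply Measurable.aemeasurable
        have : Measurable (fun p : ℝ × ℝ => ({p : ℝ × ℝ | (0 < p.2 ∧ p.2 < t) ∧ (0 < p.1 - p.2 ∧ p.1 - p.2 < t - p.2)}).indicator
           (fun p => H p.2 (p.1 - p.2)) p) := by
          apply Measurable.indicator
          · exact hH.comp (by fun_prop : Measurable fun p : ℝ × ℝ => (p.2, p.1 - p.2))
          · apply MeasurableSet.inter
            · exact (measurableSet_lt measurable_const measurable_snd).inter (measurableSet_lt measurable_snd measurable_const)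
            · exact (measurableSet_lt measurable_const (measurable_fst.sub measurable_snd)).inter (measurableSet_lt (measurable_fst.sub measurable_snd) (measurable_const.sub measurable_snd))
        convert this using 1
        ext ⟨r, s⟩
        simp only [Function.uncurry, indicator, mem_Ioo, mem_ofPred_eq]
        by_cases h1 : 0 < s ∧ s < t <;> simp [h1]
    _ = ∫⁻ s, (Ioo (0:ℝ) t).indicator (fun s => ∫⁻ u in Ioo (0:ℝ) (t - s), H s u) s := by
        congr 1; ext s
        by_cases hs : s ∈ Ioo (0 : ℝ) t
        · simp only [indicator_of_mem hs]
          rw [← lintegral_indicator measurableSet_Ioo]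
          exact lintegral_sub_right_eq_self (fun u => (Ioo (0:ℝ) (t - s)).indicator (fun u => H s u) u) s
        · simp only [indicator_of_notMem hs]; simp
    _ = _ := by rw [lintegral_indicator measurableSet_Ioo]

/-- Duhamel-type identity for each term. -/
lemma br_rel (hk : Measurable fun p : ℝ × E × E => k p.1 p.2.1 p.2.2) (hq : Measurable q)
    {f g : E → ℝ≥0∞} (hf : Measurable f) (hg : Measurable g)
    (hR : ∀ z, q z ≠ 0 → ∀ t > 0, (∫⁻ y, k t z y * f y ∂μ) +
      ∫⁻ r in Ioo (0 : ℝ) t, ∫⁻ y, k r z y * g y ∂μ = f z) (n : ℕ) (t : ℝ) :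
    br k q μ x (n + 1) f t + ib k q μ x (n + 1) g t = ib k q μ x n (fun z => q z * f z) t := by
  have hm := meas_mN (μ := μ) (x := x) hk hq n
  have hPf := meas_P (μ := μ) hk hf
  have hPg := meas_P (μ := μ) hk hg
  have hmq : Measurable (fun p : ℝ × E => mN k q μ x n p.1 p.2 * q p.2) :=
    hm.mul (hq.comp measurable_snd)
  have h1 := br_succ (μ := μ) (x := x) hk hq n hf t
  have h2 : ib k q μ x (n + 1) g t = ∫⁻ s in Ioo (0 : ℝ) t, ∫⁻ z, mN k q μ x n s z * q z *
      (∫⁻ u in Ioo (0 : ℝ) (t - s), ∫⁻ y, k u z y * g y ∂μ) ∂μ := by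
    unfold ib
    simp_rw [br_succ (μ := μ) (x := x) hk hq n hg]
    rw [tri_swap (H := fun s u => ∫⁻ z, mN k q μ x n s z * q z * (∫⁻ y, k u z y * g y ∂μ) ∂μ)]
    · congr 1; ext s
      rw [lintegral_lintegral_swap]
      · congr 1; ext z
        rw [lintegral_const_mul]
        exact hPg.comp (by fun_prop : Measurable fun u : ℝ => (u, z))
      · apply Measurable.aemeasurable
        exact (hmq.comp (by fun_prop : Measurable fun p : ℝ × E => (s, p.2))).mul hPg
    · apply Measurable.lintegral_prod_right' (f := fun a : (ℝ × ℝ) × E =>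
        mN k q μ x n a.1.1 a.2 * q a.2 * (∫⁻ y, k a.1.2 a.2 y * g y ∂μ))
      exact (hmq.comp (by fun_prop : Measurable fun a : (ℝ × ℝ) × E => (a.1.1, a.2))).mul
        (hPg.comp (by fun_prop : Measurable fun a : (ℝ × ℝ) × E => (a.1.2, a.2)))
  rw [h1, h2]
  unfold ib br
  rw [← lintegral_add_left]
  · apply setLIntegral_congr_fun measurableSet_Ioo
    intro s hs
    simp only
    rw [← lintegral_add_left]
    · congr 1; ext z
      rw [← mul_add]
      by_cases hz : q z = 0
      · simp [hz]
      · rw [hR z hz (t - s) (by linarith [hs.2]), mul_assoc]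
    · exact (hmq.comp (by fun_prop : Measurable fun z : E => (s, z))).mul
        (hPf.comp (by fun_prop : Measurable fun z : E => (t - s, z)))
  · apply Measurable.lintegral_prod_right' (f := fun a : ℝ × E =>
        mN k q μ x n a.1 a.2 * q a.2 * (∫⁻ y, k (t - a.1) a.2 y * f y ∂μ))
    exact hmq.mul (hPf.comp (by fun_prop : Measurable fun a : ℝ × E => (t - a.1, a.2)))

lemma br_rel_zero {f g : E → ℝ≥0∞}
    (hR : ∀ t > 0, (∫⁻ y, k t x y * f y ∂μ) +
      ∫⁻ r in Ioo (0 : ℝ) t, ∫⁻ y, k r x y * g y ∂μ = f x) (t : ℝ) (ht : 0 < t) :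
    br k q μ x 0 f t + ib k q μ x 0 g t = f x := by
  simpa [br, ib, mN] using hR t ht

/-- mass recursion -/
lemma br_one_succ_le (hk : Measurable fun p : ℝ × E × E => k p.1 p.2.1 p.2.2) (hq : Measurable q)
    (h1 : ∀ t > 0, ∀ z, ∫⁻ y, k t z y ∂μ ≤ 1) (n : ℕ) (t : ℝ) :
    br k q μ x (n + 1) (fun _ => 1) t ≤ ib k q μ x n q t := by
  rw [br_succ hk hq n measurable_const]
  unfold ib br
  apply setLIntegral_mono' measurableSet_Ioo
  intro s hs
  apply lintegral_mono
  intro z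
  simp only [mul_one]
  calc _ ≤ mN k q μ x n s z * q z * 1 := by gcongr; exact h1 _ (by linarith [hs.2]) z
    _ = _ := mul_one _

lemma br_mono (n : ℕ) {F G : E → ℝ≥0∞} (h : ∀ z, F z ≤ G z) (t : ℝ) :
    br k q μ x n F t ≤ br k q μ x n G t :=
  lintegral_mono fun z => by dsimp only; gcongr; exact h z

lemma ib_mono (n : ℕ) {F G : E → ℝ≥0∞} (h : ∀ z, F z ≤ G z) (t : ℝ) :
    ib k q μ x n F t ≤ ib k q μ x n G t :=
  lintegral_mono fun s => br_mono n h s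

lemma br_lin (hk : Measurable fun p : ℝ × E × E => k p.1 p.2.1 p.2.2) (hq : Measurable q)
    (n : ℕ) {F : E → ℝ≥0∞} (hF : Measurable F) (a b : ℝ≥0∞) (t : ℝ) :
    br k q μ x n (fun z => a * F z + b) t = a * br k q μ x n F t + b * br k q μ x n (fun _ => 1) t := by
  have hm : Measurable (fun z => mN k q μ x n t z) :=
    (meas_mN (μ := μ) (x := x) hk hq n).comp (by fun_prop : Measurable fun z : E => (t, z))
  have e1 : Measurable (fun z => mN k q μ x n t z * F z) := hm.mul hF
  have e2 : Measurable (fun z => mN k q μ x n t z * 1) := hm.mul measurable_const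
  unfold br
  rw [← lintegral_const_mul _ e1, ← lintegral_const_mul _ e2,
    ← lintegral_add_left (e1.const_mul _)]
  congr 1
  ext z
  ring

lemma ib_lin (hk : Measurable fun p : ℝ × E × E => k p.1 p.2.1 p.2.2) (hq : Measurable q)
    (n : ℕ) {F : E → ℝ≥0∞} (hF : Measurable F) (a b : ℝ≥0∞) (t : ℝ) :
    ib k q μ x n (fun z => a * F z + b) t = a * ib k q μ x n F t + b * ib k q μ x n (fun _ => 1) t := by
  unfold ib
  simp_rw [br_lin hk hq n hF]
  rw [lintegral_add_left ((meas_br hk hq n hF).const_mul _), lintegral_const_mul _ (meas_br hk hq n hF),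
    lintegral_const_mul _ (meas_br hk hq n measurable_const)]

end Abstract
end HardyAux

namespace HardyAux

lemma lintegral_exp_le (b : ℝ) (hb : 0 < b) (t : ℝ) (ht : 0 < t) :
    ∫⁻ s in Ioo (0 : ℝ) t, ENNReal.ofReal (exp (b * s)) ≤ ENNReal.ofReal (exp (b * t) / b) := by
  have hc : Continuous (fun s : ℝ => exp (b * s)) := by fun_prop
  rw [← ofReal_integral_eq_lintegral_ofReal]
  · apply ENNReal.ofReal_le_ofReal
    rw [← integral_Ioc_eq_integral_Ioo, ← intervalIntegral.integral_of_le ht.le]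
    rw [intervalIntegral.integral_comp_mul_left (fun u => exp u) hb.ne', integral_exp]
    simp only [smul_eq_mul, mul_zero, exp_zero]
    rw [div_eq_inv_mul]
    apply mul_le_mul_of_nonneg_left _ (by positivity)
    linarith
  · exact (hc.integrableOn_Icc (a := 0) (b := t)).mono_set Ioo_subset_Icc_self
  · exact ae_of_all _ fun s => (exp_pos _).le

lemma ennreal_half_cancel {s a : ℝ≥0∞} (hs : s ≠ ∞) (h : s ≤ a + s / 2) : s ≤ 2 * a := by
  by_cases ha : a = ∞
  · simp [ha]
  lift s to ℝ≥0 using hs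
  lift a to ℝ≥0 using ha
  have h2 : ((s : ℝ≥0∞) / 2) = ((s / 2 : ℝ≥0) : ℝ≥0∞) := by simp
  rw [h2] at h
  norm_cast at h ⊢
  have h' : (s : ℝ) ≤ a + s / 2 := by exact_mod_cast h
  have : (s : ℝ) ≤ 2 * a := by linarith
  exact_mod_cast this

lemma gronwall {M : ℝ → ℝ≥0∞} {T : ℝ} {B a : ℝ≥0∞} {b : ℝ≥0} (hB : B ≠ ∞)
    (hM : ∀ t ∈ Ioc (0 : ℝ) T, M t ≤ B)
    (h : ∀ t ∈ Ioc (0 : ℝ) T, M t ≤ a + b * ∫⁻ s in Ioo (0 : ℝ) t, M s) :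
    ∀ t ∈ Ioc (0 : ℝ) T, M t ≤ 2 * a * ENNReal.ofReal (exp (2 * b * t)) := by
  rcases eq_or_ne b 0 with hb0 | hb0
  · intro t ht
    have := h t ht
    simp only [hb0, ENNReal.coe_zero, zero_mul, add_zero] at this
    simp only [hb0, NNReal.coe_zero, mul_zero, zero_mul, exp_zero, ENNReal.ofReal_one, mul_one]
    exact this.trans (by rw [two_mul]; exact le_self_add)
  have hb : (0 : ℝ) < b := by positivity
  set S : ℝ≥0∞ := ⨆ t ∈ Ioc (0 : ℝ) T, M t * ENNReal.ofReal (exp (-(2 * b * t))) with hS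
  have hexp : ∀ t : ℝ, ENNReal.ofReal (exp (-(2 * b * t))) * ENNReal.ofReal (exp (2 * b * t)) = 1 := by
    intro t
    rw [← ENNReal.ofReal_mul (exp_pos _).le, ← exp_add]; simp
  have hle : ∀ t ∈ Ioc (0 : ℝ) T, M t ≤ S * ENNReal.ofReal (exp (2 * b * t)) := by
    intro t ht
    calc M t = M t * ENNReal.ofReal (exp (-(2 * b * t))) * ENNReal.ofReal (exp (2 * b * t)) := by
          rw [mul_assoc, hexp, mul_one]
      _ ≤ _ := by
          gcongr
          exact le_iSup₂ (f := fun t _ => M t * ENNReal.ofReal (exp (-(2 * b * t)))) t ht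
  have hSB : S ≤ B := by
    refine iSup₂_le fun t ht => ?_
    calc _ ≤ B * 1 := by
          gcongr
          · exact hM t ht
          · rw [← ENNReal.ofReal_one]
            apply ENNReal.ofReal_le_ofReal
            rw [exp_le_one_iff]
            have := ht.1
            have : 0 ≤ 2 * b * t := by positivity
            linarith
      _ = B := mul_one _
  have hSfin : S ≠ ∞ := ne_top_of_le_ne_top hB hSB
  have hS2 : S ≤ a + S / 2 := by
    refine iSup₂_le fun t ht => ?_
    have hIntg : ∫⁻ s in Ioo (0 : ℝ) t, M s ≤ S * ENNReal.ofReal (exp (2 * b * t) / (2 * b)) := by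
      calc ∫⁻ s in Ioo (0 : ℝ) t, M s ≤ ∫⁻ s in Ioo (0 : ℝ) t, S * ENNReal.ofReal (exp (2 * b * s)) := by
            apply setLIntegral_mono' measurableSet_Ioo
            intro s hs
            exact hle s ⟨hs.1, hs.2.le.trans ht.2⟩
        _ = S * ∫⁻ s in Ioo (0 : ℝ) t, ENNReal.ofReal (exp (2 * b * s)) := by
            rw [lintegral_const_mul]
            fun_prop
        _ ≤ _ := by
            gcongr
            exact lintegral_exp_le _ (by positivity) t ht.1
    calc M t * ENNReal.ofReal (exp (-(2 * b * t)))
        ≤ (a + b * (S * ENNReal.ofReal (exp (2 * b * t) / (2 * b)))) *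
            ENNReal.ofReal (exp (-(2 * b * t))) := by
          gcongr
          exact (h t ht).trans (by gcongr)
      _ = a * ENNReal.ofReal (exp (-(2 * b * t))) + S * (b * ENNReal.ofReal (exp (2 * b * t) / (2 * b)) *
            ENNReal.ofReal (exp (-(2 * b * t)))) := by ring
      _ ≤ a * 1 + S * 2⁻¹ := by
          gcongr
          · rw [← ENNReal.ofReal_one]
            apply ENNReal.ofReal_le_ofReal
            rw [exp_le_one_iff]
            have := ht.1
            have : 0 ≤ 2 * b * t := by positivity
            linarith
          · rw [← ENNReal.ofReal_coe_nnreal, ← ENNReal.ofReal_mul hb.le, ← ENNReal.ofReal_mul (by positivity)]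
            have : (b : ℝ) * (exp (2 * b * t) / (2 * b)) * exp (-(2 * b * t)) = 2⁻¹ := by
              rw [exp_neg]
              field_simp
            rw [this, ENNReal.ofReal_inv_of_pos (by norm_num)]
            simp
      _ = a + S / 2 := by rw [mul_one, div_eq_mul_inv]
  intro t ht
  exact (hle t ht).trans (by gcongr; exact ennreal_half_cancel hSfin hS2)

variable {E : Type*} [MeasurableSpace E]
variable {k : ℝ → E → E → ℝ≥0∞} {q : E → ℝ≥0∞} {μ : Measure E} [SFinite μ] {x : E}

/-- The key estimate for a damped series. -/
theorem abstract_main_damped (hk : Measurable fun p : ℝ × E × E => k p.1 p.2.1 p.2.2)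
    (hq : Measurable q) (h1 : ∀ t > 0, ∀ z, ∫⁻ y, k t z y ∂μ ≤ 1)
    {f g h gh : E → ℝ≥0∞} (hf : Measurable f) (hg : Measurable g) (hh : Measurable h)
    (hgh : Measurable gh)
    (hRf : ∀ z, q z ≠ 0 → ∀ t > 0, (∫⁻ y, k t z y * f y ∂μ) +
      ∫⁻ r in Ioo (0 : ℝ) t, ∫⁻ y, k r z y * g y ∂μ = f z)
    (hRh : ∀ z, (z = x ∨ q z ≠ 0) → ∀ t > 0, (∫⁻ y, k t z y * h y ∂μ) +
      ∫⁻ r in Ioo (0 : ℝ) t, ∫⁻ y, k r z y * gh y ∂μ = h z)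
    (hqh : ∀ z, q z * h z ≤ gh z) (hx : h x ≠ ∞) (C2 C3 K1 K2 K3 K4 : ℝ≥0)
    (i1 : ∀ z, g z ≤ (4⁻¹ : ℝ≥0) * (q z * f z) + C3)
    (i2 : ∀ z, q z * f z ≤ C2 * (q z * h z) + C2)
    (i2' : ∀ z, q z ≤ C2 * (q z * h z) + C2)
    (i3 : ∀ z, q z ≤ K2 * (q z * f z) + K1)
    (i4 : ∀ z, f z ≤ K3 * h z + K4) (i5 : 4 * K2 * K4 ≤ 1 / 2)
    (η : ℝ≥0) (hη : 1 / 2 ≤ η) (hη1 : η < 1) (t : ℝ) (ht : 0 < t) :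
    ∑' n, (η : ℝ≥0∞) ^ n * br k q μ x n (fun _ => 1) t ≤
      2 * (2 * (1 + 4 * K2 * K3 * h x)) * ENNReal.ofReal (exp (2 * (2 * (K1 + 4 * K2 * C3) : ℝ≥0) * t)) := by
  have hqhm : Measurable (fun z => q z * h z) := hq.mul hh
  have hqfm : Measurable (fun z => q z * f z) := hq.mul hf
  -- step 1
  have s1 : ∀ n, ∀ t > 0, ib k q μ x n (fun z => q z * h z) t ≤ h x := by
    intro n
    induction n with
    | zero =>
      intro t ht
      refine (ib_mono 0 hqh t).trans ?_
      rw [← br_rel_zero (k := k) (q := q) (μ := μ) (fun t ht => hRh x (Or.inl rfl) t ht) t ht]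
      exact le_add_self
    | succ n ih =>
      intro t ht
      refine (ib_mono (n + 1) hqh t).trans (le_trans ?_ (ih t ht))
      rw [← br_rel (x := x) hk hq hh hgh (fun z hz t ht => hRh z (Or.inr hz) t ht) n t]
      exact le_add_self
  set A : ℝ≥0∞ := h x * (1 - (η : ℝ≥0∞))⁻¹ with hA
  have hAfin : A ≠ ∞ := by
    apply ENNReal.mul_ne_top hx
    apply ENNReal.inv_ne_top.2
    have : (η : ℝ≥0∞) < 1 := by exact_mod_cast hη1
    exact (tsub_pos_of_lt this).ne'
  have s1' : ∀ t > 0, ∑' n, (η : ℝ≥0∞) ^ n * ib k q μ x n (fun z => q z * h z) t ≤ A := by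
    intro t ht
    calc _ ≤ ∑' n, (η : ℝ≥0∞) ^ n * h x := by
          apply ENNReal.tsum_le_tsum; intro n; gcongr; exact s1 n t ht
      _ = A := by rw [ENNReal.tsum_mul_right, ENNReal.tsum_geometric, mul_comm]
  -- step 2
  have s2 : ∀ t > 0, ∑' n, (η : ℝ≥0∞) ^ n * br k q μ x n h t ≤ h x := by
    intro t ht
    have key : (∑' n, (η : ℝ≥0∞) ^ n * br k q μ x n h t) +
        ∑' n, (η : ℝ≥0∞) ^ n * ib k q μ x n (fun z => q z * h z) t ≤
        h x + ∑' n, (η : ℝ≥0∞) ^ n * ib k q μ x n (fun z => q z * h z) t := by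
      rw [← ENNReal.tsum_add, tsum_eq_zero_add' ENNReal.summable]
      apply add_le_add
      · simp only [pow_zero, one_mul]
        rw [← br_rel_zero (k := k) (q := q) (μ := μ) (fun t ht => hRh x (Or.inl rfl) t ht) t ht]
        gcongr
        exact ib_mono 0 hqh t
      · apply ENNReal.tsum_le_tsum
        intro n
        rw [← mul_add]
        have : (η : ℝ≥0∞) ^ (n + 1) ≤ (η : ℝ≥0∞) ^ n := by
          rw [pow_succ]
          calc _ ≤ (η : ℝ≥0∞) ^ n * 1 := by gcongr; exact_mod_cast hη1.le
            _ = _ := mul_one _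
        gcongr
        rw [← br_rel (x := x) hk hq hh hgh (fun z hz t ht => hRh z (Or.inr hz) t ht) n t]
        gcongr
        exact ib_mono (n + 1) hqh t
    exact (ENNReal.add_le_add_iff_right (ne_top_of_le_ne_top hAfin (s1' t ht))).1 key
  -- step 3
  have hq_le : ∀ n, ∀ t > 0, ib k q μ x n q t ≤ C2 * ib k q μ x n (fun z => q z * h z) t +
      C2 * ib k q μ x n (fun _ => 1) t := by
    intro n t ht
    rw [← ib_lin hk hq n hqhm]
    exact ib_mono n i2' t
  have b0 : ∀ t > 0, br k q μ x 0 (fun _ => 1) t ≤ 1 := by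
    intro t ht
    simp only [br, mN, mul_one]
    exact h1 t ht x
  have s3 : ∀ n, ∃ B : ℝ≥0∞, B ≠ ∞ ∧ ∀ s ∈ Ioc (0 : ℝ) t, br k q μ x n (fun _ => 1) s ≤ B := by
    intro n
    induction n with
    | zero => exact ⟨1, by simp, fun s hs => b0 s hs.1⟩
    | succ n ih =>
      obtain ⟨B, hB, hB'⟩ := ih
      refine ⟨C2 * h x + C2 * (B * ENNReal.ofReal t), ?_, ?_⟩
      · finiteness
      · intro s hs
        refine (br_one_succ_le hk hq h1 n s).trans ((hq_le n s hs.1).trans ?_)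
        gcongr
        · exact s1 n s hs.1
        · unfold ib
          calc _ ≤ ∫⁻ r in Ioo (0 : ℝ) s, B := by
                apply setLIntegral_mono' measurableSet_Ioo
                intro r hr
                exact hB' r ⟨hr.1, hr.2.le.trans hs.2⟩
            _ = B * ENNReal.ofReal s := by simp
            _ ≤ _ := by gcongr; exact hs.2
  -- step 4
  set M : ℝ → ℝ≥0∞ := fun s => ∑' n, (η : ℝ≥0∞) ^ n * br k q μ x n (fun _ => 1) s with hMdef
  have mbr : ∀ n, Measurable (br k q μ x n (fun _ => 1)) := fun n => meas_br hk hq n measurable_const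
  have s4 : ∀ s ∈ Ioc (0 : ℝ) t, M s ≤ 2 * (1 + C2 * A) * ENNReal.ofReal (exp (2 * C2 * t)) := by
    have hN : ∀ N : ℕ, ∀ s ∈ Ioc (0 : ℝ) t, ∑ n ∈ Finset.range N, (η : ℝ≥0∞) ^ n * br k q μ x n (fun _ => 1) s
        ≤ 2 * (1 + C2 * A) * ENNReal.ofReal (exp (2 * C2 * s)) := by
      intro N
      choose B hB hB' using s3
      apply gronwall (B := ∑ n ∈ Finset.range N, (η : ℝ≥0∞) ^ n * B n)
      · rw [ENNReal.sum_ne_top]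
        intro n _
        exact ENNReal.mul_ne_top (by finiteness) (hB n)
      · intro s hs
        apply Finset.sum_le_sum
        intro n _
        gcongr
        exact hB' n s hs
      · intro s hs
        rw [lintegral_finsetSum _ (fun n _ => (mbr n).const_mul _)]
        simp_rw [lintegral_const_mul _ (mbr _)]
        change _ ≤ 1 + C2 * A + C2 * ∑ n ∈ Finset.range N, (η : ℝ≥0∞) ^ n * ib k q μ x n (fun _ => 1) s
        have hle : ∑ n ∈ Finset.range N, (η : ℝ≥0∞) ^ n * ib k q μ x n (fun z => q z * h z) s ≤ A :=
          (ENNReal.sum_le_tsum _).trans (s1' s hs.1)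
        refine le_trans ?_ (add_le_add_left (add_le_add_right (mul_le_mul_right hle _) _) _)
        rw [add_assoc, ← mul_add, ← Finset.sum_add_distrib, Finset.mul_sum]
        rcases N with _ | N
        · simp
        · rw [Finset.sum_range_succ']
          rw [add_comm]
          apply add_le_add
          · simpa using b0 s hs.1
          · rw [Finset.sum_range_succ]
            refine le_trans (Finset.sum_le_sum ?_) le_self_add
            intro n _
            have : (η : ℝ≥0∞) ^ (n + 1) ≤ (η : ℝ≥0∞) ^ n := by
              rw [pow_succ]
              calc _ ≤ (η : ℝ≥0∞) ^ n * 1 := by gcongr; exact_mod_cast hη1.le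
                _ = _ := mul_one _
            calc _ ≤ (η : ℝ≥0∞) ^ n * (C2 * ib k q μ x n (fun z => q z * h z) s +
                  C2 * ib k q μ x n (fun _ => 1) s) := by
                  gcongr
                  exact (br_one_succ_le hk hq h1 n s).trans (hq_le n s hs.1)
              _ = _ := by ring
    intro s hs
    rw [hMdef]
    dsimp only
    rw [ENNReal.tsum_eq_iSup_nat]
    refine iSup_le fun N => (hN N s hs).trans ?_
    gcongr
    exact hs.2
  set MB := 2 * (1 + C2 * A) * ENNReal.ofReal (exp (2 * C2 * t)) with hMB
  have hMBfin : MB ≠ ∞ := by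
    rw [hMB]
    finiteness
  -- step 5
  refine gronwall (T := t) (B := MB) (M := M) hMBfin s4 ?_ t ⟨ht, le_rfl⟩
  intro s hs
  have hMi : ∫⁻ r in Ioo (0 : ℝ) s, M r = ∑' n, (η : ℝ≥0∞) ^ n * ib k q μ x n (fun _ => 1) s := by
    rw [hMdef]
    dsimp only
    rw [lintegral_tsum (fun n => ((mbr n).const_mul _).aemeasurable)]
    congr 1
    ext n
    rw [lintegral_const_mul _ (mbr _)]
    rfl
  have hMifin : ∫⁻ r in Ioo (0 : ℝ) s, M r ≠ ∞ := by
    have : ∫⁻ r in Ioo (0 : ℝ) s, M r ≤ MB * ENNReal.ofReal s := by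
      calc _ ≤ ∫⁻ r in Ioo (0 : ℝ) s, MB := by
            apply setLIntegral_mono' measurableSet_Ioo
            intro r hr
            exact s4 r ⟨hr.1, hr.2.le.trans hs.2⟩
        _ = MB * ENNReal.ofReal s := by simp
    exact ne_top_of_le_ne_top (by finiteness) this
  set Mi := ∫⁻ r in Ioo (0 : ℝ) s, M r with hMidef
  set X := ∑' n, (η : ℝ≥0∞) ^ n * ib k q μ x n (fun z => q z * f z) s with hX
  set Bf := ∑' n, (η : ℝ≥0∞) ^ n * br k q μ x n f s with hBf
  have hMs : M s ≠ ∞ := ne_top_of_le_ne_top hMBfin (s4 s hs)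
  have e1 : Bf ≤ K3 * h x + K4 * M s := by
    calc Bf ≤ ∑' n, (η : ℝ≥0∞) ^ n * (K3 * br k q μ x n h s + K4 * br k q μ x n (fun _ => 1) s) := by
          apply ENNReal.tsum_le_tsum
          intro n
          gcongr
          rw [← br_lin hk hq n hh]
          exact br_mono n i4 s
      _ = K3 * (∑' n, (η : ℝ≥0∞) ^ n * br k q μ x n h s) + K4 * M s := by
          rw [hMdef]
          dsimp only
          rw [← ENNReal.tsum_mul_left, ← ENNReal.tsum_mul_left, ← ENNReal.tsum_add]
          congr 1; ext n; ring
      _ ≤ _ := by gcongr; exact s2 s hs.1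
  have e2 : X ≤ C2 * A + C2 * Mi := by
    calc X ≤ ∑' n, (η : ℝ≥0∞) ^ n * (C2 * ib k q μ x n (fun z => q z * h z) s + C2 * ib k q μ x n (fun _ => 1) s) := by
          apply ENNReal.tsum_le_tsum
          intro n
          gcongr
          rw [← ib_lin hk hq n hqhm]
          exact ib_mono n i2 s
      _ = C2 * (∑' n, (η : ℝ≥0∞) ^ n * ib k q μ x n (fun z => q z * h z) s) + C2 * Mi := by
          rw [hMi]
          rw [← ENNReal.tsum_mul_left, ← ENNReal.tsum_mul_left, ← ENNReal.tsum_add]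
          congr 1; ext n; ring
      _ ≤ _ := by gcongr; exact s1' s hs.1
  have e3 : η * X ≤ Bf + ((4⁻¹ : ℝ≥0) * X + C3 * Mi) := by
    calc η * X = ∑' n, (η : ℝ≥0∞) ^ (n + 1) * (br k q μ x (n + 1) f s + ib k q μ x (n + 1) g s) := by
          rw [hX, ← ENNReal.tsum_mul_left]
          congr 1; ext n
          rw [br_rel (x := x) hk hq hf hg hRf n s]
          ring
      _ ≤ ∑' n, (η : ℝ≥0∞) ^ n * (br k q μ x n f s + ib k q μ x n g s) := by
          rw [tsum_eq_zero_add' (f := fun n => (η : ℝ≥0∞) ^ n * (br k q μ x n f s + ib k q μ x n g s)) ENNReal.summable]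
          exact le_add_self
      _ ≤ ∑' n, (η : ℝ≥0∞) ^ n * (br k q μ x n f s + ((4⁻¹ : ℝ≥0) * ib k q μ x n (fun z => q z * f z) s + C3 * ib k q μ x n (fun _ => 1) s)) := by
          apply ENNReal.tsum_le_tsum
          intro n
          gcongr
          rw [← ib_lin hk hq n hqfm]
          exact ib_mono n i1 s
      _ = _ := by
          rw [hMi, hX, hBf, ← ENNReal.tsum_mul_left, ← ENNReal.tsum_mul_left, ← ENNReal.tsum_add, ← ENNReal.tsum_add]
          congr 1; ext n; ring
  have e4 : M s ≤ 1 + (K2 * X + K1 * Mi) := by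
    calc M s = (η : ℝ≥0∞) ^ 0 * br k q μ x 0 (fun _ => 1) s + ∑' n, (η : ℝ≥0∞) ^ (n + 1) * br k q μ x (n + 1) (fun _ => 1) s := by
          rw [hMdef]
          dsimp only
          rw [tsum_eq_zero_add' ENNReal.summable]
      _ ≤ 1 + ∑' n, (η : ℝ≥0∞) ^ n * (K2 * ib k q μ x n (fun z => q z * f z) s + K1 * ib k q μ x n (fun _ => 1) s) := by
          apply add_le_add
          · simpa using b0 s hs.1
          · apply ENNReal.tsum_le_tsum
            intro n
            have : (η : ℝ≥0∞) ^ (n + 1) ≤ (η : ℝ≥0∞) ^ n := by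
              rw [pow_succ]
              calc _ ≤ (η : ℝ≥0∞) ^ n * 1 := by gcongr; exact_mod_cast hη1.le
                _ = _ := mul_one _
            gcongr
            refine (br_one_succ_le hk hq h1 n s).trans ?_
            rw [← ib_lin hk hq n hqfm]
            exact ib_mono n i3 s
      _ = _ := by
          rw [hMi, hX, ← ENNReal.tsum_mul_left, ← ENNReal.tsum_mul_left, ← ENNReal.tsum_add]
          congr 2; ext n; ring
  have hXfin : X ≠ ∞ := ne_top_of_le_ne_top (by finiteness) e2
  have hBfin : Bf ≠ ∞ := ne_top_of_le_ne_top (by finiteness) e1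
  clear_value X Bf Mi
  generalize M s = m at *
  generalize h x = hx0 at *
  lift X to ℝ≥0 using hXfin
  lift Bf to ℝ≥0 using hBfin
  lift m to ℝ≥0 using hMs
  lift Mi to ℝ≥0 using hMifin
  lift hx0 to ℝ≥0 using hx
  norm_cast at e1 e3 e4 ⊢
  rw [← NNReal.coe_le_coe] at e1 e3 e4 i5 hη ⊢
  push_cast at e1 e3 e4 i5 hη ⊢
  have hX0 : (0 : ℝ) ≤ X := X.2
  have hK2 : (0 : ℝ) ≤ K2 := K2.2
  have hm : (0 : ℝ) ≤ m := m.2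
  have f1 : (X : ℝ) ≤ 4 * (Bf + C3 * Mi) := by nlinarith
  have f2 : (K2 : ℝ) * X ≤ K2 * (4 * (K3 * hx0 + K4 * m + C3 * Mi)) := by
    apply mul_le_mul_of_nonneg_left _ hK2
    linarith
  have f3 : 4 * (K2 : ℝ) * K4 * m ≤ 1 / 2 * m := mul_le_mul_of_nonneg_right i5 hm
  nlinarith

theorem abstract_main (hk : Measurable fun p : ℝ × E × E => k p.1 p.2.1 p.2.2)
    (hq : Measurable q) (h1 : ∀ t > 0, ∀ z, ∫⁻ y, k t z y ∂μ ≤ 1)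
    {f g h gh : E → ℝ≥0∞} (hf : Measurable f) (hg : Measurable g) (hh : Measurable h)
    (hgh : Measurable gh)
    (hRf : ∀ z, q z ≠ 0 → ∀ t > 0, (∫⁻ y, k t z y * f y ∂μ) +
      ∫⁻ r in Ioo (0 : ℝ) t, ∫⁻ y, k r z y * g y ∂μ = f z)
    (hRh : ∀ z, (z = x ∨ q z ≠ 0) → ∀ t > 0, (∫⁻ y, k t z y * h y ∂μ) +
      ∫⁻ r in Ioo (0 : ℝ) t, ∫⁻ y, k r z y * gh y ∂μ = h z)
    (hqh : ∀ z, q z * h z ≤ gh z) (hx : h x ≠ ∞) (C2 C3 K1 K2 K3 K4 : ℝ≥0)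
    (i1 : ∀ z, g z ≤ (4⁻¹ : ℝ≥0) * (q z * f z) + C3)
    (i2 : ∀ z, q z * f z ≤ C2 * (q z * h z) + C2)
    (i2' : ∀ z, q z ≤ C2 * (q z * h z) + C2)
    (i3 : ∀ z, q z ≤ K2 * (q z * f z) + K1)
    (i4 : ∀ z, f z ≤ K3 * h z + K4) (i5 : 4 * K2 * K4 ≤ 1 / 2)
    (t : ℝ) (ht : 0 < t) :
    ∑' n, br k q μ x n (fun _ => 1) t ≤
      2 * (2 * (1 + 4 * K2 * K3 * h x)) * ENNReal.ofReal (exp (2 * (2 * (K1 + 4 * K2 * C3) : ℝ≥0) * t)) := by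
  set R := 2 * (2 * (1 + 4 * K2 * K3 * h x)) * ENNReal.ofReal (exp (2 * (2 * (K1 + 4 * K2 * C3) : ℝ≥0) * t))
  rw [ENNReal.tsum_eq_iSup_nat]
  refine iSup_le fun N => ?_
  have htend : Tendsto (fun η : ℝ≥0 => ∑ n ∈ Finset.range N, (η : ℝ≥0∞) ^ n * br k q μ x n (fun _ => 1) t)
      (nhdsWithin 1 (Iio 1)) (nhds (∑ n ∈ Finset.range N, ((1 : ℝ≥0) : ℝ≥0∞) ^ n * br k q μ x n (fun _ => 1) t)) := by
    apply tendsto_finsetSum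
    intro n _
    apply ENNReal.Tendsto.mul_const
    · apply ENNReal.Tendsto.pow
      exact (ENNReal.tendsto_coe.2 tendsto_id).mono_left nhdsWithin_le_nhds
    · left; simp
  simp only [ENNReal.coe_one, one_pow, one_mul] at htend
  have hne : (nhdsWithin (1 : ℝ≥0) (Iio 1)).NeBot := nhdsLT_neBot_of_exists_lt ⟨0, by simp⟩
  refine le_of_tendsto htend ?_
  have hev : ∀ᶠ η : ℝ≥0 in nhdsWithin 1 (Iio 1), 1 / 2 ≤ η := by
    apply mem_nhdsWithin_of_mem_nhds
    apply Ici_mem_nhds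
    exact NNReal.half_lt_self one_ne_zero
  filter_upwards [hev, self_mem_nhdsWithin] with η h2 h3
  refine (ENNReal.sum_le_tsum _).trans ?_
  exact abstract_main_damped hk hq h1 hf hg hh hgh hRf hRh hqh hx C2 C3 K1 K2 K3 K4 i1 i2 i2' i3 i4 i5 η h2 h3 t ht

end HardyAux

namespace HardyAux

/-- Nonnegative power series on `[0,1)`. -/
def PS (G : ℝ → ℝ≥0∞) : Prop :=
  ∃ a : ℕ → ℝ≥0∞, ∀ y ∈ Ico (0 : ℝ) 1, ∑' k, a k * ENNReal.ofReal y ^ k = G y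

lemma PS.one : PS (fun _ => 1) := by
  refine ⟨fun k => if k = 0 then 1 else 0, fun y _ => ?_⟩
  rw [tsum_eq_single 0]
  · simp
  · intro b hb; simp [hb]

lemma PS.mul {G H : ℝ → ℝ≥0∞} (hG : PS G) (hH : PS H) : PS (fun y => G y * H y) := by
  obtain ⟨a, ha⟩ := hG
  obtain ⟨b, hb⟩ := hH
  refine ⟨fun n => ∑ p ∈ Finset.HasAntidiagonal.antidiagonal n, a p.1 * b p.2, fun y hy => ?_⟩
  beta_reduce
  rw [← ha y hy, ← hb y hy]
  set Y := ENNReal.ofReal y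
  have : (∑' i, a i * Y ^ i) * (∑' j, b j * Y ^ j) =
      ∑' p : ℕ × ℕ, (a p.1 * Y ^ p.1) * (b p.2 * Y ^ p.2) := by
    rw [ENNReal.tsum_prod (f := fun i j => (a i * Y ^ i) * (b j * Y ^ j)), ← ENNReal.tsum_mul_right]
    refine tsum_congr fun i => ?_
    rw [ENNReal.tsum_mul_left]
  rw [this, ← Finset.HasAntidiagonal.sigmaAntidiagonalEquivProd.tsum_eq, ENNReal.tsum_sigma']
  refine tsum_congr fun n => ?_
  rw [tsum_fintype, Finset.sum_mul, Finset.univ_eq_attach,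
    ← Finset.sum_attach (Finset.HasAntidiagonal.antidiagonal n)]
  refine Finset.sum_congr rfl fun p _ => ?_
  have hp := Finset.HasAntidiagonal.mem_antidiagonal.1 p.2
  simp only [Finset.HasAntidiagonal.sigmaAntidiagonalEquivProd_apply]
  have hY : Y ^ n = Y ^ p.1.1 * Y ^ p.1.2 := by rw [← pow_add, hp]
  rw [hY]; ring

lemma PS.pow {G : ℝ → ℝ≥0∞} (hG : PS G) (n : ℕ) : PS (fun y => G y ^ n) := by
  induction n with
  | zero => simpa using PS.one
  | succ n ih => simpa [pow_succ] using ih.mul hG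

lemma PS.tsum {G : ℕ → ℝ → ℝ≥0∞} (hG : ∀ n, PS (G n)) (c : ℕ → ℝ≥0∞) :
    PS (fun y => ∑' n, c n * G n y) := by
  choose a ha using hG
  refine ⟨fun k => ∑' n, c n * a n k, fun y hy => ?_⟩
  simp_rw [← ENNReal.tsum_mul_right]
  rw [ENNReal.tsum_comm]
  refine tsum_congr fun n => ?_
  rw [← ha n y hy, ← ENNReal.tsum_mul_left]
  refine tsum_congr fun k => ?_
  ring

lemma choose_succ_mul (θ : ℝ) (k : ℕ) :
    ((k : ℝ) + 1) * Ring.choose θ (k + 1) = (θ - k) * Ring.choose θ k := by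
  rw [Ring.choose_eq_smul, Ring.choose_eq_smul, descPochhammer_succ_right,
    Polynomial.smeval_mul]
  have : (Polynomial.X - (k : Polynomial ℤ)).smeval θ = θ - k := by
    rw [Polynomial.smeval_sub, Polynomial.smeval_X, Polynomial.smeval_natCast]
    simp
  rw [this, Nat.factorial_succ]
  have h := Nat.factorial_ne_zero k
  push_cast
  simp only [smul_eq_mul]
  field_simp

lemma choose_sign (θ : ℝ) (h0 : 0 < θ) (h1 : θ < 1) (k : ℕ) :
    0 ≤ -(Ring.choose θ (k + 1) * (-1) ^ (k + 1)) := by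
  induction k with
  | zero => simp; exact h0.le
  | succ k ih =>
    have := choose_succ_mul θ (k + 1)
    have hk : (0 : ℝ) < ((k + 1 : ℕ) : ℝ) + 1 := by positivity
    have e : Ring.choose θ (k + 1 + 1) = (θ - (k + 1 : ℕ)) * Ring.choose θ (k + 1) /
      (((k + 1 : ℕ) : ℝ) + 1) := by
      rw [eq_div_iff hk.ne', ← this]; ring
    rw [e, pow_succ]
    have : -((θ - (k + 1 : ℕ)) * Ring.choose θ (k + 1) /
      (((k + 1 : ℕ) : ℝ) + 1) * ((-1) ^ (k + 1) * -1)) =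
      ((k + 1 : ℕ) - θ) / (((k + 1 : ℕ) : ℝ) + 1) * -(Ring.choose θ (k + 1) * (-1) ^ (k + 1)) := by
      ring
    rw [this]
    apply mul_nonneg _ ih
    apply div_nonneg _ hk.le
    push_cast
    have : (0 : ℝ) ≤ k := by positivity
    linarith

lemma PS.one_sub_rpow (θ : ℝ) (h0 : 0 < θ) (h1 : θ < 1) :
    PS (fun y => ENNReal.ofReal (1 - (1 - y) ^ θ)) := by
  refine ⟨fun k => if k = 0 then 0 else ENNReal.ofReal (-(Ring.choose θ k * (-1) ^ k)), fun y hy => ?_⟩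
  have hs := (Real.one_add_rpow_hasFPowerSeriesOnBall_zero (a := θ)).hasSum (y := -y) (by
    simp [abs_of_nonneg hy.1, hy.2, enorm_eq_nnnorm, Real.nnnorm_of_nonneg hy.1]
    exact hy.2)
  simp only [binomialSeries_apply, List.ofFn_const, List.prod_replicate, smul_eq_mul, zero_add] at hs
  have hs2 := (hasSum_nat_add_iff' 1).2 hs
  simp only [Finset.range_one, Finset.sum_singleton, pow_zero, mul_one, Ring.choose_zero_right] at hs2
  have hs3 := hs2.neg
  rw [tsum_eq_zero_add' ENNReal.summable]
  simp only [if_true, zero_mul, zero_add, Nat.add_eq_zero_iff, one_ne_zero, and_false, if_false]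
  have e : ∀ k : ℕ, ENNReal.ofReal (-(Ring.choose θ (k+1) * (-1) ^ (k+1))) * ENNReal.ofReal y ^ (k+1)
    = ENNReal.ofReal (-(Ring.choose θ (k+1) * (-y) ^ (k+1))) := by
    intro k
    rw [← ENNReal.ofReal_pow hy.1, ← ENNReal.ofReal_mul (choose_sign θ h0 h1 k)]
    congr 1
    rw [neg_pow y]; ring
  simp_rw [e]
  rw [← ENNReal.ofReal_tsum_of_nonneg _ hs3.summable, hs3.tsum_eq]
  · congr 1; rw [← sub_eq_add_neg]; ring
  · intro k
    have := mul_nonneg (choose_sign θ h0 h1 k) (pow_nonneg hy.1 (k+1))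
    rw [neg_pow y]; linarith

lemma PS.exp_neg (θ : ℝ) (h0 : 0 < θ) (h1 : θ < 1) (τ : ℝ) (hτ : 0 ≤ τ) :
    PS (fun y => ENNReal.ofReal (exp (-τ * (1 - y) ^ θ))) := by
  have := PS.tsum (fun n => (PS.one_sub_rpow θ h0 h1).pow n)
    (fun n => ENNReal.ofReal (exp (-τ) * (τ ^ n / n.factorial)))
  obtain ⟨a, ha⟩ := this
  refine ⟨a, fun y hy => ?_⟩
  rw [ha y hy]
  have hg : 0 ≤ 1 - (1 - y) ^ θ := by
    have := Real.rpow_le_one (x := 1 - y) (by linarith [hy.2]) (by linarith [hy.1]) h0.le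
    linarith
  have hs := (NormedSpace.expSeries_div_hasSum_exp (τ * (1 - (1 - y) ^ θ))).mul_left (exp (-τ))
  rw [← Real.exp_eq_exp_ℝ, ← Real.exp_add] at hs
  have e : ∀ n : ℕ, ENNReal.ofReal (exp (-τ) * (τ ^ n / n.factorial)) *
      ENNReal.ofReal (1 - (1 - y) ^ θ) ^ n =
      ENNReal.ofReal (exp (-τ) * ((τ * (1 - (1 - y) ^ θ)) ^ n / n.factorial)) := by
    intro n
    rw [← ENNReal.ofReal_pow hg, ← ENNReal.ofReal_mul (by positivity)]
    congr 1
    rw [mul_pow]; ring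
  simp_rw [e]
  rw [← ENNReal.ofReal_tsum_of_nonneg _ hs.summable, hs.tsum_eq]
  · congr 2; ring
  · intro n; positivity

/-- Real form of the expansion. -/
lemma exp_neg_series (θ : ℝ) (h0 : 0 < θ) (h1 : θ < 1) (τ : ℝ) (hτ : 0 ≤ τ) :
    ∃ a : ℕ → ℝ, (∀ k, 0 ≤ a k) ∧ ∀ y ∈ Ioo (0 : ℝ) 1,
      HasSum (fun k => a k * y ^ k) (exp (-τ * (1 - y) ^ θ)) := by
  obtain ⟨a, ha⟩ := PS.exp_neg θ h0 h1 τ hτ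
  refine ⟨fun k => (a k).toReal, fun k => ENNReal.toReal_nonneg, fun y hy => ?_⟩
  have h := ha y ⟨hy.1.le, hy.2⟩
  have hne : ∑' k, a k * ENNReal.ofReal y ^ k ≠ ∞ := by rw [h]; exact ENNReal.ofReal_ne_top
  have := (ENNReal.hasSum_toReal hne)
  rw [← ENNReal.tsum_toReal_eq (ENNReal.ne_top_of_tsum_ne_top hne), h, ENNReal.toReal_ofReal (exp_pos _).le] at this
  simpa [ENNReal.toReal_mul, ENNReal.toReal_pow, ENNReal.toReal_ofReal hy.1.le] using this

end HardyAux

namespace HardyAux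

/-- `|z|^2 + 1`. -/
def phi {d : ℕ} (z : Ed d) : ℝ := ‖z‖ ^ 2 + 1

lemma one_le_phi {d : ℕ} (z : Ed d) : 1 ≤ phi z := by unfold phi; nlinarith [sq_nonneg ‖z‖]

lemma phi_pos {d : ℕ} (z : Ed d) : 0 < phi z := lt_of_lt_of_le one_pos (one_le_phi z)

lemma continuous_phi {d : ℕ} : Continuous (phi : Ed d → ℝ) := by unfold phi; fun_prop

/-- The symbol. -/
def psi {d : ℕ} (α : ℝ) (z : Ed d) : ℝ := phi z ^ (α / 2)

lemma continuous_psi {d : ℕ} (α : ℝ) : Continuous (psi α : Ed d → ℝ) := by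
  unfold psi
  exact continuous_phi.rpow_const fun z => Or.inl (phi_pos z).ne'

lemma one_le_psi {d : ℕ} {α : ℝ} (hα : 0 < α) (z : Ed d) : 1 ≤ psi α z :=
  Real.one_le_rpow (one_le_phi z) (by positivity)

/-- Two parameter kernel. -/
def GG (d : ℕ) (α t s : ℝ) (x : Ed d) : ℝ :=
  (2 * π) ^ (-(d : ℝ)) * ∫ z : Ed d, cos ⟪x, z⟫ * (exp (-t * psi α z) * exp (-s * phi z))

/-- Gaussian kernel with mass. -/
def FF (d : ℕ) (s : ℝ) (x : Ed d) : ℝ :=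
  exp (-s) * (4 * π * s) ^ (-((d : ℝ) / 2)) * exp (-(‖x‖ ^ 2 / (4 * s)))

lemma relKernel_eq (d : ℕ) (α t : ℝ) (x y : Ed d) :
    relKernel d α 1 t x y = GG d α t 0 (y - x) := by
  unfold relKernel GG psi phi
  simp

lemma gauss_cos (d : ℕ) (b : ℝ) (hb : 0 < b) (z : Ed d) (c : ℝ) :
    ∫ y : Ed d, cos (⟪z, y⟫ - c) * exp (-b * ‖y‖ ^ 2) =
      cos c * ((π / b) ^ ((d : ℝ) / 2) * exp (-(‖z‖ ^ 2 / (4 * b)))) := by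
  have hb' : 0 < (b : ℂ).re := by simpa using hb
  have h := GaussianFourier.integral_cexp_neg_mul_sq_norm_add hb' Complex.I z
  have hi := GaussianFourier.integrable_cexp_neg_mul_sq_norm_add hb' Complex.I z
  have h2 : ∫ y : Ed d, Complex.exp (-(c : ℂ) * Complex.I) *
      Complex.exp (-(b : ℂ) * ‖y‖ ^ 2 + Complex.I * ⟪z, y⟫) =
      Complex.exp (-(c : ℂ) * Complex.I) *
        ((((π / b) ^ ((d : ℝ) / 2) * exp (-(‖z‖ ^ 2 / (4 * b))) : ℝ)) : ℂ) := by
    rw [integral_const_mul, h]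
    congr 1
    push_cast
    rw [Complex.ofReal_cpow (by positivity)]
    congr 1
    · push_cast
      simp
    · congr 1
      rw [Complex.I_sq]; ring
  have hi2 := hi.const_mul (Complex.exp (-(c : ℂ) * Complex.I))
  have h3 := integral_re (𝕜 := ℂ) hi2
  simp only [RCLike.re_to_complex] at h3
  rw [h2, Complex.re_mul_ofReal] at h3
  have hc : (Complex.exp (-(c : ℂ) * Complex.I)).re = cos c := by
    rw [← Complex.ofReal_neg, Complex.exp_ofReal_mul_I_re, cos_neg]
  rw [hc] at h3
  rw [← h3]
  refine integral_congr_ae (Eventually.of_forall fun y => ?_)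
  beta_reduce
  rw [← Complex.exp_add]
  have : -(c : ℂ) * Complex.I + (-(b : ℂ) * ‖y‖ ^ 2 + Complex.I * ⟪z, y⟫) =
    ((-b * ‖y‖ ^ 2 : ℝ) : ℂ) + ((⟪z, y⟫ - c : ℝ) : ℂ) * Complex.I := by
    push_cast; ring
  rw [this, Complex.exp_add, ← Complex.ofReal_exp, Complex.re_ofReal_mul,
    Complex.exp_ofReal_mul_I_re]
  ring

lemma integrable_gauss (d : ℕ) (b : ℝ) (hb : 0 < b) :
    Integrable (fun y : Ed d => exp (-b * ‖y‖ ^ 2)) := by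
  by_contra h
  have h1 := GaussianFourier.integral_rexp_neg_mul_sq_norm (V := Ed d) hb
  rw [integral_undef h] at h1
  have : 0 < (π / b) ^ (Module.finrank ℝ (Ed d) / 2 : ℝ) := by positivity
  linarith

lemma integrable_exp_phi (d : ℕ) (s : ℝ) (hs : 0 < s) :
    Integrable (fun y : Ed d => exp (-s * phi y)) := by
  have := (integrable_gauss d s hs).mul_const (exp (-s))
  refine this.congr (Eventually.of_forall fun y => ?_)
  beta_reduce
  rw [← exp_add]; congr 1; unfold phi; ring

lemma integrable_exp_psi (d : ℕ) {α : ℝ} (hα : 0 < α) (t : ℝ) (ht : 0 < t) :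
    Integrable (fun y : Ed d => exp (-t * psi α y)) := by
  obtain ⟨n, hn⟩ := exists_nat_gt (((d : ℝ) + 1) / α)
  have hr : (Module.finrank ℝ (Ed d) : ℝ) < n * α := by
    rw [div_lt_iff₀ hα] at hn
    simp; linarith
  have := (integrable_rpow_neg_one_add_norm_sq (E := Ed d) (μ := volume) hr).const_mul
    ((n.factorial : ℝ) / t ^ n)
  refine this.mono' ?_ (Eventually.of_forall fun y => ?_)
  · exact (by have := continuous_psi (d := d) α; fun_prop : Continuous _).aestronglyMeasurable
  · rw [norm_of_nonneg (exp_pos _).le]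
    have hp : 0 < psi α y := lt_of_lt_of_le one_pos (one_le_psi hα y)
    have h1 := Real.pow_div_factorial_le_exp (t * psi α y) (by positivity) n
    have e : ((1 : ℝ) + ‖y‖ ^ 2) ^ (-(n * α) / 2) = (psi α y ^ n)⁻¹ := by
      unfold psi phi
      rw [← Real.rpow_mul_natCast (by positivity), ← Real.rpow_neg (by positivity)]
      congr 1
      · ring
      · ring
    rw [e, neg_mul, exp_neg]
    have : (n.factorial : ℝ) / t ^ n * (psi α y ^ n)⁻¹ = ((t * psi α y) ^ n / n.factorial)⁻¹ := by
      rw [mul_pow]; field_simp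
    rw [this]
    exact inv_anti₀ (by positivity) h1

lemma integrable_GG (d : ℕ) {α : ℝ} (hα : 0 < α) (t s : ℝ) (ht : 0 ≤ t) (hs : 0 ≤ s)
    (h : 0 < t ∨ 0 < s) :
    Integrable (fun z : Ed d => exp (-t * psi α z) * exp (-s * phi z)) := by
  have hc : Continuous (fun z : Ed d => exp (-t * psi α z) * exp (-s * phi z)) := by
    have := continuous_psi (d := d) α
    have := continuous_phi (d := d)
    fun_prop
  rcases h with h | h
  · refine (integrable_exp_psi d hα t h).mono' hc.aestronglyMeasurable
      (Eventually.of_forall fun z => ?_)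
    rw [norm_of_nonneg (by positivity)]
    refine mul_le_of_le_one_right (exp_pos _).le (exp_le_one_iff.2 ?_)
    have := phi_pos z
    nlinarith
  · refine (integrable_exp_phi d s h).mono' hc.aestronglyMeasurable
      (Eventually.of_forall fun z => ?_)
    rw [norm_of_nonneg (by positivity)]
    refine mul_le_of_le_one_left (exp_pos _).le (exp_le_one_iff.2 ?_)
    have := one_le_psi hα z
    nlinarith

lemma GG_tendsto (d : ℕ) {α : ℝ} (hα : 0 < α) (t0 s0 : ℝ) (ht0 : 0 ≤ t0) (hs0 : 0 ≤ s0)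
    (h : 0 < t0 ∨ 0 < s0) (x : Ed d) {ι : Type} {l : Filter ι} [l.IsCountablyGenerated]
    {T S : ι → ℝ} {t s : ℝ} (hT : Tendsto T l (nhds t)) (hS : Tendsto S l (nhds s))
    (hT0 : ∀ᶠ i in l, t0 ≤ T i) (hS0 : ∀ᶠ i in l, s0 ≤ S i) :
    Tendsto (fun i => GG d α (T i) (S i) x) l (nhds (GG d α t s x)) := by
  unfold GG
  refine Tendsto.const_mul _ ?_
  refine tendsto_integral_filter_of_dominated_convergence
    (fun z : Ed d => exp (-t0 * psi α z) * exp (-s0 * phi z)) ?_ ?_ (integrable_GG d hα t0 s0 ht0 hs0 h) ?_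
  · refine Eventually.of_forall fun i => Continuous.aestronglyMeasurable ?_
    have := continuous_psi (d := d) α
    have := continuous_phi (d := d)
    fun_prop
  · filter_upwards [hT0, hS0] with i h1 h2
    refine Eventually.of_forall fun z => ?_
    rw [norm_mul, norm_of_nonneg (by positivity : 0 ≤ exp (-T i * psi α z) * exp (-S i * phi z))]
    have hc : ‖cos ⟪x, z⟫‖ ≤ 1 := abs_cos_le_one _
    refine (mul_le_of_le_one_left (by positivity) hc).trans ?_
    have := one_le_psi hα z
    have := phi_pos z
    gcongr
  · refine Eventually.of_forall fun z => ?_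
    have h1 := ((continuous_exp.tendsto _).comp (hT.neg.mul_const (psi α z)))
    have h2 := ((continuous_exp.tendsto _).comp (hS.neg.mul_const (phi z)))
    exact (h1.mul h2).const_mul _

lemma FF_eq (d : ℕ) (s : ℝ) (hs : 0 < s) (x : Ed d) :
    (2 * π) ^ (-(d : ℝ)) * ∫ z : Ed d, cos ⟪x, z⟫ * exp (-s * phi z) = FF d s x := by
  have h := gauss_cos d s hs x 0
  have e : (fun z : Ed d => cos ⟪x, z⟫ * exp (-s * phi z)) =
      fun z => exp (-s) * (cos (⟪x, z⟫ - 0) * exp (-s * ‖z‖ ^ 2)) := by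
    ext z
    have : exp (-s * phi z) = exp (-s) * exp (-s * ‖z‖ ^ 2) := by
      rw [← exp_add]; congr 1; unfold phi; ring
    rw [this, sub_zero]; ring
  rw [e, integral_const_mul, h, cos_zero, one_mul]
  unfold FF
  have : (2 * π) ^ (-(d : ℝ)) * (π / s) ^ ((d : ℝ) / 2) = (4 * π * s) ^ (-((d : ℝ) / 2)) := by
    have : (2 * π) ^ (-(d : ℝ)) = ((2 * π) ^ (2 : ℝ)) ^ (-((d : ℝ) / 2)) := by
      rw [← Real.rpow_mul (by positivity)]; congr 1; ring
    have h4 : (4 * π * s) = (2 * π) ^ (2 : ℝ) * (π / s)⁻¹ := by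
      have : (2 * π) ^ (2 : ℝ) = (2 * π) ^ 2 := by norm_cast
      rw [this]
      have := pi_pos
      field_simp
      ring
    rw [this, h4, Real.mul_rpow (x := (2 * π) ^ (2 : ℝ)) (y := (π / s)⁻¹) (by positivity) (by positivity)]
    congr 1
    rw [Real.inv_rpow (by positivity), Real.rpow_neg (by positivity), inv_inv]
  calc _ = exp (-s) * ((2 * π) ^ (-(d : ℝ)) * (π / s) ^ ((d : ℝ) / 2)) * exp (-(‖x‖ ^ 2 / (4 * s))) := by ring
    _ = _ := by rw [this]

lemma GG_zero (d : ℕ) (α s : ℝ) (hs : 0 < s) (x : Ed d) : GG d α 0 s x = FF d s x := by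
  rw [← FF_eq d s hs x]; unfold GG; simp

lemma GG_neg (d : ℕ) (α t s : ℝ) (x : Ed d) : GG d α t s (-x) = GG d α t s x := by
  unfold GG; simp

lemma FF_pos (d : ℕ) (s : ℝ) (hs : 0 < s) (x : Ed d) : 0 < FF d s x := by
  unfold FF; positivity

/-- Off-diagonal bound. -/
lemma FF_le (d : ℕ) (x : Ed d) (hx : x ≠ 0) : ∃ C : ℝ, 0 < C ∧ ∀ s > 0, FF d s x ≤ C * exp (-s) := by
  obtain ⟨n, hn⟩ := exists_nat_gt ((d : ℝ) / 2)
  have hxx : 0 < ‖x‖ := norm_pos_iff.2 hx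
  -- for s ≥ 1 use the power, for s ≤ 1 use the exponential
  refine ⟨1 + n.factorial * (4 / ‖x‖ ^ 2) ^ n, by positivity, fun s hs => ?_⟩
  unfold FF
  have hk : (4 * π * s) ^ (-((d : ℝ) / 2)) * exp (-(‖x‖ ^ 2 / (4 * s))) ≤
      1 + n.factorial * (4 / ‖x‖ ^ 2) ^ n := by
    rcases le_total 1 (4 * π * s) with h | h
    · have h1 := Real.rpow_le_one_of_one_le_of_nonpos h (by
        have : (0 : ℝ) ≤ d := by positivity
        linarith : -((d : ℝ) / 2) ≤ 0)
      have h2 : exp (-(‖x‖ ^ 2 / (4 * s))) ≤ 1 := exp_le_one_iff.2 (by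
        have : 0 ≤ ‖x‖ ^ 2 / (4 * s) := by positivity
        linarith)
      have := mul_le_one₀ h1 (exp_pos _).le h2
      have : 0 ≤ n.factorial * (4 / ‖x‖ ^ 2) ^ n := by positivity
      linarith
    · have h1 : (4 * π * s) ^ (-((d : ℝ) / 2)) ≤ (s ^ n)⁻¹ := by
        calc _ ≤ (4 * π * s) ^ (-(n : ℝ)) :=
              Real.rpow_le_rpow_of_exponent_ge (by positivity) h (by linarith)
          _ = ((4 * π * s) ^ n)⁻¹ := by rw [Real.rpow_neg (by positivity), Real.rpow_natCast]
          _ ≤ _ := by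
            apply inv_anti₀ (by positivity)
            apply pow_le_pow_left₀ hs.le
            nlinarith [pi_gt_three]
      have h2 := Real.pow_div_factorial_le_exp (‖x‖ ^ 2 / (4 * s)) (by positivity) n
      have h3 : exp (-(‖x‖ ^ 2 / (4 * s))) ≤ ((‖x‖ ^ 2 / (4 * s)) ^ n / n.factorial)⁻¹ := by
        rw [exp_neg]; exact inv_anti₀ (by positivity) h2
      calc _ ≤ (s ^ n)⁻¹ * ((‖x‖ ^ 2 / (4 * s)) ^ n / n.factorial)⁻¹ :=
            mul_le_mul h1 h3 (exp_pos _).le (by positivity)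
        _ = n.factorial * (4 / ‖x‖ ^ 2) ^ n := by
            rw [div_pow, div_pow, mul_pow]; field_simp
        _ ≤ _ := by linarith
  nlinarith [exp_pos (-s)]

end HardyAux

namespace HardyAux

/-- Bernstein-type approximation of the symbol. -/
def psiE {d : ℕ} (α ε : ℝ) (z : Ed d) : ℝ := ((1 - exp (-ε * phi z)) / ε) ^ (α / 2)

lemma quot_tendsto (c : ℝ) :
    Tendsto (fun ε : ℝ => (1 - exp (-ε * c)) / ε) (nhdsWithin 0 (Ioi 0)) (nhds c) := by
  have h : HasDerivAt (fun ε : ℝ => 1 - exp (-ε * c)) c 0 := by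
    have := (((hasDerivAt_id (0 : ℝ)).neg.mul_const c).exp).const_sub 1
    simpa using this
  have h2 := h.tendsto_slope_zero_right
  refine h2.congr fun ε => ?_
  simp [div_eq_inv_mul]

lemma quot_nonneg {ε c : ℝ} (hε : 0 < ε) (hc : 0 ≤ c) : 0 ≤ (1 - exp (-ε * c)) / ε := by
  apply div_nonneg _ hε.le
  have : exp (-ε * c) ≤ 1 := exp_le_one_iff.2 (by nlinarith)
  linarith

lemma GGE_hasSum (d : ℕ) {α : ℝ} (hα : 0 < α) (hα2 : α < 2) (t s ε : ℝ) (ht : 0 ≤ t) (hs : 0 < s)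
    (hε : 0 < ε) : ∃ a : ℕ → ℝ, (∀ k, 0 ≤ a k) ∧
      HasSum (fun k => a k * exp (-ε) ^ k) (exp (-t * ((1 - exp (-ε)) / ε) ^ (α / 2))) ∧
      ∀ x : Ed d, HasSum (fun k => a k * FF d (s + k * ε) x)
        ((2 * π) ^ (-(d : ℝ)) * ∫ z : Ed d, cos ⟪x, z⟫ * (exp (-t * psiE α ε z) * exp (-s * phi z))) := by
  obtain ⟨a, ha0, ha⟩ := exp_neg_series (α / 2) (by positivity) (by linarith)
    (t * ε ^ (-(α / 2))) (by positivity)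
  have hconv : ∀ y : ℝ, y ∈ Ioo (0 : ℝ) 1 →
      exp (-(t * ε ^ (-(α / 2))) * (1 - y) ^ (α / 2)) = exp (-t * ((1 - y) / ε) ^ (α / 2)) := by
    intro y hy
    rw [Real.div_rpow (by linarith [hy.2]) hε.le, Real.rpow_neg hε.le]
    congr 1
    field_simp
  have hmem : ∀ z : Ed d, exp (-ε * phi z) ∈ Ioo (0 : ℝ) 1 := fun z =>
    ⟨exp_pos _, exp_lt_one_iff.2 (by have := phi_pos z; nlinarith)⟩
  have hE : exp (-ε) ∈ Ioo (0 : ℝ) 1 := ⟨exp_pos _, exp_lt_one_iff.2 (by linarith)⟩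
  have hsum1 := ha _ hE
  rw [hconv _ hE] at hsum1
  refine ⟨a, ha0, hsum1, fun x => ?_⟩
  have hcont := continuous_phi (d := d)
  have hI : ∀ k : ℕ, Integrable (fun z : Ed d =>
      a k * (cos ⟪x, z⟫ * exp (-(s + k * ε) * phi z))) := by
    intro k
    apply Integrable.const_mul
    refine (integrable_exp_phi d (s + k * ε) (by positivity)).mono'
      (by apply Continuous.aestronglyMeasurable; fun_prop) (Eventually.of_forall fun z => ?_)
    rw [norm_mul, norm_of_nonneg (exp_pos _).le]
    exact mul_le_of_le_one_left (exp_pos _).le (abs_cos_le_one _)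
  have key := hasSum_integral_of_summable_integral_norm hI (by
    refine Summable.of_nonneg_of_le (fun k => integral_nonneg fun z => norm_nonneg _) (fun k => ?_)
      (hsum1.summable.mul_right (∫ z : Ed d, exp (-s * phi z)))
    rw [← integral_const_mul]
    refine integral_mono (hI k).norm ((integrable_exp_phi d s hs).const_mul _) fun z => ?_
    beta_reduce
    rw [norm_mul, norm_mul, norm_of_nonneg (exp_pos _).le, norm_of_nonneg (ha0 k), mul_assoc]
    apply mul_le_mul_of_nonneg_left _ (ha0 k)
    refine (mul_le_of_le_one_left (exp_pos _).le (abs_cos_le_one _)).trans ?_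
    rw [← exp_nat_mul, ← exp_add]
    apply exp_le_exp.2
    have := one_le_phi z
    have : 0 ≤ (k : ℝ) * ε := by positivity
    nlinarith)
  have key2 := key.mul_left ((2 * π) ^ (-(d : ℝ)))
  have e1 : (fun k : ℕ => a k * FF d (s + k * ε) x) = fun k : ℕ => (2 * π) ^ (-(d : ℝ)) *
      ∫ z : Ed d, a k * (cos ⟪x, z⟫ * exp (-(s + k * ε) * phi z)) := by
    ext k
    rw [← FF_eq d _ (by positivity), integral_const_mul]
    ring
  have e2 : (fun z : Ed d => cos ⟪x, z⟫ * (exp (-t * psiE α ε z) * exp (-s * phi z))) =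
      fun z => ∑' k : ℕ, a k * (cos ⟪x, z⟫ * exp (-(s + k * ε) * phi z)) := by
    ext z
    have h1 := ((ha _ (hmem z)).mul_left (cos ⟪x, z⟫)).mul_right (exp (-s * phi z))
    rw [hconv _ (hmem z)] at h1
    rw [← mul_assoc]
    unfold psiE
    rw [← h1.tsum_eq]
    refine tsum_congr fun k => ?_
    have : exp (-(s + k * ε) * phi z) = exp (-ε * phi z) ^ k * exp (-s * phi z) := by
      rw [← exp_nat_mul, ← exp_add]; congr 1; ring
    rw [this]; ring
  rw [e1, e2]
  exact key2

lemma GGE_tendsto (d : ℕ) {α : ℝ} (hα : 0 < α) (t s : ℝ) (ht : 0 ≤ t) (hs : 0 < s) (x : Ed d) :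
    Tendsto (fun ε : ℝ => (2 * π) ^ (-(d : ℝ)) *
      ∫ z : Ed d, cos ⟪x, z⟫ * (exp (-t * psiE α ε z) * exp (-s * phi z)))
      (nhdsWithin 0 (Ioi 0)) (nhds (GG d α t s x)) := by
  unfold GG
  refine Tendsto.const_mul _ ?_
  refine tendsto_integral_filter_of_dominated_convergence
    (fun z : Ed d => exp (-s * phi z)) ?_ ?_ (integrable_exp_phi d s hs) ?_
  · refine Eventually.of_forall fun ε => Measurable.aestronglyMeasurable ?_
    have := (continuous_phi (d := d)).measurable
    unfold psiE
    fun_prop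
  · filter_upwards [self_mem_nhdsWithin] with ε hε
    refine Eventually.of_forall fun z => ?_
    rw [norm_mul, norm_of_nonneg (by positivity : 0 ≤ exp (-t * psiE α ε z) * exp (-s * phi z))]
    refine (mul_le_of_le_one_left (by positivity) (abs_cos_le_one _)).trans ?_
    refine mul_le_of_le_one_left (exp_pos _).le (exp_le_one_iff.2 ?_)
    have : 0 ≤ psiE α ε z := Real.rpow_nonneg (quot_nonneg hε (phi_pos z).le) _
    nlinarith
  · refine Eventually.of_forall fun z => ?_
    have h1 := (quot_tendsto (phi z)).rpow_const (p := α / 2) (Or.inl (phi_pos z).ne')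
    have h2 := (continuous_exp.tendsto _).comp (h1.const_mul (-t))
    exact (h2.mul_const _).const_mul _

lemma GG_nonneg_pos (d : ℕ) {α : ℝ} (hα : 0 < α) (hα2 : α < 2) (t s : ℝ) (ht : 0 ≤ t) (hs : 0 < s)
    (x : Ed d) : 0 ≤ GG d α t s x := by
  refine ge_of_tendsto (GGE_tendsto d hα t s ht hs x) ?_
  filter_upwards [self_mem_nhdsWithin] with ε hε
  have hε : 0 < ε := hε
  obtain ⟨a, h0, -, h⟩ := GGE_hasSum d hα hα2 t s ε ht hs hε
  exact (h x).nonneg fun k => mul_nonneg (h0 k) (FF_pos d _ (by positivity) x).le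

lemma GG_le_pos (d : ℕ) {α : ℝ} (hα : 0 < α) (hα2 : α < 2) (t s : ℝ) (ht : 0 ≤ t) (hs : 0 < s)
    (x : Ed d) (C : ℝ) (hC : ∀ s > 0, FF d s x ≤ C * exp (-s)) :
    GG d α t s x ≤ C * (exp (-t) * exp (-s)) := by
  have h1 := (quot_tendsto 1).rpow_const (p := α / 2) (Or.inl one_ne_zero)
  have h2 := (((continuous_exp.tendsto _).comp (h1.const_mul (-t))).mul_const (exp (-s))).const_mul C
  rw [Real.one_rpow, mul_one] at h2
  refine le_of_tendsto_of_tendsto (GGE_tendsto d hα t s ht hs x) h2 ?_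
  filter_upwards [self_mem_nhdsWithin] with ε hε
  have hε : 0 < ε := hε
  obtain ⟨a, h0, h1, h⟩ := GGE_hasSum d hα hα2 t s ε ht hs hε
  have h3 := (h1.mul_right (exp (-s))).mul_left C
  simp only [Function.comp, mul_one]
  refine hasSum_le (fun k => ?_) (h x) h3
  have := mul_le_mul_of_nonneg_left (hC (s + k * ε) (by positivity)) (h0 k)
  refine this.trans (le_of_eq ?_)
  have : exp (-(s + k * ε)) = exp (-ε) ^ k * exp (-s) := by
    rw [← exp_nat_mul, ← exp_add]; congr 1; ring
  rw [this]; ring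

lemma tendsto_s (d : ℕ) {α : ℝ} (hα : 0 < α) (t : ℝ) (ht : 0 < t) (x : Ed d) :
    Tendsto (fun s : ℝ => GG d α t s x) (nhdsWithin 0 (Ioi 0)) (nhds (GG d α t 0 x)) := by
  refine GG_tendsto d hα t 0 ht.le le_rfl (Or.inl ht) x tendsto_const_nhds
    (tendsto_id.mono_left nhdsWithin_le_nhds) (Eventually.of_forall fun _ => le_rfl) ?_
  filter_upwards [self_mem_nhdsWithin] with s hs
  exact le_of_lt hs

lemma GG_nonneg (d : ℕ) {α : ℝ} (hα : 0 < α) (hα2 : α < 2) (t s : ℝ) (ht : 0 ≤ t) (hs : 0 ≤ s)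
    (h : 0 < t ∨ 0 < s) (x : Ed d) : 0 ≤ GG d α t s x := by
  rcases hs.eq_or_lt with h0 | h0
  · subst h0
    have ht : 0 < t := by rcases h with h | h; exacts [h, absurd h (lt_irrefl _)]
    refine ge_of_tendsto (tendsto_s d hα t ht x) ?_
    filter_upwards [self_mem_nhdsWithin] with s hs
    exact GG_nonneg_pos d hα hα2 t s ht.le hs x
  · exact GG_nonneg_pos d hα hα2 t s ht h0 x

lemma GG_le (d : ℕ) {α : ℝ} (hα : 0 < α) (hα2 : α < 2) (x : Ed d) (hx : x ≠ 0) :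
    ∃ C : ℝ, 0 < C ∧ ∀ t s : ℝ, 0 ≤ t → 0 ≤ s → (0 < t ∨ 0 < s) →
      GG d α t s x ≤ C * (exp (-t) * exp (-s)) := by
  obtain ⟨C, hC0, hC⟩ := FF_le d x hx
  refine ⟨C, hC0, fun t s ht hs h => ?_⟩
  rcases hs.eq_or_lt with h0 | h0
  · subst h0
    have ht : 0 < t := by rcases h with h | h; exacts [h, absurd h (lt_irrefl _)]
    have h2 : Tendsto (fun s : ℝ => C * (exp (-t) * exp (-s))) (nhdsWithin 0 (Ioi 0))
        (nhds (C * (exp (-t) * exp (-0)))) := by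
      apply Tendsto.mono_left _ nhdsWithin_le_nhds
      apply Continuous.tendsto (f := fun s : ℝ => C * (exp (-t) * exp (-s)))
      fun_prop
    refine le_of_tendsto_of_tendsto (tendsto_s d hα t ht x) h2 ?_
    filter_upwards [self_mem_nhdsWithin] with s hs
    exact GG_le_pos d hα hα2 t s ht.le hs x C hC
  · exact GG_le_pos d hα hα2 t s ht h0 x C hC

lemma relKernel_nonneg (d : ℕ) {α : ℝ} (hα : 0 < α) (hα2 : α < 2) (t : ℝ) (ht : 0 < t) (x y : Ed d) :
    0 ≤ relKernel d α 1 t x y := by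
  rw [relKernel_eq]; exact GG_nonneg d hα hα2 t 0 ht.le le_rfl (Or.inl ht) _

lemma measurable_GG (d : ℕ) (α : ℝ) : Measurable (fun p : ℝ × ℝ × Ed d => GG d α p.1 p.2.1 p.2.2) := by
  unfold GG
  apply Measurable.const_mul
  apply StronglyMeasurable.measurable
  apply StronglyMeasurable.integral_prod_right
    (f := fun (p : ℝ × ℝ × Ed d) (z : Ed d) => cos ⟪p.2.2, z⟫ * (exp (-p.1 * psi α z) * exp (-p.2.1 * phi z)))
  apply Continuous.stronglyMeasurable
  have := continuous_psi (d := d) α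
  have := continuous_phi (d := d)
  fun_prop

lemma measurable_relKernel (d : ℕ) (α : ℝ) :
    Measurable (fun p : ℝ × Ed d × Ed d => relKernel d α 1 p.1 p.2.1 p.2.2) := by
  simp_rw [relKernel_eq]
  exact (measurable_GG d α).comp (g := fun p : ℝ × ℝ × Ed d => GG d α p.1 p.2.1 p.2.2)
    (f := fun p : ℝ × Ed d × Ed d => (p.1, (0 : ℝ), p.2.2 - p.2.1)) (by fun_prop)

lemma gauss_FF (d : ℕ) (s : ℝ) (hs : 0 < s) (x z : Ed d) :
    ∫ y : Ed d, cos ⟪y - x, z⟫ * FF d s y = cos ⟪x, z⟫ * exp (-s * phi z) := by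
  have h := gauss_cos d (1 / (4 * s)) (by positivity) z ⟪x, z⟫
  have e : (fun y : Ed d => cos ⟪y - x, z⟫ * FF d s y) =
      fun y => (exp (-s) * (4 * π * s) ^ (-((d : ℝ) / 2))) *
        (cos (⟪z, y⟫ - ⟪x, z⟫) * exp (-(1 / (4 * s)) * ‖y‖ ^ 2)) := by
    ext y
    unfold FF
    rw [inner_sub_left, real_inner_comm y z]
    have : -(‖y‖ ^ 2 / (4 * s)) = -(1 / (4 * s)) * ‖y‖ ^ 2 := by ring
    rw [this]; ring
  rw [e, integral_const_mul, h]
  have h1 : π / (1 / (4 * s)) = 4 * π * s := by field_simp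
  have h2 : exp (-s * phi z) = exp (-s) * exp (-(‖z‖ ^ 2 / (4 * (1 / (4 * s))))) := by
    rw [← exp_add]; congr 1; unfold phi; field_simp; ring
  rw [h1, h2, Real.rpow_neg (by positivity)]
  have : (4 * π * s) ^ ((d : ℝ) / 2) ≠ 0 := by positivity
  field_simp

lemma integrable_FF (d : ℕ) (s : ℝ) (hs : 0 < s) : Integrable (fun y : Ed d => FF d s y) := by
  refine ((integrable_gauss d (1 / (4 * s)) (by positivity)).const_mul
    (exp (-s) * (4 * π * s) ^ (-((d : ℝ) / 2)))).congr (Eventually.of_forall fun y => ?_)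
  unfold FF
  beta_reduce
  congr 2; ring

lemma measurable_FF (d : ℕ) : Measurable (fun p : ℝ × Ed d => FF d p.1 p.2) := by
  unfold FF
  fun_prop

lemma conv_real (d : ℕ) {α : ℝ} (hα : 0 < α) (a s : ℝ) (ha : 0 < a) (hs : 0 < s) (x : Ed d) :
    Integrable (fun y : Ed d => GG d α a 0 (y - x) * FF d s y) ∧
    ∫ y : Ed d, GG d α a 0 (y - x) * FF d s y = GG d α a s x := by
  have hI : Integrable (fun p : Ed d × Ed d =>
      cos ⟪p.1 - x, p.2⟫ * (FF d s p.1 * exp (-a * psi α p.2))) (volume.prod volume) := by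
    have h := (integrable_FF d s hs).mul_prod (integrable_exp_psi d hα a ha)
    refine h.mono' ?_ (Eventually.of_forall fun p => ?_)
    · apply Measurable.aestronglyMeasurable
      have := (continuous_psi (d := d) α).measurable
      have h2 : Measurable fun p : Ed d × Ed d => FF d s p.1 :=
        (measurable_FF d).comp (g := fun p : ℝ × Ed d => FF d p.1 p.2) (f := fun p : Ed d × Ed d => (s, p.1)) (by fun_prop)
      fun_prop
    · rw [norm_mul, norm_of_nonneg (mul_nonneg (FF_pos d s hs _).le (exp_pos _).le)]
      exact mul_le_of_le_one_left (mul_nonneg (FF_pos d s hs _).le (exp_pos _).le) (abs_cos_le_one _)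
  have e : ∀ y : Ed d, GG d α a 0 (y - x) * FF d s y = (2 * π) ^ (-(d : ℝ)) *
      ∫ z : Ed d, cos ⟪y - x, z⟫ * (FF d s y * exp (-a * psi α z)) := by
    intro y
    unfold GG
    rw [mul_assoc, ← integral_mul_const]
    congr 2
    ext z
    simp; ring
  simp_rw [e]
  refine ⟨hI.integral_prod_left.const_mul _, ?_⟩
  rw [integral_const_mul, integral_integral_swap hI]
  unfold GG
  congr 2
  ext z
  have := gauss_FF d s hs x z
  calc _ = ∫ y : Ed d, exp (-a * psi α z) * (cos ⟪y - x, z⟫ * FF d s y) := by congr 1; ext y; ring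
    _ = _ := by rw [integral_const_mul, this]; ring

lemma conv_lint (d : ℕ) {α : ℝ} (hα : 0 < α) (hα2 : α < 2) (a s : ℝ) (ha : 0 < a) (hs : 0 < s) (x : Ed d) :
    ∫⁻ y : Ed d, ENNReal.ofReal (relKernel d α 1 a x y) * ENNReal.ofReal (FF d s y) =
      ENNReal.ofReal (GG d α a s x) := by
  obtain ⟨h1, h2⟩ := conv_real d hα a s ha hs x
  rw [← h2, ofReal_integral_eq_lintegral_ofReal h1]
  · refine lintegral_congr fun y => ?_
    rw [relKernel_eq, ← ENNReal.ofReal_mul (GG_nonneg d hα hα2 a 0 ha.le le_rfl (Or.inl ha) _)]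
  · exact Eventually.of_forall fun y => mul_nonneg (GG_nonneg d hα hα2 a 0 ha.le le_rfl (Or.inl ha) _)
      (FF_pos d s hs y).le

lemma GG_zero_le (d : ℕ) {α : ℝ} (hα : 0 < α) (a s : ℝ) (ha : 0 < a) (hs : 0 < s) :
    GG d α a s 0 ≤ FF d s 0 := by
  rw [← FF_eq d s hs]
  unfold GG
  refine mul_le_mul_of_nonneg_left ?_ (by positivity)
  simp only [inner_zero_left, cos_zero, one_mul]
  refine integral_mono (integrable_GG d hα a s ha.le hs.le (Or.inl ha)) (integrable_exp_phi d s hs) fun z => ?_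
  refine mul_le_of_le_one_left (exp_pos _).le (exp_le_one_iff.2 ?_)
  have := one_le_psi hα z
  nlinarith

/-- Sub-Markov property. -/
lemma relKernel_mass (d : ℕ) {α : ℝ} (hα : 0 < α) (hα2 : α < 2) (a : ℝ) (ha : 0 < a) (x : Ed d) :
    ∫⁻ y : Ed d, ENNReal.ofReal (relKernel d α 1 a x y) ≤ 1 := by
  have e : ∫⁻ y : Ed d, ENNReal.ofReal (relKernel d α 1 a x y) =
      ∫⁻ y : Ed d, ENNReal.ofReal (relKernel d α 1 a 0 y) := by
    rw [← lintegral_sub_right_eq_self (fun y => ENNReal.ofReal (relKernel d α 1 a 0 y)) x]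
    simp_rw [relKernel_eq, sub_zero]
  rw [e]
  have hm : Measurable fun y : Ed d => ENNReal.ofReal (relKernel d α 1 a 0 y) :=
    ((measurable_relKernel d α).comp (f := fun y : Ed d => (a, (0 : Ed d), y)) (by fun_prop)).ennreal_ofReal
  set s : ℕ → ℝ := fun n => (n : ℝ) + 1
  have hs : ∀ n, 0 < s n := fun n => by positivity
  have hlim : Tendsto s atTop atTop := tendsto_atTop_add_const_right _ _ tendsto_natCast_atTop_atTop
  have hb : ∀ n, ∫⁻ y : Ed d, ENNReal.ofReal (relKernel d α 1 a 0 y) *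
      ENNReal.ofReal (exp (-(‖y‖ ^ 2 / (4 * s n)))) ≤ 1 := by
    intro n
    have h0 := FF_pos d (s n) (hs n) 0
    have e2 : ∀ y : Ed d, ENNReal.ofReal (exp (-(‖y‖ ^ 2 / (4 * s n)))) =
        ENNReal.ofReal (FF d (s n) y) * ENNReal.ofReal (FF d (s n) 0)⁻¹ := by
      intro y
      rw [← ENNReal.ofReal_mul (FF_pos d (s n) (hs n) y).le]
      congr 1
      rw [eq_mul_inv_iff_mul_eq₀ h0.ne']
      unfold FF; simp; ring
    simp_rw [e2, ← mul_assoc]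
    rw [lintegral_mul_const' _ _ ENNReal.ofReal_ne_top, conv_lint d hα hα2 a (s n) ha (hs n),
      ← ENNReal.ofReal_mul (GG_nonneg d hα hα2 a (s n) ha.le (hs n).le (Or.inl ha) _)]
    rw [← ENNReal.ofReal_one]
    apply ENNReal.ofReal_le_ofReal
    rw [← div_eq_mul_inv, div_le_one h0]
    exact GG_zero_le d hα a (s n) ha (hs n)
  have hp : ∀ y : Ed d, ENNReal.ofReal (relKernel d α 1 a 0 y) =
      liminf (fun n => ENNReal.ofReal (relKernel d α 1 a 0 y) *
        ENNReal.ofReal (exp (-(‖y‖ ^ 2 / (4 * s n))))) atTop := by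
    intro y
    symm
    apply Tendsto.liminf_eq
    have h1 : Tendsto (fun n => exp (-(‖y‖ ^ 2 / (4 * s n)))) atTop (nhds (exp (-0))) := by
      refine (continuous_exp.tendsto _).comp (Tendsto.neg ?_)
      exact Tendsto.const_div_atTop (hlim.const_mul_atTop (by norm_num)) _
    have h2 := ENNReal.Tendsto.const_mul (a := ENNReal.ofReal (relKernel d α 1 a 0 y))
      (ENNReal.tendsto_ofReal h1) (Or.inr ENNReal.ofReal_ne_top)
    simpa using h2
  calc _ = ∫⁻ y : Ed d, liminf (fun n => ENNReal.ofReal (relKernel d α 1 a 0 y) *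
        ENNReal.ofReal (exp (-(‖y‖ ^ 2 / (4 * s n))))) atTop := lintegral_congr hp
    _ ≤ liminf (fun n => ∫⁻ y : Ed d, ENNReal.ofReal (relKernel d α 1 a 0 y) *
        ENNReal.ofReal (exp (-(‖y‖ ^ 2 / (4 * s n))))) atTop :=
      lintegral_liminf_le fun n => hm.mul (by fun_prop)
    _ ≤ 1 := by
      refine liminf_le_of_le (by isBoundedDefault) fun b hb' => ?_
      obtain ⟨n, hn⟩ := hb'.exists
      exact hn.trans (hb n)

end HardyAux

namespace HardyAux

/-- Mellin transform in the second variable. -/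
def ell (d : ℕ) (α ν a : ℝ) (x : Ed d) : ℝ := ∫ s in Ioi (0 : ℝ), s ^ (ν - 1) * GG d α a s x

/-- Fourier side of `ell`. -/
def MM (d : ℕ) (α ν a : ℝ) (x : Ed d) : ℝ :=
  (2 * π) ^ (-(d : ℝ)) * ∫ z : Ed d, cos ⟪x, z⟫ * (exp (-a * psi α z) * phi z ^ (-ν))

lemma fub (d : ℕ) {α : ℝ} (hα : 0 < α) (a : ℝ) (ha : 0 < a) (x : Ed d) (S : Set ℝ)
    (hS : MeasurableSet S) (k : ℝ → ℝ → ℝ) (hk : Measurable (fun p : ℝ × ℝ => k p.1 p.2))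
    (W : ℝ → ℝ) (hW : IntegrableOn W S) (hb : ∀ s ∈ S, ∀ c ≥ 1, ‖k s c‖ ≤ W s) :
    ∫ s in S, ((2 * π) ^ (-(d : ℝ)) * ∫ z : Ed d, cos ⟪x, z⟫ * (exp (-a * psi α z) * k s (phi z))) =
    (2 * π) ^ (-(d : ℝ)) *
      ∫ z : Ed d, cos ⟪x, z⟫ * (exp (-a * psi α z) * ∫ s in S, k s (phi z)) := by
  have hI : Integrable (fun p : ℝ × Ed d =>
      cos ⟪x, p.2⟫ * (exp (-a * psi α p.2) * k p.1 (phi p.2))) ((volume.restrict S).prod volume) := by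
    have h := Integrable.mul_prod hW (integrable_exp_psi d hα a ha)
    refine h.mono' ?_ ?_
    · apply Measurable.aestronglyMeasurable
      have := (continuous_psi (d := d) α).measurable
      have h1 := (continuous_phi (d := d)).measurable
      have h2 : Measurable fun p : ℝ × Ed d => k p.1 (phi p.2) :=
        hk.comp (f := fun p : ℝ × Ed d => (p.1, phi p.2)) (by fun_prop)
      fun_prop
    · have := (Measure.quasiMeasurePreserving_fst (μ := volume.restrict S) (ν := (volume : Measure (Ed d)))).ae (ae_restrict_mem hS)
      filter_upwards [this] with p hp
      rw [norm_mul, norm_mul, norm_of_nonneg (exp_pos _).le, mul_comm (W _)]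
      refine (mul_le_of_le_one_left (by positivity) (abs_cos_le_one _)).trans ?_
      exact mul_le_mul_of_nonneg_left (hb _ hp _ (one_le_phi _)) (exp_pos _).le
  rw [integral_const_mul, integral_integral_swap hI]
  congr 2
  ext z
  rw [integral_const_mul, integral_const_mul]

lemma integrableOn_gamma (ν : ℝ) (hν : 0 < ν) :
    IntegrableOn (fun s : ℝ => s ^ (ν - 1) * exp (-s)) (Ioi 0) := by
  refine (Real.GammaIntegral_convergent hν).congr_fun (fun s _ => ?_) measurableSet_Ioi
  beta_reduce; ring

lemma ell_eq (d : ℕ) {α : ℝ} (hα : 0 < α) (ν a : ℝ) (hν : 0 < ν) (ha : 0 < a) (x : Ed d) :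
    ell d α ν a x = Gamma ν * MM d α ν a x := by
  have h := fub d hα a ha x (Ioi 0) measurableSet_Ioi (fun s c => s ^ (ν - 1) * exp (-s * c))
    (by fun_prop) _ (integrableOn_gamma ν hν) (by
      intro s hs c hc
      have hs : 0 < s := hs
      rw [norm_of_nonneg (by positivity)]
      apply mul_le_mul_of_nonneg_left _ (by positivity)
      apply exp_le_exp.2
      nlinarith)
  unfold ell MM
  have e1 : ∀ s, s ^ (ν - 1) * GG d α a s x = (2 * π) ^ (-(d : ℝ)) *
      ∫ z : Ed d, cos ⟪x, z⟫ * (exp (-a * psi α z) * (s ^ (ν - 1) * exp (-s * phi z))) := by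
    intro s
    unfold GG
    rw [mul_left_comm, ← integral_const_mul]
    congr 2; ext z; ring
  simp_rw [e1]
  rw [h, mul_left_comm, ← integral_const_mul (Gamma ν)]
  congr 2
  ext z
  have h2 := Real.integral_rpow_mul_exp_neg_mul_Ioi hν (phi_pos z)
  have h3 : ∫ s in Ioi (0 : ℝ), s ^ (ν - 1) * exp (-s * phi z) = phi z ^ (-ν) * Gamma ν := by
    rw [Real.rpow_neg (phi_pos z).le, ← Real.inv_rpow (phi_pos z).le, ← one_div, ← h2]
    congr 1; ext s; congr 2; ring
  rw [h3]; ring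

lemma MM_diff (d : ℕ) {α : ℝ} (hα : 0 < α) (ν a t : ℝ) (hν : α / 2 < ν) (ha : 0 < a) (hat : a < t)
    (x : Ed d) : MM d α ν a x = MM d α ν t x + ∫ r in Ioo a t, MM d α (ν - α / 2) r x := by
  have h := fub d hα a ha x (Ioo a t) measurableSet_Ioo
    (fun r c => exp (-(r - a) * c ^ (α / 2)) * c ^ (-(ν - α / 2)))
    (by fun_prop) (fun _ => 1) (by simp [IntegrableOn]) (by
      intro r hr c hc
      have hc0 : 0 < c := by linarith
      rw [norm_of_nonneg (by positivity)]
      apply mul_le_one₀ _ (by positivity)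
      · exact Real.rpow_le_one_of_one_le_of_nonpos hc (by linarith)
      · apply exp_le_one_iff.2
        have : 0 < c ^ (α / 2) := by positivity
        nlinarith [hr.1])
  have e1 : ∀ r, MM d α (ν - α / 2) r x = (2 * π) ^ (-(d : ℝ)) *
      ∫ z : Ed d, cos ⟪x, z⟫ * (exp (-a * psi α z) *
        (exp (-(r - a) * phi z ^ (α / 2)) * phi z ^ (-(ν - α / 2)))) := by
    intro r
    unfold MM
    congr 2; ext z
    rw [← mul_assoc (exp _) (exp _), ← exp_add]
    congr 3
    unfold psi; ring
  simp_rw [e1]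
  rw [h]
  unfold MM
  have hIntg : ∀ b, 0 < b → Integrable fun z : Ed d => cos ⟪x, z⟫ * (exp (-b * psi α z) * phi z ^ (-ν)) := by
    intro b hb
    refine (integrable_exp_psi d hα b hb).mono' ?_ (Eventually.of_forall fun z => ?_)
    · apply Measurable.aestronglyMeasurable
      have := (continuous_psi (d := d) α).measurable
      have h1 := (continuous_phi (d := d)).measurable
      fun_prop
    · have := phi_pos z
      rw [norm_mul, norm_of_nonneg (by positivity : 0 ≤ exp (-b * psi α z) * phi z ^ (-ν))]
      refine (mul_le_of_le_one_left (by positivity) (abs_cos_le_one _)).trans ?_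
      exact mul_le_of_le_one_right (by positivity)
        (Real.rpow_le_one_of_one_le_of_nonpos (one_le_phi z) (by linarith))
  have e2 : (fun z : Ed d => cos ⟪x, z⟫ * (exp (-a * psi α z) *
      ∫ s in Ioo a t, exp (-(s - a) * phi z ^ (α / 2)) * phi z ^ (-(ν - α / 2)))) =
      fun z => cos ⟪x, z⟫ * (exp (-a * psi α z) * phi z ^ (-ν)) -
        cos ⟪x, z⟫ * (exp (-t * psi α z) * phi z ^ (-ν)) := by
    ext z
    have hp := phi_pos z
    set c := phi z ^ (α / 2) with hc
    have hc0 : 0 < c := by positivity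
    have h3 : ∫ s in Ioo a t, exp (-(s - a) * c) * phi z ^ (-(ν - α / 2)) =
        (1 - exp (-(t - a) * c)) * phi z ^ (-ν) := by
      rw [integral_mul_const, ← integral_Ioc_eq_integral_Ioo, ← intervalIntegral.integral_of_le hat.le]
      have hd : ∀ s ∈ Set.uIcc a t, HasDerivAt (fun s => -(exp (-(s - a) * c) / c)) (exp (-(s - a) * c)) s := by
        intro s _
        have := ((((hasDerivAt_id s).sub_const a).neg.mul_const c).exp.div_const c).neg
        refine HasDerivAt.congr_deriv (f := fun s => -(exp (-(s - a) * c) / c)) this ?_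
        simp
        rw [neg_div, neg_neg, mul_div_assoc, div_self hc0.ne', mul_one]
      rw [intervalIntegral.integral_eq_sub_of_hasDerivAt hd
        (by apply Continuous.intervalIntegrable; fun_prop)]
      have : phi z ^ (-(ν - α / 2)) = c * phi z ^ (-ν) := by
        rw [hc, ← Real.rpow_add hp]; congr 1; ring
      rw [this]; simp; field_simp; ring
    rw [h3]
    have h4 : exp (-t * psi α z) = exp (-a * psi α z) * exp (-(t - a) * c) := by
      rw [← exp_add]; congr 1; unfold psi; rw [← hc]; ring
    rw [h4]; ring
  rw [e2, integral_sub (hIntg a ha) (hIntg t (ha.trans hat))]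
  ring

lemma ell_diff (d : ℕ) {α : ℝ} (hα : 0 < α) (ν a t : ℝ) (hν : α / 2 < ν) (ha : 0 < a) (hat : a < t)
    (x : Ed d) : ell d α ν a x = ell d α ν t x +
      ∫ r in Ioo a t, Gamma ν / Gamma (ν - α / 2) * ell d α (ν - α / 2) r x := by
  have hν0 : 0 < ν := by linarith
  have hG : Gamma (ν - α / 2) ≠ 0 := (Real.Gamma_pos_of_pos (by linarith)).ne'
  rw [ell_eq d hα ν a hν0 ha, ell_eq d hα ν t hν0 (ha.trans hat), MM_diff d hα ν a t hν ha hat,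
    mul_add, ← integral_const_mul]
  congr 1
  refine setIntegral_congr_fun measurableSet_Ioo fun r hr => ?_
  beta_reduce
  rw [ell_eq d hα (ν - α / 2) r (by linarith) (ha.trans hr.1), ← mul_assoc, div_mul_cancel₀ _ hG]

lemma ell_bound (d : ℕ) {α : ℝ} (hα : 0 < α) (hα2 : α < 2) (x : Ed d) (hx : x ≠ 0) :
    ∃ C : ℝ, 0 < C ∧ ∀ ν a s : ℝ, 0 ≤ a → 0 < s →
      ‖s ^ (ν - 1) * GG d α a s x‖ ≤ C * (s ^ (ν - 1) * exp (-s)) := by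
  obtain ⟨C, hC0, hC⟩ := GG_le d hα hα2 x hx
  refine ⟨C, hC0, fun ν a s ha hs => ?_⟩
  rw [norm_of_nonneg (mul_nonneg (by positivity) (GG_nonneg d hα hα2 a s ha hs.le (Or.inr hs) x))]
  have h1 : exp (-a) ≤ 1 := exp_le_one_iff.2 (by linarith)
  calc _ ≤ s ^ (ν - 1) * (C * (exp (-a) * exp (-s))) :=
        mul_le_mul_of_nonneg_left (hC a s ha hs.le (Or.inr hs)) (by positivity)
    _ ≤ s ^ (ν - 1) * (C * (1 * exp (-s))) := by gcongr
    _ = _ := by ring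

lemma measurable_ell_integrand (d : ℕ) (α ν a : ℝ) (x : Ed d) :
    Measurable (fun s : ℝ => s ^ (ν - 1) * GG d α a s x) :=
  (by fun_prop : Measurable fun s : ℝ => s ^ (ν - 1)).mul
    ((measurable_GG d α).comp (f := fun s : ℝ => (a, s, x)) (by fun_prop))

lemma ell_integrable (d : ℕ) {α : ℝ} (hα : 0 < α) (hα2 : α < 2) (x : Ed d) (hx : x ≠ 0)
    (ν a : ℝ) (hν : 0 < ν) (ha : 0 ≤ a) :
    IntegrableOn (fun s : ℝ => s ^ (ν - 1) * GG d α a s x) (Ioi 0) := by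
  obtain ⟨C, hC0, hC⟩ := ell_bound d hα hα2 x hx
  refine ((integrableOn_gamma ν hν).const_mul C).mono'
    (measurable_ell_integrand d α ν a x).aestronglyMeasurable ?_
  filter_upwards [ae_restrict_mem measurableSet_Ioi] with s hs
  exact hC ν a s ha hs

lemma ell_tendsto (d : ℕ) {α : ℝ} (hα : 0 < α) (hα2 : α < 2) (x : Ed d) (hx : x ≠ 0)
    (ν : ℝ) (hν : 0 < ν) :
    Tendsto (fun a => ell d α ν a x) (nhdsWithin 0 (Ioi 0)) (nhds (ell d α ν 0 x)) := by
  obtain ⟨C, hC0, hC⟩ := ell_bound d hα hα2 x hx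
  unfold ell
  refine tendsto_integral_filter_of_dominated_convergence
    (fun s => C * (s ^ (ν - 1) * exp (-s))) ?_ ?_ ((integrableOn_gamma ν hν).const_mul C) ?_
  · exact Eventually.of_forall fun a => (measurable_ell_integrand d α ν a x).aestronglyMeasurable
  · filter_upwards [self_mem_nhdsWithin] with a ha
    filter_upwards [ae_restrict_mem measurableSet_Ioi] with s hs
    exact hC ν a s (le_of_lt ha) hs
  · filter_upwards [ae_restrict_mem measurableSet_Ioi] with s hs
    refine Tendsto.const_mul _ ?_
    refine GG_tendsto d hα 0 s le_rfl (le_of_lt hs) (Or.inr hs) x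
      (tendsto_id.mono_left nhdsWithin_le_nhds) tendsto_const_nhds ?_ (Eventually.of_forall fun _ => le_rfl)
    filter_upwards [self_mem_nhdsWithin] with a ha
    exact le_of_lt ha

lemma ell_nonneg (d : ℕ) {α : ℝ} (hα : 0 < α) (hα2 : α < 2) (x : Ed d) (ν a : ℝ) (ha : 0 ≤ a) :
    0 ≤ ell d α ν a x := by
  refine setIntegral_nonneg measurableSet_Ioi fun s hs => ?_
  have hs : 0 < s := hs
  exact mul_nonneg (by positivity) (GG_nonneg d hα hα2 a s ha hs.le (Or.inr hs) x)

lemma measurable_ell (d : ℕ) (α ν : ℝ) (x : Ed d) : Measurable (fun a => ell d α ν a x) := by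
  unfold ell
  apply StronglyMeasurable.measurable
  apply StronglyMeasurable.integral_prod_right
    (f := fun (a s : ℝ) => s ^ (ν - 1) * GG d α a s x)
  apply Measurable.stronglyMeasurable
  exact (by fun_prop : Measurable fun p : ℝ × ℝ => p.2 ^ (ν - 1)).mul
    ((measurable_GG d α).comp (f := fun p : ℝ × ℝ => (p.1, p.2, x)) (by fun_prop))

lemma ell_le (d : ℕ) {α : ℝ} (hα : 0 < α) (hα2 : α < 2) (x : Ed d) (hx : x ≠ 0) (ν : ℝ) (hν : 0 < ν) :
    ∃ C : ℝ, ∀ a, 0 ≤ a → ell d α ν a x ≤ C := by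
  obtain ⟨C, hC0, hC⟩ := ell_bound d hα hα2 x hx
  refine ⟨∫ s in Ioi (0 : ℝ), C * (s ^ (ν - 1) * exp (-s)), fun a ha => ?_⟩
  refine setIntegral_mono_on (ell_integrable d hα hα2 x hx ν a hν ha)
    ((integrableOn_gamma ν hν).const_mul C) measurableSet_Ioi fun s hs => ?_
  exact (le_abs_self _).trans (hC ν a s ha hs)

/-- Resolvent-type relation. -/
lemma ell_rel (d : ℕ) {α : ℝ} (hα : 0 < α) (hα2 : α < 2) (x : Ed d) (hx : x ≠ 0)
    (ν t : ℝ) (hν : α / 2 < ν) (ht : 0 < t) :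
    ENNReal.ofReal (ell d α ν t x) + ∫⁻ r in Ioo 0 t,
      ENNReal.ofReal (Gamma ν / Gamma (ν - α / 2) * ell d α (ν - α / 2) r x) =
      ENNReal.ofReal (ell d α ν 0 x) := by
  have hν0 : 0 < ν := by linarith
  have hA : 0 < Gamma ν / Gamma (ν - α / 2) :=
    div_pos (Real.Gamma_pos_of_pos hν0) (Real.Gamma_pos_of_pos (by linarith))
  set A := Gamma ν / Gamma (ν - α / 2) with hAdef
  set w : ℝ → ℝ := fun r => A * ell d α (ν - α / 2) r x with hw
  have hwm : Measurable w := (measurable_ell d α _ x).const_mul A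
  obtain ⟨C, hC⟩ := ell_le d hα hα2 x hx (ν - α / 2) (by linarith)
  have hw0 : ∀ r, 0 ≤ r → 0 ≤ w r := fun r hr => mul_nonneg hA.le (ell_nonneg d hα hα2 x _ r hr)
  have hwi : IntegrableOn w (Ioo 0 t) := by
    refine Measure.integrableOn_of_bounded (M := A * C) (by simp) hwm.aestronglyMeasurable ?_
    filter_upwards [ae_restrict_mem measurableSet_Ioo] with r hr
    rw [norm_of_nonneg (hw0 r hr.1.le)]
    exact mul_le_mul_of_nonneg_left (hC r hr.1.le) hA.le
  rw [← ofReal_integral_eq_lintegral_ofReal hwi (by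
    filter_upwards [ae_restrict_mem measurableSet_Ioo] with r hr using hw0 r hr.1.le),
    ← ENNReal.ofReal_add (ell_nonneg d hα hα2 x _ _ ht.le)
      (setIntegral_nonneg measurableSet_Ioo fun r hr => hw0 r hr.1.le)]
  congr 1
  have hii : IntervalIntegrable w volume 0 t := by
    rw [intervalIntegrable_iff_integrableOn_Ioo_of_le ht.le]; exact hwi
  have hcont : Tendsto (fun a => ∫ r in a..t, w r) (nhdsWithin 0 (Ioi 0)) (nhds (∫ r in (0 : ℝ)..t, w r)) := by
    have h1 := intervalIntegral.continuousOn_primitive_interval' hii (a := t) (by simp)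
    have h2 := (h1 0 (by simp)).neg
    have e : ∀ a, -∫ r in t..a, w r = ∫ r in a..t, w r := fun a => by
      rw [intervalIntegral.integral_symm, neg_neg]
    have h3 : Tendsto (fun a => ∫ r in a..t, w r) (nhdsWithin 0 (uIcc 0 t)) (nhds (∫ r in (0 : ℝ)..t, w r)) := by
      have := h2.tendsto
      simp only [Pi.neg_apply, e] at this
      refine this.congr fun a => ?_
      rw [Pi.neg_apply, e]
    refine h3.mono_left ?_
    rw [uIcc_of_le ht.le]
    rw [← nhdsWithin_Ioo_eq_nhdsGT ht]
    exact nhdsWithin_mono _ Ioo_subset_Icc_self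
  rw [← integral_Ioc_eq_integral_Ioo, ← intervalIntegral.integral_of_le ht.le]
  refine tendsto_nhds_unique (f := fun a => ell d α ν a x) (l := nhdsWithin 0 (Ioi 0)) ?_
    (ell_tendsto d hα hα2 x hx ν hν0)
  refine (hcont.const_add (ell d α ν t x)).congr' ?_
  filter_upwards [Ioo_mem_nhdsGT ht] with a ha
  rw [ell_diff d hα ν a t hν ha.1 ha.2, intervalIntegral.integral_of_le ha.2.le,
    integral_Ioc_eq_integral_Ioo]

/-- The Green-type function. -/
lemma green_eq (d : ℕ) {α : ℝ} (hα : 0 < α) (hα2 : α < 2) (x : Ed d) (hx : x ≠ 0)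
    (ν : ℝ) (hν : 0 < ν) :
    ∫ r in Ioi (0 : ℝ), r ^ (ν / (α / 2) - 1) * GG d α r 0 x =
      Gamma (ν / (α / 2)) / Gamma ν * ell d α ν 0 x := by
  have hg : 0 < ν / (α / 2) := by positivity
  set g := ν / (α / 2) with hgdef
  obtain ⟨C, hC0, hC⟩ := GG_le d hα hα2 x hx
  have h1 : ∀ a, 0 < a → ∫ r in Ioi (0 : ℝ), r ^ (g - 1) * GG d α (a + r) 0 x =
      Gamma g / Gamma ν * ell d α ν a x := by
    intro a ha
    have h := fub d hα a ha x (Ioi 0) measurableSet_Ioi (fun s c => s ^ (g - 1) * exp (-s * c ^ (α / 2)))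
      (by fun_prop) _ (integrableOn_gamma g hg) (by
        intro s hs c hc
        have hs : 0 < s := hs
        rw [norm_of_nonneg (by positivity)]
        apply mul_le_mul_of_nonneg_left _ (by positivity)
        apply exp_le_exp.2
        have := Real.one_le_rpow hc (by positivity : 0 ≤ α / 2)
        nlinarith)
    have e1 : ∀ r, r ^ (g - 1) * GG d α (a + r) 0 x = (2 * π) ^ (-(d : ℝ)) *
        ∫ z : Ed d, cos ⟪x, z⟫ * (exp (-a * psi α z) * (r ^ (g - 1) * exp (-r * phi z ^ (α / 2)))) := by
      intro r
      unfold GG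
      rw [mul_left_comm, ← integral_const_mul]
      congr 2; ext z
      have : exp (-(a + r) * psi α z) = exp (-a * psi α z) * exp (-r * phi z ^ (α / 2)) := by
        rw [← exp_add]; congr 1; unfold psi; ring
      rw [this]; simp; ring
    simp_rw [e1]
    rw [h, ell_eq d hα ν a hν ha]
    have hG : Gamma ν ≠ 0 := (Real.Gamma_pos_of_pos hν).ne'
    rw [← mul_assoc, div_mul_cancel₀ _ hG]
    unfold MM
    rw [mul_left_comm, ← integral_const_mul (Gamma g)]
    congr 2
    ext z
    have hp := phi_pos z
    have h2 := Real.integral_rpow_mul_exp_neg_mul_Ioi hg (by positivity : 0 < phi z ^ (α / 2))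
    have h3 : ∫ s in Ioi (0 : ℝ), s ^ (g - 1) * exp (-s * phi z ^ (α / 2)) = phi z ^ (-ν) * Gamma g := by
      have e3 : phi z ^ (-ν) = (1 / phi z ^ (α / 2)) ^ g := by
        rw [one_div, Real.inv_rpow (by positivity), ← Real.rpow_mul hp.le, Real.rpow_neg hp.le]
        congr 2; rw [hgdef]; field_simp
      rw [e3, ← h2]
      congr 1; ext s; congr 2; ring
    rw [h3]; ring
  have h2 := (ell_tendsto d hα hα2 x hx ν hν).const_mul (Gamma g / Gamma ν)
  refine tendsto_nhds_unique (f := fun a => ∫ r in Ioi (0 : ℝ), r ^ (g - 1) * GG d α (a + r) 0 x)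
    (l := nhdsWithin 0 (Ioi 0)) ?_ (h2.congr' ?_)
  · refine tendsto_integral_filter_of_dominated_convergence
      (fun s => C * (s ^ (g - 1) * exp (-s))) ?_ ?_ ((integrableOn_gamma g hg).const_mul C) ?_
    · refine Eventually.of_forall fun a => Measurable.aestronglyMeasurable ?_
      exact (by fun_prop : Measurable fun s : ℝ => s ^ (g - 1)).mul
        ((measurable_GG d α).comp (f := fun s : ℝ => (a + s, (0 : ℝ), x)) (by fun_prop))
    · filter_upwards [self_mem_nhdsWithin] with a ha
      have ha : 0 < a := ha
      filter_upwards [ae_restrict_mem measurableSet_Ioi] with r hr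
      have hr : 0 < r := hr
      rw [norm_of_nonneg (mul_nonneg (by positivity)
        (GG_nonneg d hα hα2 (a + r) 0 (by positivity) le_rfl (Or.inl (by positivity)) x))]
      have h5 := hC (a + r) 0 (by positivity) le_rfl (Or.inl (by positivity))
      rw [neg_zero, exp_zero, mul_one] at h5
      have h6 : exp (-(a + r)) ≤ exp (-r) := exp_le_exp.2 (by linarith)
      calc _ ≤ r ^ (g - 1) * (C * exp (-r)) := by
            apply mul_le_mul_of_nonneg_left _ (by positivity)
            exact h5.trans (mul_le_mul_of_nonneg_left h6 hC0.le)
        _ = _ := by ring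
    · filter_upwards [ae_restrict_mem measurableSet_Ioi] with r hr
      refine Tendsto.const_mul _ ?_
      have ht : Tendsto (fun a : ℝ => a + r) (nhdsWithin 0 (Ioi 0)) (nhds r) := by
        have : Tendsto (fun a : ℝ => a + r) (nhds 0) (nhds (0 + r)) := tendsto_id.add_const r
        rw [zero_add] at this
        exact this.mono_left nhdsWithin_le_nhds
      refine GG_tendsto d hα r 0 (le_of_lt hr) le_rfl (Or.inl hr) x
        ht tendsto_const_nhds ?_ (Eventually.of_forall fun _ => le_rfl)
      filter_upwards [self_mem_nhdsWithin] with a ha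
      have : 0 < a := ha
      linarith
  · filter_upwards [self_mem_nhdsWithin] with a ha
    exact (h1 a ha).symm

end HardyAux

namespace HardyAux

/-- The integral in the Bessel function. -/
def JJ (β r : ℝ) : ℝ := ∫ u in Ioi (0 : ℝ), u ^ (-(β / 2) - 1) * exp (-u - r ^ 2 / (4 * u))

/-- The Gamma quotient. -/
def AA (d : ℕ) (α β : ℝ) : ℝ := Gamma (((d : ℝ) - β) / 2) / Gamma (((d : ℝ) - β - α) / 2)

lemma integrand_eq (d : ℕ) (β s : ℝ) (hs : 0 < s) (x : Ed d) :
    s ^ (((d : ℝ) - β) / 2 - 1) * FF d s x =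
      (4 * π) ^ (-((d : ℝ) / 2)) * (s ^ (-(β / 2) - 1) * exp (-s - ‖x‖ ^ 2 / (4 * s))) := by
  unfold FF
  rw [Real.mul_rpow (by positivity) hs.le, sub_eq_add_neg (-s), exp_add]
  have : s ^ (-(β / 2) - 1) = s ^ (((d : ℝ) - β) / 2 - 1) * s ^ (-((d : ℝ) / 2)) := by
    rw [← Real.rpow_add hs]; congr 1; ring
  rw [this]; ring

lemma ell_zero (d : ℕ) (α β : ℝ) (x : Ed d) :
    ell d α (((d : ℝ) - β) / 2) 0 x = (4 * π) ^ (-((d : ℝ) / 2)) * JJ β ‖x‖ := by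
  unfold ell JJ
  rw [← integral_const_mul]
  refine setIntegral_congr_fun measurableSet_Ioi fun s hs => ?_
  beta_reduce
  rw [GG_zero d α s hs, integrand_eq d β s hs]

lemma JJ_eq_lint (d : ℕ) {α : ℝ} (hα : 0 < α) (hα2 : α < 2) (β : ℝ) (hβ : β < d) (y : Ed d) (hy : y ≠ 0) :
    ENNReal.ofReal (JJ β ‖y‖) = ENNReal.ofReal ((4 * π) ^ ((d : ℝ) / 2)) *
      ∫⁻ s in Ioi (0 : ℝ), ENNReal.ofReal (s ^ (((d : ℝ) - β) / 2 - 1)) * ENNReal.ofReal (FF d s y) := by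
  have hc : (4 * π) ^ ((d : ℝ) / 2) * (4 * π) ^ (-((d : ℝ) / 2)) = 1 := by
    rw [← Real.rpow_add (by positivity)]; simp
  have h1 : JJ β ‖y‖ = (4 * π) ^ ((d : ℝ) / 2) * ell d α (((d : ℝ) - β) / 2) 0 y := by
    rw [ell_zero, ← mul_assoc, hc, one_mul]
  rw [h1, ENNReal.ofReal_mul (by positivity)]
  congr 1
  unfold ell
  rw [ofReal_integral_eq_lintegral_ofReal (ell_integrable d hα hα2 y hy _ 0 (by linarith) le_rfl)]
  · refine setLIntegral_congr_fun measurableSet_Ioi fun s hs => ?_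
    have hs : 0 < s := hs
    beta_reduce
    rw [GG_zero d α s hs, ENNReal.ofReal_mul (by positivity)]
  · filter_upwards [ae_restrict_mem measurableSet_Ioi] with s hs
    have hs : 0 < s := hs
    exact mul_nonneg (by positivity) (GG_nonneg d hα hα2 0 s le_rfl hs.le (Or.inr hs) y)

lemma ae_ne_zero (d : ℕ) (hd : 0 < d) : ∀ᵐ y : Ed d, y ≠ 0 := by
  haveI : Nonempty (Fin d) := ⟨⟨0, hd⟩⟩
  haveI : Nontrivial (Ed d) := inferInstance
  exact Measure.ae_ne volume 0

lemma PJ (d : ℕ) (hd : 0 < d) {α : ℝ} (hα : 0 < α) (hα2 : α < 2) (β : ℝ) (hβ : β < d) (a : ℝ)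
    (ha : 0 < a) (x : Ed d) (hx : x ≠ 0) :
    ∫⁻ y : Ed d, ENNReal.ofReal (relKernel d α 1 a x y) * ENNReal.ofReal (JJ β ‖y‖) =
      ENNReal.ofReal ((4 * π) ^ ((d : ℝ) / 2) * ell d α (((d : ℝ) - β) / 2) a x) := by
  have hm : Measurable fun y : Ed d => ENNReal.ofReal (relKernel d α 1 a x y) :=
    ((measurable_relKernel d α).comp (f := fun y : Ed d => (a, x, y)) (by fun_prop)).ennreal_ofReal
  have hF : Measurable fun p : ℝ × Ed d => ENNReal.ofReal (FF d p.1 p.2) := (measurable_FF d).ennreal_ofReal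
  have hF' : Measurable fun p : Ed d × ℝ => ENNReal.ofReal (FF d p.2 p.1) :=
    hF.comp (f := fun p : Ed d × ℝ => (p.2, p.1)) (by fun_prop)
  have hs1 : Measurable fun s : ℝ => ENNReal.ofReal (s ^ (((d : ℝ) - β) / 2 - 1)) := by fun_prop
  calc _ = ∫⁻ y : Ed d, ENNReal.ofReal ((4 * π) ^ ((d : ℝ) / 2)) *
      ∫⁻ s in Ioi (0 : ℝ), ENNReal.ofReal (relKernel d α 1 a x y) *
        (ENNReal.ofReal (s ^ (((d : ℝ) - β) / 2 - 1)) * ENNReal.ofReal (FF d s y)) := by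
        refine lintegral_congr_ae ?_
        filter_upwards [ae_ne_zero d hd] with y hy
        rw [JJ_eq_lint d hα hα2 β hβ y hy, lintegral_const_mul' _ _ ENNReal.ofReal_ne_top]
        ring
    _ = ENNReal.ofReal ((4 * π) ^ ((d : ℝ) / 2)) * ∫⁻ s in Ioi (0 : ℝ), ∫⁻ y : Ed d,
        ENNReal.ofReal (relKernel d α 1 a x y) *
        (ENNReal.ofReal (s ^ (((d : ℝ) - β) / 2 - 1)) * ENNReal.ofReal (FF d s y)) := by
        rw [lintegral_const_mul' _ _ ENNReal.ofReal_ne_top, lintegral_lintegral_swap]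
        apply Measurable.aemeasurable
        exact (hm.comp measurable_fst).mul ((hs1.comp measurable_snd).mul hF')
    _ = ENNReal.ofReal ((4 * π) ^ ((d : ℝ) / 2)) * ∫⁻ s in Ioi (0 : ℝ),
        ENNReal.ofReal (s ^ (((d : ℝ) - β) / 2 - 1) * GG d α a s x) := by
        congr 1
        refine setLIntegral_congr_fun measurableSet_Ioi fun s hs => ?_
        have hs : 0 < s := hs
        beta_reduce
        simp_rw [mul_left_comm (ENNReal.ofReal (relKernel d α 1 a x _))]
        rw [lintegral_const_mul' _ _ ENNReal.ofReal_ne_top, conv_lint d hα hα2 a s ha hs,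
          ENNReal.ofReal_mul (by positivity)]
    _ = _ := by
        rw [ENNReal.ofReal_mul (by positivity)]
        congr 1
        unfold ell
        rw [ofReal_integral_eq_lintegral_ofReal (ell_integrable d hα hα2 x hx _ a (by linarith) ha.le)]
        filter_upwards [ae_restrict_mem measurableSet_Ioi] with s hs
        have hs : 0 < s := hs
        exact mul_nonneg (by positivity) (GG_nonneg d hα hα2 a s ha.le hs.le (Or.inr hs) x)

lemma AA_pos (d : ℕ) {α : ℝ} (hα : 0 < α) (β : ℝ) (hβ : β < d - α) : 0 < AA d α β :=
  div_pos (Real.Gamma_pos_of_pos (by linarith)) (Real.Gamma_pos_of_pos (by linarith))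

/-- The main relation. -/
lemma rel_JJ (d : ℕ) (hd : 0 < d) {α : ℝ} (hα : 0 < α) (hα2 : α < 2) (β : ℝ)
    (hβ : β < d - α) (t : ℝ) (ht : 0 < t) (x : Ed d) (hx : x ≠ 0) :
    (∫⁻ y : Ed d, ENNReal.ofReal (relKernel d α 1 t x y) * ENNReal.ofReal (JJ β ‖y‖)) +
      ∫⁻ r in Ioo 0 t, ∫⁻ y : Ed d, ENNReal.ofReal (relKernel d α 1 r x y) *
        ENNReal.ofReal (AA d α β * JJ (β + α) ‖y‖) = ENNReal.ofReal (JJ β ‖x‖) := by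
  have hA := AA_pos d hα β hβ
  have h := ell_rel d hα hα2 x hx (((d : ℝ) - β) / 2) t (by linarith) ht
  have hν : ((d : ℝ) - β) / 2 - α / 2 = ((d : ℝ) - (β + α)) / 2 := by ring
  have hA2 : Gamma (((d : ℝ) - β) / 2) / Gamma (((d : ℝ) - (β + α)) / 2) = AA d α β := by
    unfold AA; congr 2; ring
  rw [hν, hA2] at h
  rw [PJ d hd hα hα2 β (by linarith) t ht x hx]
  have e2 : ∫⁻ r in Ioo 0 t, ∫⁻ y : Ed d, ENNReal.ofReal (relKernel d α 1 r x y) *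
        ENNReal.ofReal (AA d α β * JJ (β + α) ‖y‖) = ENNReal.ofReal ((4 * π) ^ ((d : ℝ) / 2)) *
        ∫⁻ r in Ioo 0 t, ENNReal.ofReal (AA d α β * ell d α (((d : ℝ) - (β + α)) / 2) r x) := by
    rw [← lintegral_const_mul' _ _ ENNReal.ofReal_ne_top]
    refine setLIntegral_congr_fun measurableSet_Ioo fun r hr => ?_
    beta_reduce
    simp_rw [ENNReal.ofReal_mul hA.le, mul_left_comm (ENNReal.ofReal (relKernel d α 1 r x _))]
    rw [lintegral_const_mul' _ _ ENNReal.ofReal_ne_top,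
      PJ d hd hα hα2 (β + α) (by linarith) r hr.1 x hx, ENNReal.ofReal_mul (by positivity)]
    ring
  have hc : (4 * π) ^ ((d : ℝ) / 2) * (4 * π) ^ (-((d : ℝ) / 2)) = 1 := by
    rw [← Real.rpow_add (by positivity)]; simp
  rw [e2, ENNReal.ofReal_mul (by positivity), ← mul_add, h, ← ENNReal.ofReal_mul (by positivity),
    ell_zero, ← mul_assoc, hc, one_mul]

lemma VProf_eq (d : ℕ) (α β r : ℝ) (hr : 0 < r) :
    VProf d α β r = AA d α β * JJ (β + α) r / JJ β r := by
  unfold VProf besselK AA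
  have e1 : ∫ u in Ioi (0 : ℝ), u ^ (-((β + α) / 2) - 1) * exp (-u - r ^ 2 / (4 * u)) = JJ (β + α) r := rfl
  have e2 : ∫ u in Ioi (0 : ℝ), u ^ (-(β / 2) - 1) * exp (-u - r ^ 2 / (4 * u)) = JJ β r := rfl
  rw [e1, e2]
  have h1 : (r / 2) ^ ((β + α) / 2) = (r / 2) ^ (β / 2) * (r / 2) ^ (α / 2) := by
    rw [← Real.rpow_add (by positivity)]; congr 1; ring
  have h2 : (r / 2) ^ (α / 2) = r ^ (α / 2) / 2 ^ (α / 2) := Real.div_rpow hr.le (by norm_num) _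
  rw [h1, h2, Real.rpow_neg hr.le]
  have h3 : (r / 2) ^ (β / 2) ≠ 0 := by positivity
  have h4 : r ^ (α / 2) ≠ 0 := by positivity
  have h5 : (2 : ℝ) ^ (α / 2) ≠ 0 := by positivity
  rw [mul_div_mul_comm, mul_div_mul_comm (1 / 2 : ℝ)]
  rw [mul_div_right_comm ((r / 2) ^ (β / 2)), div_self h3]
  field_simp

lemma Vbeta_zero (d : ℕ) (α β : ℝ) (hα : 0 < α) : Vbeta d α β 0 = 0 := by
  unfold Vbeta VProf
  rw [norm_zero, Real.zero_rpow (by linarith), mul_zero]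

lemma hBeta_eq (d : ℕ) {α : ℝ} (hα : 0 < α) (hα2 : α < 2) (δ : ℝ) (hδ : δ < d) :
    ∃ c : ℝ, 0 < c ∧ ∀ x : Ed d, x ≠ 0 → hBeta d α δ x = c * JJ δ ‖x‖ := by
  have hν : 0 < ((d : ℝ) - δ) / 2 := by linarith
  refine ⟨Gamma (((d : ℝ) - δ) / 2 / (α / 2)) / Gamma (((d : ℝ) - δ) / 2) * (4 * π) ^ (-((d : ℝ) / 2)),
    mul_pos (div_pos (Real.Gamma_pos_of_pos (by positivity)) (Real.Gamma_pos_of_pos hν)) (by positivity),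
    fun x hx => ?_⟩
  rw [mul_assoc, ← ell_zero d α, ← green_eq d hα hα2 x hx _ hν]
  unfold hBeta hBetaM
  congr 1
  ext t
  rw [relKernel_eq, zero_sub, GG_neg]
  congr 2
  field_simp
  ring

end HardyAux

namespace HardyAux

/-- Rescaled Bessel integrand. -/
def ii (β r v : ℝ) : ℝ := v ^ (-(β / 2) - 1) * exp (-(r ^ 2 * v) - 1 / (4 * v))

/-- Rescaled Bessel integral. -/
def II (β r : ℝ) : ℝ := ∫ v in Ioi (0 : ℝ), ii β r v

lemma ii_nonneg (β r v : ℝ) (hv : 0 < v) : 0 ≤ ii β r v := by unfold ii; positivity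

lemma measurable_ii (β r : ℝ) : Measurable (ii β r) := by unfold ii; fun_prop

lemma integrableOn_rpow_exp (β c : ℝ) (hβ : 0 < β) (hc : 0 < c) :
    IntegrableOn (fun v : ℝ => v ^ (-(β / 2) - 1) * exp (-(c / v))) (Ioi 0) := by
  have hm : Measurable (fun v : ℝ => v ^ (-(β / 2) - 1) * exp (-(c / v))) := by fun_prop
  rw [← Ioc_union_Ioi_eq_Ioi (zero_le_one' ℝ)]
  apply IntegrableOn.union
  · obtain ⟨n, hn⟩ := exists_nat_gt (β / 2 + 1)
    refine Measure.integrableOn_of_bounded (M := n.factorial / c ^ n) (by simp) hm.aestronglyMeasurable ?_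
    filter_upwards [ae_restrict_mem measurableSet_Ioc] with v hv
    have hv0 : 0 < v := hv.1
    rw [norm_of_nonneg (by positivity), exp_neg]
    have h1 := Real.pow_div_factorial_le_exp (c / v) (by positivity) n
    have h2 : v ^ (-(β / 2) - 1) ≤ (v ^ n)⁻¹ := by
      rw [← Real.rpow_natCast, ← Real.rpow_neg hv0.le]
      exact Real.rpow_le_rpow_of_exponent_ge hv0 hv.2 (by linarith)
    calc _ ≤ (v ^ n)⁻¹ * ((c / v) ^ n / n.factorial)⁻¹ :=
          mul_le_mul h2 (inv_anti₀ (by positivity) h1) (by positivity) (by positivity)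
      _ = _ := by rw [div_pow]; field_simp
  · refine (integrableOn_Ioi_rpow_of_lt (a := -(β / 2) - 1) (by linarith) one_pos).mono'
      hm.aestronglyMeasurable ?_
    filter_upwards [ae_restrict_mem measurableSet_Ioi] with v hv
    have hv0 : 0 < v := lt_trans one_pos hv
    rw [norm_of_nonneg (by positivity)]
    exact mul_le_of_le_one_right (by positivity) (exp_le_one_iff.2 (by
      have : 0 < c / v := by positivity
      linarith))

lemma integrableOn_ii (β r : ℝ) (hβ : 0 < β) : IntegrableOn (ii β r) (Ioi 0) := by
  refine (integrableOn_rpow_exp β (1 / 4) hβ (by norm_num)).mono' (measurable_ii β r).aestronglyMeasurable ?_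
  filter_upwards [ae_restrict_mem measurableSet_Ioi] with v hv
  have hv : 0 < v := hv
  rw [norm_of_nonneg (ii_nonneg β r v hv)]
  unfold ii
  apply mul_le_mul_of_nonneg_left _ (by positivity)
  apply exp_le_exp.2
  have : 0 ≤ r ^ 2 * v := by positivity
  have e : (1 : ℝ) / 4 / v = 1 / (4 * v) := by rw [div_div]
  rw [e]; linarith

lemma II_pos (β r : ℝ) (hβ : 0 < β) : 0 < II β r := by
  unfold II
  rw [integral_pos_iff_support_of_nonneg_ae]
  · have : Ioi (0 : ℝ) ⊆ Function.support (ii β r) := by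
      intro v hv
      have hv : 0 < v := hv
      have : 0 < ii β r v := by unfold ii; positivity
      exact this.ne'
    rw [Measure.restrict_apply' measurableSet_Ioi, inter_eq_right.2 this]
    simp
  · filter_upwards [ae_restrict_mem measurableSet_Ioi] with v hv using ii_nonneg β r v hv
  · exact integrableOn_ii β r hβ

lemma II_anti (β r R : ℝ) (hβ : 0 < β) (hr : 0 ≤ r) (hR : r ≤ R) : II β R ≤ II β r := by
  refine setIntegral_mono_on (integrableOn_ii β R hβ) (integrableOn_ii β r hβ) measurableSet_Ioi fun v hv => ?_
  have hv : 0 < v := hv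
  unfold ii
  apply mul_le_mul_of_nonneg_left _ (by positivity)
  apply exp_le_exp.2
  have : r ^ 2 * v ≤ R ^ 2 * v := by gcongr
  linarith

lemma JJ_eq_II (β r : ℝ) (hr : 0 < r) : JJ β r = r ^ (-β) * II β r := by
  have h := integral_comp_mul_left_Ioi (fun u : ℝ => u ^ (-(β / 2) - 1) * exp (-u - r ^ 2 / (4 * u)))
    0 (by positivity : 0 < r ^ 2)
  rw [mul_zero, smul_eq_mul, eq_inv_mul_iff_mul_eq₀ (by positivity)] at h
  unfold JJ II
  rw [← h, ← integral_const_mul, ← integral_const_mul]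
  refine setIntegral_congr_fun measurableSet_Ioi fun v hv => ?_
  have hv : 0 < v := hv
  beta_reduce
  unfold ii
  rw [Real.mul_rpow (by positivity) hv.le]
  have e1 : r ^ 2 / (4 * (r ^ 2 * v)) = 1 / (4 * v) := by field_simp
  have e2 : r ^ (-β) = r ^ 2 * (r ^ 2) ^ (-(β / 2) - 1) := by
    have h2 : (r ^ 2) = r ^ (2 : ℝ) := by norm_cast
    rw [h2, ← Real.rpow_mul hr.le, ← Real.rpow_add hr]; congr 1; ring
  rw [e1, e2]; ring

lemma JJ_pos (β r : ℝ) (hβ : 0 < β) (hr : 0 < r) : 0 < JJ β r := by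
  rw [JJ_eq_II β r hr]; exact mul_pos (by positivity) (II_pos β r hβ)

lemma JJ_le (β r : ℝ) (hβ : 0 < β) (hr : 0 < r) : JJ β r ≤ II β 0 * r ^ (-β) := by
  rw [JJ_eq_II β r hr, mul_comm]
  exact mul_le_mul_of_nonneg_right (II_anti β 0 r hβ le_rfl hr.le) (by positivity)

lemma le_JJ (β r R : ℝ) (hβ : 0 < β) (hr : 0 < r) (hR : r ≤ R) : II β R * r ^ (-β) ≤ JJ β r := by
  rw [JJ_eq_II β r hr, mul_comm (r ^ _)]
  exact mul_le_mul_of_nonneg_right (II_anti β r R hβ hr.le hR) (by positivity)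

lemma integrableOn_JJ (β r : ℝ) (hβ : 0 < β) (hr : 0 < r) :
    IntegrableOn (fun u : ℝ => u ^ (-(β / 2) - 1) * exp (-u - r ^ 2 / (4 * u))) (Ioi 0) := by
  refine (integrableOn_rpow_exp β (r ^ 2 / 4) hβ (by positivity)).mono'
    (by apply Measurable.aestronglyMeasurable; fun_prop) ?_
  filter_upwards [ae_restrict_mem measurableSet_Ioi] with v hv
  have hv : 0 < v := hv
  rw [norm_of_nonneg (by positivity)]
  apply mul_le_mul_of_nonneg_left _ (by positivity)
  apply exp_le_exp.2
  have e : r ^ 2 / 4 / v = r ^ 2 / (4 * v) := by rw [div_div]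
  rw [e]; linarith

/-- For large argument the quotient of Bessel functions is bounded. -/
lemma JJ_quot_large (δ α : ℝ) (hδ : 0 < δ) (hα : 0 < α) :
    ∃ C : ℝ, 0 < C ∧ ∀ r ≥ 1, JJ (δ + α) r ≤ C * JJ δ r := by
  set D := ∫ u in Ioi (0 : ℝ), u ^ (-((δ + α) / 2) - 1) * exp (-(1 / 8 / u)) with hD
  have hDi := integrableOn_rpow_exp (δ + α) (1 / 8) (by positivity) (by norm_num)
  have hD0 : 0 ≤ D := setIntegral_nonneg measurableSet_Ioi fun u hu => by
    have hu : 0 < u := hu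
    positivity
  set c := (3 : ℝ) ^ (-(δ / 2) - 1) * exp (-3) with hc
  have hc0 : 0 < c := by positivity
  refine ⟨1 + D / c, by positivity, fun r hr => ?_⟩
  have hr0 : 0 < r := by linarith
  have hJi := integrableOn_JJ δ r hδ hr0
  have hnn : ∀ u ∈ Ioi (0 : ℝ), 0 ≤ u ^ (-(δ / 2) - 1) * exp (-u - r ^ 2 / (4 * u)) := by
    intro u hu
    have hu : 0 < u := hu
    positivity
  -- lower bound
  have hlow : c * exp (-(r ^ 2 / 8)) ≤ JJ δ r := by
    have h1 : ∫ u in Ioc (2 : ℝ) 3, c * exp (-(r ^ 2 / 8)) ≤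
        ∫ u in Ioc (2 : ℝ) 3, u ^ (-(δ / 2) - 1) * exp (-u - r ^ 2 / (4 * u)) := by
      refine setIntegral_mono_on (integrable_const _) (hJi.mono_set fun u hu => lt_trans two_pos hu.1)
        measurableSet_Ioc fun u hu => ?_
      have hu0 : 0 < u := lt_trans two_pos hu.1
      rw [hc, mul_assoc, ← exp_add]
      apply mul_le_mul
      · exact Real.rpow_le_rpow_of_nonpos hu0 hu.2 (by linarith)
      · apply exp_le_exp.2
        have : r ^ 2 / (4 * u) ≤ r ^ 2 / 8 := by
          apply div_le_div_of_nonneg_left (by positivity) (by norm_num)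
          linarith [hu.1]
        linarith [hu.2]
      · positivity
      · positivity
    have h2 : ∫ u in Ioc (2 : ℝ) 3, c * exp (-(r ^ 2 / 8)) = c * exp (-(r ^ 2 / 8)) := by
      simp; norm_num
    rw [h2] at h1
    refine h1.trans ?_
    refine setIntegral_mono_set hJi ?_ (Eventually.of_forall fun u hu => lt_trans two_pos hu.1)
    filter_upwards [ae_restrict_mem measurableSet_Ioi] with u hu using hnn u hu
  have hup : JJ (δ + α) r ≤ JJ δ r + exp (-(r ^ 2 / 8)) * D := by
    unfold JJ
    rw [hD, ← integral_const_mul, ← integral_add hJi (hDi.const_mul _)]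
    refine setIntegral_mono_on (integrableOn_JJ (δ + α) r (by positivity) hr0)
      (hJi.add (hDi.const_mul _)) measurableSet_Ioi fun u hu => ?_
    have hu : 0 < u := hu
    rcases le_total 1 u with h | h
    · have h1 : u ^ (-((δ + α) / 2) - 1) ≤ u ^ (-(δ / 2) - 1) :=
        Real.rpow_le_rpow_of_exponent_le h (by linarith)
      have h2 := mul_le_mul_of_nonneg_right h1 (exp_pos (-u - r ^ 2 / (4 * u))).le
      have h3 : 0 ≤ exp (-(r ^ 2 / 8)) * (u ^ (-((δ + α) / 2) - 1) * exp (-(1 / 8 / u))) := by positivity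
      linarith
    · have h1 : exp (-u - r ^ 2 / (4 * u)) ≤ exp (-(r ^ 2 / 8)) * exp (-(1 / 8 / u)) := by
        rw [← exp_add]
        apply exp_le_exp.2
        have e : r ^ 2 / (4 * u) = r ^ 2 / (8 * u) + r ^ 2 / (8 * u) := by field_simp; ring
        have h2 : r ^ 2 / 8 ≤ r ^ 2 / (8 * u) := by
          apply div_le_div_of_nonneg_left (by positivity) (by positivity)
          linarith
        have h3 : 1 / 8 / u ≤ r ^ 2 / (8 * u) := by
          rw [div_div]
          apply div_le_div_of_nonneg_right _ (by positivity)
          nlinarith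
        linarith
      have h2 := mul_le_mul_of_nonneg_left h1 (by positivity : 0 ≤ u ^ (-((δ + α) / 2) - 1))
      have h3 := hnn u hu
      linarith
  have : exp (-(r ^ 2 / 8)) * D ≤ D / c * JJ δ r := by
    rw [div_mul_eq_mul_div, le_div_iff₀ hc0]
    nlinarith
  linarith

lemma II_lower (β : ℝ) (hβ : 0 < β) : exp (-(5 / 4)) / β ≤ II β (2 ^ (-(1 / β))) := by
  set r : ℝ := 2 ^ (-(1 / β)) with hr
  have hr0 : 0 < r := by positivity
  have hr1 : r ≤ 1 := Real.rpow_le_one_of_one_le_of_nonpos (by norm_num) (by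
    have : 0 < 1 / β := by positivity
    linarith)
  set b := (r ^ 2)⁻¹ with hb
  have hb1 : 1 ≤ b := by
    rw [hb]; exact (one_le_inv₀ (by positivity)).2 (by nlinarith)
  have hrb : r ^ β = 1 / 2 := by
    rw [hr, ← Real.rpow_mul (by norm_num)]
    have : -(1 / β) * β = -1 := by field_simp
    rw [this, Real.rpow_neg_one]; norm_num
  have hpow : b ^ (-(β / 2)) = 1 / 2 := by
    rw [hb, Real.inv_rpow (by positivity), Real.rpow_neg (by positivity), inv_inv]
    have h2 : (r ^ 2) = r ^ (2 : ℝ) := by norm_cast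
    rw [h2, ← Real.rpow_mul hr0.le, ← hrb]; congr 1; ring
  have hIntg : ∫ v in (1 : ℝ)..b, v ^ (-(β / 2) - 1) = 1 / β := by
    rw [integral_rpow]
    · have e : -(β / 2) - 1 + 1 = -(β / 2) := by ring
      rw [e, hpow, Real.one_rpow]
      field_simp; norm_num
    · right
      refine ⟨by linarith, ?_⟩
      rw [uIcc_of_le hb1]
      intro h; linarith [h.1]
  have h1 : ∫ v in Ioc (1 : ℝ) b, exp (-(5 / 4)) * v ^ (-(β / 2) - 1) ≤ ∫ v in Ioc (1 : ℝ) b, ii β r v := by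
    refine setIntegral_mono_on ?_ ((integrableOn_ii β r hβ).mono_set fun u hu => lt_trans one_pos hu.1)
      measurableSet_Ioc fun v hv => ?_
    · apply Integrable.const_mul
      exact (integrableOn_Ioi_rpow_of_lt (a := -(β / 2) - 1) (by linarith) one_pos).mono_set Ioc_subset_Ioi_self
    · have hv0 : 0 < v := lt_trans one_pos hv.1
      unfold ii
      rw [mul_comm]
      apply mul_le_mul_of_nonneg_left _ (by positivity)
      apply exp_le_exp.2
      have h2 : r ^ 2 * v ≤ 1 := by
        have := mul_le_mul_of_nonneg_left hv.2 (by positivity : 0 ≤ r ^ 2)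
        rwa [hb, mul_inv_cancel₀ (by positivity)] at this
      have h3 : 1 / (4 * v) ≤ 1 / 4 := by
        apply one_div_le_one_div_of_le (by norm_num)
        linarith [hv.1]
      linarith
  rw [integral_const_mul, ← intervalIntegral.integral_of_le hb1, hIntg] at h1
  have h4 : ∫ v in Ioc (1 : ℝ) b, ii β r v ≤ II β r := by
    refine setIntegral_mono_set (integrableOn_ii β r hβ) ?_ (Eventually.of_forall fun u hu => lt_trans one_pos hu.1)
    filter_upwards [ae_restrict_mem measurableSet_Ioi] with u hu using ii_nonneg β r u hu
  calc _ = exp (-(5 / 4)) * (1 / β) := by ring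
    _ ≤ _ := h1.trans h4

lemma II_interp (a b c : ℝ) (ha : 0 < a) (hab : a ≤ b) (hbc : b ≤ c) : II b 0 ≤ II a 0 + II c 0 := by
  unfold II
  have h1 := integrableOn_ii a 0 ha
  have h3 := integrableOn_ii c 0 (by linarith)
  rw [← integral_add h1 h3]
  refine setIntegral_mono_on (integrableOn_ii b 0 (by linarith)) (h1.add h3) measurableSet_Ioi fun v hv => ?_
  have hv : 0 < v := hv
  have p1 := ii_nonneg a 0 v hv
  have p3 := ii_nonneg c 0 v hv
  rcases le_total 1 v with h | h
  · have : ii b 0 v ≤ ii a 0 v := by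
      unfold ii
      exact mul_le_mul_of_nonneg_right (Real.rpow_le_rpow_of_exponent_le h (by linarith)) (exp_pos _).le
    linarith
  · have : ii b 0 v ≤ ii c 0 v := by
      unfold ii
      exact mul_le_mul_of_nonneg_right (Real.rpow_le_rpow_of_exponent_ge hv h (by linarith)) (exp_pos _).le
    linarith

lemma AA_bound (d : ℕ) (α : ℝ) (hα : 0 < α) (hαd : α < d) :
    ∃ β1 > 0, ∀ β ∈ Ioo 0 β1, AA d α β ≤ AA d α 0 + 1 := by
  have hG : ∀ s : ℝ, 0 < s → ContinuousAt Gamma s := fun s hs =>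
    (Real.differentiableAt_Gamma fun m => by
      have : (0 : ℝ) ≤ m := by positivity
      linarith).continuousAt
  have h1 : ContinuousAt (AA d α) 0 := by
    unfold AA
    apply ContinuousAt.div
    · exact ContinuousAt.comp (g := Gamma) (f := fun β : ℝ => ((d : ℝ) - β) / 2) (hG _ (by linarith)) (by fun_prop)
    · exact ContinuousAt.comp (g := Gamma) (f := fun β : ℝ => ((d : ℝ) - β - α) / 2) (hG _ (by linarith)) (by fun_prop)
    · exact (Real.Gamma_pos_of_pos (by linarith)).ne'
  have h2 : ∀ᶠ β in nhds 0, AA d α β < AA d α 0 + 1 := h1.eventually_lt_const (by linarith)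
  obtain ⟨ε, hε, h⟩ := Metric.eventually_nhds_iff.1 h2
  refine ⟨ε, hε, fun β hβ => (h ?_).le⟩
  rw [Real.dist_eq, sub_zero, abs_of_pos hβ.1]; exact hβ.2

/-- Choice of the small exponent. -/
lemma exists_beta (d : ℕ) (α δ : ℝ) (hα : 0 < α) (hδ : 0 < δ) (hδd : δ < d - α) :
    ∃ β r0 : ℝ, 0 < β ∧ β < δ ∧ 0 < r0 ∧ r0 ≤ 1 ∧ ∀ r, 0 < r → r ≤ r0 →
      AA d α β * JJ (β + α) r ≤ 1 / 4 * (AA d α δ * JJ (δ + α) r / JJ δ r * JJ β r) := by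
  obtain ⟨β1, hβ1, hA⟩ := AA_bound d α hα (by linarith)
  have hAδ := AA_pos d hα δ hδd
  have hA0 := AA_pos d hα 0 (by linarith)
  set κ := AA d α δ * II (δ + α) 1 / II δ 0 with hκ
  have hκ0 : 0 < κ := div_pos (mul_pos hAδ (II_pos _ _ (by positivity))) (II_pos _ _ hδ)
  set B := (AA d α 0 + 1) * (II α 0 + II (α + δ) 0) with hB
  have hB0 : 0 < B := by
    have := II_pos α 0 hα
    have := II_pos (α + δ) 0 (by positivity)
    positivity
  set E := exp (-(5 / 4)) with hE
  have hE0 : 0 < E := exp_pos _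
  set β := min (min (β1 / 2) (δ / 2)) (κ * E / (4 * B)) with hβ
  have hβ0 : 0 < β := lt_min (lt_min (by positivity) (by positivity)) (by positivity)
  have hβδ : β < δ := by
    have : β ≤ δ / 2 := (min_le_left _ _).trans (min_le_right _ _)
    linarith
  have hββ1 : β < β1 := by
    have : β ≤ β1 / 2 := (min_le_left _ _).trans (min_le_left _ _)
    linarith
  have hβE : β * (4 * B) ≤ κ * E := by
    have : β ≤ κ * E / (4 * B) := min_le_right _ _
    rwa [le_div_iff₀ (by positivity)] at this
  set r0 : ℝ := 2 ^ (-(1 / β)) with hr0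
  have hr00 : 0 < r0 := by positivity
  have hr01 : r0 ≤ 1 := Real.rpow_le_one_of_one_le_of_nonpos (by norm_num) (by
    have : 0 < 1 / β := by positivity
    linarith)
  refine ⟨β, r0, hβ0, hβδ, hr00, hr01, fun r hr hrr => ?_⟩
  have hlow : B ≤ 1 / 4 * κ * II β r0 := by
    have h1 := II_lower β hβ0
    have h2 : B ≤ 1 / 4 * κ * (E / β) := by
      rw [mul_div_assoc', le_div_iff₀ hβ0]; nlinarith
    exact h2.trans (mul_le_mul_of_nonneg_left h1 (by positivity))
  have hAβ := hA β ⟨hβ0, hββ1⟩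
  have hAβ0 := AA_pos d hα β (by linarith)
  have hI := II_interp α (β + α) (α + δ) hα (by linarith) (by linarith)
  have hup : AA d α β * JJ (β + α) r ≤ B * (r ^ (-α) * r ^ (-β)) := by
    have h1 := JJ_le (β + α) r (by positivity) hr
    have e : r ^ (-(β + α)) = r ^ (-α) * r ^ (-β) := by
      rw [← Real.rpow_add hr]; congr 1; ring
    rw [e] at h1
    have hI0 := II_pos (β + α) 0 (by positivity)
    calc _ ≤ (AA d α 0 + 1) * ((II α 0 + II (α + δ) 0) * (r ^ (-α) * r ^ (-β))) := by
          apply mul_le_mul hAβ _ (JJ_pos _ _ (by positivity) hr).le (by positivity)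
          exact h1.trans (mul_le_mul_of_nonneg_right hI (by positivity))
      _ = _ := by rw [hB]; ring
  have hV : κ * r ^ (-α) ≤ AA d α δ * JJ (δ + α) r / JJ δ r := by
    rw [le_div_iff₀ (JJ_pos δ r hδ hr)]
    have h1 := JJ_le δ r hδ hr
    have h2 := le_JJ (δ + α) r 1 (by positivity) hr (hrr.trans hr01)
    have e : r ^ (-(δ + α)) = r ^ (-α) * r ^ (-δ) := by
      rw [← Real.rpow_add hr]; congr 1; ring
    rw [e] at h2
    calc κ * r ^ (-α) * JJ δ r ≤ κ * r ^ (-α) * (II δ 0 * r ^ (-δ)) := by gcongr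
      _ = AA d α δ * (II (δ + α) 1 * (r ^ (-α) * r ^ (-δ))) := by
          have := (II_pos δ 0 hδ).ne'
          rw [hκ]; field_simp
      _ ≤ _ := by gcongr
  have hJβ := le_JJ β r r0 hβ0 hr hrr
  have hIr := II_pos β r0 hβ0
  have hV0 : 0 ≤ AA d α δ * JJ (δ + α) r / JJ δ r := le_trans (by positivity) hV
  calc _ ≤ B * (r ^ (-α) * r ^ (-β)) := hup
    _ ≤ (1 / 4 * κ * II β r0) * (r ^ (-α) * r ^ (-β)) := by gcongr
    _ = 1 / 4 * ((κ * r ^ (-α)) * (II β r0 * r ^ (-β))) := by ring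
    _ ≤ 1 / 4 * (AA d α δ * JJ (δ + α) r / JJ δ r * JJ β r) := by gcongr

lemma V_bound (d : ℕ) (α δ : ℝ) (hα : 0 < α) (hδ : 0 < δ) (hδd : δ < d - α) :
    ∃ C : ℝ, 0 < C ∧ ∀ r ρ, 0 < ρ → ρ ≤ 1 → ρ ≤ r →
      AA d α δ * JJ (δ + α) r / JJ δ r ≤ C * ρ ^ (-α) := by
  have hAδ := AA_pos d hα δ hδd
  obtain ⟨C1, hC1, h1⟩ := JJ_quot_large δ α hδ hα
  have hI1 := II_pos δ 1 hδ
  have hI0 := II_pos (δ + α) 0 (by positivity)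
  refine ⟨AA d α δ * C1 + AA d α δ * (II (δ + α) 0 / II δ 1), by positivity, fun r ρ hρ hρ1 hr => ?_⟩
  have hr0 : 0 < r := by linarith
  rw [div_le_iff₀ (JJ_pos δ r hδ hr0)]
  have hJ := JJ_pos δ r hδ hr0
  have hρα : 1 ≤ ρ ^ (-α) := Real.one_le_rpow_of_pos_of_le_one_of_nonpos hρ hρ1 (by linarith)
  rcases le_total 1 r with h | h
  · calc _ ≤ AA d α δ * (C1 * JJ δ r) := by gcongr; exact h1 r h
      _ = AA d α δ * C1 * 1 * JJ δ r := by ring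
      _ ≤ (AA d α δ * C1 + AA d α δ * (II (δ + α) 0 / II δ 1)) * ρ ^ (-α) * JJ δ r := by
        have : 0 ≤ AA d α δ * (II (δ + α) 0 / II δ 1) := by positivity
        gcongr
        linarith
  · have h2 := JJ_le (δ + α) r (by positivity) hr0
    have h3 := le_JJ δ r 1 hδ hr0 h
    have e : r ^ (-(δ + α)) = r ^ (-α) * r ^ (-δ) := by
      rw [← Real.rpow_add hr0]; congr 1; ring
    rw [e] at h2
    have h4 : r ^ (-α) ≤ ρ ^ (-α) := Real.rpow_le_rpow_of_nonpos hρ hr (by linarith)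
    calc _ ≤ AA d α δ * (II (δ + α) 0 * (r ^ (-α) * r ^ (-δ))) := by gcongr
      _ = AA d α δ * (II (δ + α) 0 / II δ 1) * r ^ (-α) * (II δ 1 * r ^ (-δ)) := by field_simp
      _ ≤ AA d α δ * (II (δ + α) 0 / II δ 1) * ρ ^ (-α) * JJ δ r := by gcongr
      _ ≤ _ := by
        have : 0 ≤ AA d α δ * C1 := by positivity
        gcongr
        linarith

lemma measurable_JJ (β : ℝ) : Measurable (JJ β) := by
  unfold JJ
  apply StronglyMeasurable.measurable
  apply StronglyMeasurable.integral_prod_right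
    (f := fun (r u : ℝ) => u ^ (-(β / 2) - 1) * exp (-u - r ^ 2 / (4 * u)))
  apply Measurable.stronglyMeasurable
  fun_prop

lemma measurable_Vbeta (d : ℕ) (α β : ℝ) : Measurable (Vbeta d α β) := by
  have hK : ∀ ν, Measurable (besselK ν) := by
    intro ν
    unfold besselK
    apply Measurable.mul (by fun_prop)
    apply StronglyMeasurable.measurable
    apply StronglyMeasurable.integral_prod_right
      (f := fun (r u : ℝ) => u ^ (-ν - 1) * exp (-u - r ^ 2 / (4 * u)))
    apply Measurable.stronglyMeasurable
    fun_prop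
  have h1 := hK ((β + α) / 2)
  have h2 := hK (β / 2)
  have : Measurable (VProf d α β) := by
    unfold VProf
    fun_prop
  exact this.comp measurable_norm

end HardyAux

namespace HardyAux

lemma ofReal_integral_le {X : Type*} [MeasurableSpace X] (μ : Measure X) (f : X → ℝ) :
    ENNReal.ofReal (∫ x, f x ∂μ) ≤ ∫⁻ x, ENNReal.ofReal (f x) ∂μ := by
  by_cases hf : Integrable f μ
  · rw [integral_eq_lintegral_pos_part_sub_lintegral_neg_part hf]
    refine (ENNReal.ofReal_le_ofReal (sub_le_self _ ENNReal.toReal_nonneg)).trans ?_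
    exact ENNReal.ofReal_toReal_le
  · rw [integral_undef hf]; simp

lemma Vbeta_eq (d : ℕ) (α δ : ℝ) (z : Ed d) (hz : z ≠ 0) :
    Vbeta d α δ z = AA d α δ * JJ (δ + α) ‖z‖ / JJ δ ‖z‖ :=
  VProf_eq d α δ ‖z‖ (norm_pos_iff.2 hz)

lemma Vbeta_nonneg (d : ℕ) (α δ : ℝ) (hα : 0 < α) (hδ : 0 < δ) (hδd : δ < d - α) (z : Ed d) :
    0 ≤ Vbeta d α δ z := by
  by_cases hz : z = 0
  · rw [hz, Vbeta_zero d α δ hα]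
  · rw [Vbeta_eq d α δ z hz]
    have hn := norm_pos_iff.2 hz
    have h1 := AA_pos d hα δ hδd
    have h2 := JJ_pos (δ + α) ‖z‖ (by positivity) hn
    have h3 := JJ_pos δ ‖z‖ hδ hn
    positivity

/-- the kernel in extended nonnegative reals -/
def kE (d : ℕ) (α : ℝ) : ℝ → Ed d → Ed d → ℝ≥0∞ :=
  fun t x y => ENNReal.ofReal (relKernel d α 1 t x y)

/-- the potential in extended nonnegative reals -/
def qE (d : ℕ) (α δ : ℝ) : Ed d → ℝ≥0∞ := fun z => ENNReal.ofReal (Vbeta d α δ z)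

lemma pertN_nonneg (d : ℕ) (α δ : ℝ) (hα : 0 < α) (hα2 : α < 2) (hδ : 0 < δ) (hδd : δ < d - α)
    (n : ℕ) : ∀ t > 0, ∀ x y, 0 ≤ pertN d (relKernel d α 1) (Vbeta d α δ) n t x y := by
  induction n with
  | zero => intro t ht x y; exact relKernel_nonneg d hα hα2 t ht x y
  | succ n ih =>
    intro t ht x y
    simp only [pertN]
    refine setIntegral_nonneg measurableSet_Ioo fun s hs => integral_nonneg fun z => ?_
    have h1 := ih s hs.1 x z
    have h2 := Vbeta_nonneg d α δ hα hδ hδd z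
    have h3 := relKernel_nonneg d hα hα2 (t - s) (sub_pos.2 hs.2) z y
    positivity

lemma pertN_le (d : ℕ) (α δ : ℝ) (hα : 0 < α) (hα2 : α < 2) (hδ : 0 < δ) (hδd : δ < d - α)
    (n : ℕ) : ∀ t > 0, ∀ x y,
    ENNReal.ofReal (pertN d (relKernel d α 1) (Vbeta d α δ) n t x y) ≤
      mN (kE d α) (qE d α δ) volume x n t y := by
  induction n with
  | zero => intro t ht x y; exact le_rfl
  | succ n ih =>
    intro t ht x y
    simp only [pertN, mN]
    refine (ofReal_integral_le _ _).trans ?_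
    refine setLIntegral_mono' measurableSet_Ioo fun s hs => ?_
    refine (ofReal_integral_le _ _).trans ?_
    refine lintegral_mono fun z => ?_
    have h1 := pertN_nonneg d α δ hα hα2 hδ hδd n s hs.1 x z
    have h2 := Vbeta_nonneg d α δ hα hδ hδd z
    beta_reduce
    rw [ENNReal.ofReal_mul (by positivity), ENNReal.ofReal_mul h1]
    exact mul_le_mul_left (mul_le_mul_left (ih s hs.1 x z) _) _

lemma measurable_kE (d : ℕ) (α : ℝ) :
    Measurable fun p : ℝ × Ed d × Ed d => kE d α p.1 p.2.1 p.2.2 :=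
  (measurable_relKernel d α).ennreal_ofReal

lemma measurable_qE (d : ℕ) (α δ : ℝ) : Measurable (qE d α δ) :=
  (measurable_Vbeta d α δ).ennreal_ofReal

lemma pert_integral_le (d : ℕ) (α δ : ℝ) (hα : 0 < α) (hα2 : α < 2) (hδ : 0 < δ)
    (hδd : δ < d - α) (t : ℝ) (ht : 0 < t) (x : Ed d) :
    ENNReal.ofReal (∫ y, pert d (relKernel d α 1) (Vbeta d α δ) t x y) ≤
      ∑' n, br (kE d α) (qE d α δ) volume x n (fun _ => 1) t := by
  refine (ofReal_integral_le _ _).trans ?_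
  have h1 : ∀ y, ENNReal.ofReal (pert d (relKernel d α 1) (Vbeta d α δ) t x y) ≤
      ∑' n, mN (kE d α) (qE d α δ) volume x n t y := by
    intro y
    unfold pert
    by_cases hs : Summable fun n => pertN d (relKernel d α 1) (Vbeta d α δ) n t x y
    · rw [ENNReal.ofReal_tsum_of_nonneg
        (fun n => pertN_nonneg d α δ hα hα2 hδ hδd n t ht x y) hs]
      exact ENNReal.tsum_le_tsum fun n => pertN_le d α δ hα hα2 hδ hδd n t ht x y
    · rw [tsum_eq_zero_of_not_summable hs]; simp
  refine (lintegral_mono h1).trans ?_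
  rw [lintegral_tsum]
  · simp [br]
  · intro n
    exact ((meas_mN (measurable_kE d α) (measurable_qE d α δ) n).comp
      (by fun_prop : Measurable fun y : Ed d => (t, y))).aemeasurable

/-- radial function, vanishing at the origin -/
def fn (d : ℕ) (φ : ℝ → ℝ) : Ed d → ℝ≥0∞ :=
  fun z => if z = 0 then 0 else ENNReal.ofReal (φ ‖z‖)

lemma measurable_fn (d : ℕ) (φ : ℝ → ℝ) (hφ : Measurable φ) : Measurable (fn d φ) :=
  Measurable.ite (measurableSet_singleton 0) measurable_const
    (hφ.comp measurable_norm).ennreal_ofReal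

lemma fn_ae (d : ℕ) (hd : 0 < d) (φ : ℝ → ℝ) :
    ∀ᵐ z : Ed d, fn d φ z = ENNReal.ofReal (φ ‖z‖) := by
  filter_upwards [ae_ne_zero d hd] with z hz
  simp [fn, hz]

lemma fn_rel (d : ℕ) (hd : 0 < d) (α : ℝ) (hα : 0 < α) (hα2 : α < 2) (β : ℝ) (hβ : β < d - α)
    (z : Ed d) (hz : z ≠ 0) (t : ℝ) (ht : 0 < t) :
    (∫⁻ y, kE d α t z y * fn d (JJ β) y) + ∫⁻ r in Ioo (0 : ℝ) t, ∫⁻ y, kE d α r z y *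
      fn d (fun r => AA d α β * JJ (β + α) r) y = fn d (JJ β) z := by
  have h := rel_JJ d hd hα hα2 β hβ t ht z hz
  have e : fn d (JJ β) z = ENNReal.ofReal (JJ β ‖z‖) := by simp [fn, hz]
  rw [e, ← h]
  congr 1
  · refine lintegral_congr_ae ?_
    filter_upwards [fn_ae d hd (JJ β)] with y hy
    rw [hy]; rfl
  · refine lintegral_congr fun r => lintegral_congr_ae ?_
    filter_upwards [fn_ae d hd (fun r => AA d α β * JJ (β + α) r)] with y hy
    rw [hy]; rfl

lemma qE_eq (d : ℕ) (α δ : ℝ) (hα : 0 < α) (z : Ed d) :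
    qE d α δ z = fn d (fun r => AA d α δ * JJ (δ + α) r / JJ δ r) z := by
  by_cases hz : z = 0
  · simp [qE, fn, hz, Vbeta_zero d α δ hα]
  · simp [qE, fn, hz, Vbeta_eq d α δ z hz]

theorem main_real (d : ℕ) (hd : 0 < d) (α δ β : ℝ) (hα : 0 < α) (hα2 : α < 2) (hδ : 0 < δ)
    (hδd : δ < d - α) (hβ : 0 < β) (hβδ : β < δ) (V : ℝ → ℝ)
    (hV : V = fun r => AA d α δ * JJ (δ + α) r / JJ δ r)
    (C2 C3 K1 K2 K3 K4 : ℝ) (hC2 : 0 ≤ C2) (hC3 : 0 ≤ C3) (hK1 : 0 ≤ K1) (hK2 : 0 ≤ K2)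
    (hK3 : 0 ≤ K3) (hK4 : 0 ≤ K4)
    (i1 : ∀ r, 0 < r → AA d α β * JJ (β + α) r ≤ 1 / 4 * (V r * JJ β r) + C3)
    (i2 : ∀ r, 0 < r → V r * JJ β r ≤ C2 * (V r * JJ δ r) + C2)
    (i2' : ∀ r, 0 < r → V r ≤ C2 * (V r * JJ δ r) + C2)
    (i3 : ∀ r, 0 < r → V r ≤ K2 * (V r * JJ β r) + K1)
    (i4 : ∀ r, 0 < r → JJ β r ≤ K3 * JJ δ r + K4) (i5 : 4 * K2 * K4 ≤ 1 / 2)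
    (t : ℝ) (ht : 0 < t) (x : Ed d) (hx : x ≠ 0) :
    ∫ y, pert d (relKernel d α 1) (Vbeta d α δ) t x y ≤
      4 * (1 + 4 * K2 * K3 * JJ δ ‖x‖) * exp (4 * (K1 + 4 * K2 * C3) * t) := by
  have hJβ : ∀ r, 0 < r → 0 < JJ β r := fun r hr => JJ_pos β r hβ hr
  have hJδ : ∀ r, 0 < r → 0 < JJ δ r := fun r hr => JJ_pos δ r hδ hr
  have hV0 : ∀ r, 0 < r → 0 ≤ V r := by
    intro r hr
    rw [hV]
    have h1 := AA_pos d hα δ hδd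
    have h2 := JJ_pos (δ + α) r (by positivity) hr
    have h3 := hJδ r hr
    positivity
  have hq : ∀ z, qE d α δ z = fn d V z := by rw [hV]; exact qE_eq d α δ hα
  have hq0 : ∀ z, qE d α δ z ≠ 0 → z ≠ 0 := by
    rintro z hz rfl
    exact hz (by simp [qE, Vbeta_zero d α δ hα])
  have hxn := norm_pos_iff.2 hx
  have key := abstract_main (k := kE d α) (q := qE d α δ) (μ := volume) (x := x)
    (measurable_kE d α) (measurable_qE d α δ)
    (fun t ht z => relKernel_mass d hα hα2 t ht z)
    (f := fn d (JJ β)) (g := fn d fun r => AA d α β * JJ (β + α) r)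
    (h := fn d (JJ δ)) (gh := fn d fun r => AA d α δ * JJ (δ + α) r)
    (measurable_fn d _ (measurable_JJ β)) (measurable_fn d _ ((measurable_JJ _).const_mul _))
    (measurable_fn d _ (measurable_JJ δ)) (measurable_fn d _ ((measurable_JJ _).const_mul _))
    (fun z hz t ht => fn_rel d hd α hα hα2 β (by linarith) z (hq0 z hz) t ht)
    (fun z hz t ht => fn_rel d hd α hα hα2 δ hδd z
      (hz.elim (fun h => h ▸ hx) (fun h => hq0 z h)) t ht)
    (by
      intro z
      rw [hq]
      by_cases hz : z = 0
      · simp [fn, hz]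
      · have hn := norm_pos_iff.2 hz
        simp only [fn, hz, if_false]
        rw [← ENNReal.ofReal_mul (hV0 _ hn), hV]
        apply ENNReal.ofReal_le_ofReal
        have := (hJδ _ hn).ne'
        apply le_of_eq
        field_simp)
    (by simp [fn, hx])
    C2.toNNReal C3.toNNReal K1.toNNReal K2.toNNReal K3.toNNReal K4.toNNReal
    (by
      intro z
      rw [hq]
      by_cases hz : z = 0
      · simp [fn, hz]
      · have hn := norm_pos_iff.2 hz
        have := hV0 _ hn
        have := hJβ _ hn
        simp only [fn, hz, if_false]
        have e : ((4⁻¹ : ℝ≥0) : ℝ≥0∞) = ENNReal.ofReal (1 / 4) := by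
          rw [ENNReal.ofReal]; congr 1; ext; simp
        rw [e]
        change _ ≤ _ + ENNReal.ofReal C3
        rw [← ENNReal.ofReal_mul (hV0 _ hn), ← ENNReal.ofReal_mul (by norm_num),
          ← ENNReal.ofReal_add (by positivity) hC3]
        exact ENNReal.ofReal_le_ofReal (i1 _ hn))
    (by
      intro z
      rw [hq]
      by_cases hz : z = 0
      · simp [fn, hz]
      · have hn := norm_pos_iff.2 hz
        have := hV0 _ hn
        have := hJδ _ hn
        simp only [fn, hz, if_false]
        change _ ≤ ENNReal.ofReal C2 * _ + ENNReal.ofReal C2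
        rw [← ENNReal.ofReal_mul (hV0 _ hn), ← ENNReal.ofReal_mul (hV0 _ hn),
          ← ENNReal.ofReal_mul hC2, ← ENNReal.ofReal_add (by positivity) hC2]
        exact ENNReal.ofReal_le_ofReal (i2 _ hn))
    (by
      intro z
      rw [hq]
      by_cases hz : z = 0
      · simp [fn, hz]
      · have hn := norm_pos_iff.2 hz
        have := hV0 _ hn
        have := hJδ _ hn
        simp only [fn, hz, if_false]
        change _ ≤ ENNReal.ofReal C2 * _ + ENNReal.ofReal C2
        rw [← ENNReal.ofReal_mul (hV0 _ hn),
          ← ENNReal.ofReal_mul hC2, ← ENNReal.ofReal_add (by positivity) hC2]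
        exact ENNReal.ofReal_le_ofReal (i2' _ hn))
    (by
      intro z
      rw [hq]
      by_cases hz : z = 0
      · simp [fn, hz]
      · have hn := norm_pos_iff.2 hz
        have := hV0 _ hn
        have := hJβ _ hn
        simp only [fn, hz, if_false]
        change _ ≤ ENNReal.ofReal K2 * _ + ENNReal.ofReal K1
        rw [← ENNReal.ofReal_mul (hV0 _ hn),
          ← ENNReal.ofReal_mul hK2, ← ENNReal.ofReal_add (by positivity) hK1]
        exact ENNReal.ofReal_le_ofReal (i3 _ hn))
    (by
      intro z
      by_cases hz : z = 0
      · simp [fn, hz]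
      · have hn := norm_pos_iff.2 hz
        have := hJδ _ hn
        simp only [fn, hz, if_false]
        change _ ≤ ENNReal.ofReal K3 * _ + ENNReal.ofReal K4
        rw [← ENNReal.ofReal_mul hK3, ← ENNReal.ofReal_add (by positivity) hK4]
        exact ENNReal.ofReal_le_ofReal (i4 _ hn))
    (by
      rw [← NNReal.coe_le_coe]
      push_cast
      rw [Real.coe_toNNReal _ hK2, Real.coe_toNNReal _ hK4]
      exact i5) t ht
  have hJx := hJδ _ hxn
  have key2 := (pert_integral_le d α δ hα hα2 hδ hδd t ht x).trans key
  have e : (2 * (2 * (1 + 4 * (K2.toNNReal : ℝ≥0∞) * K3.toNNReal * fn d (JJ δ) x)) *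
      ENNReal.ofReal (exp (2 * ((2 * (K1.toNNReal + 4 * K2.toNNReal * C3.toNNReal) : ℝ≥0) : ℝ) * t)))
      = ENNReal.ofReal (4 * (1 + 4 * K2 * K3 * JJ δ ‖x‖) * exp (4 * (K1 + 4 * K2 * C3) * t)) := by
    have e1 : fn d (JJ δ) x = ENNReal.ofReal (JJ δ ‖x‖) := by simp [fn, hx]
    have e2 : 2 * ((2 * (K1.toNNReal + 4 * K2.toNNReal * C3.toNNReal) : ℝ≥0) : ℝ) * t =
        4 * (K1 + 4 * K2 * C3) * t := by
      push_cast
      rw [Real.coe_toNNReal _ hK2, Real.coe_toNNReal _ hK1, Real.coe_toNNReal _ hC3]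
      ring
    rw [e1, e2, ENNReal.ofReal_mul (by positivity), ENNReal.ofReal_mul (by norm_num),
      ENNReal.ofReal_add (by norm_num) (by positivity), ENNReal.ofReal_mul (by positivity),
      ENNReal.ofReal_mul (by positivity), ENNReal.ofReal_mul (by positivity)]
    simp only [ENNReal.ofReal_one, ENNReal.ofReal_ofNat]
    change 2 * (2 * (1 + 4 * ENNReal.ofReal K2 * ENNReal.ofReal K3 * _)) * _ = _
    rw [← mul_assoc 2 2]
    norm_num
  rw [e] at key2
  exact (ENNReal.ofReal_le_ofReal_iff (by positivity)).1 key2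

end HardyAux

namespace HardyAux

theorem main_rho (d : ℕ) (hd : 0 < d) (α δ : ℝ) (hα : 0 < α) (hα2 : α < 2) (hδ : 0 < δ)
    (hδd : δ < d - α) :
    ∃ CV c1 c2 r0 : ℝ, 0 < CV ∧ 0 < c1 ∧ 0 < c2 ∧ 0 < r0 ∧ ∀ ρ, 0 < ρ → ρ ≤ r0 → ∀ t, 0 < t →
      ∀ x : Ed d, x ≠ 0 → ∫ y, pert d (relKernel d α 1) (Vbeta d α δ) t x y ≤
        4 * (1 + c1 * ρ ^ δ * JJ δ ‖x‖) * exp (4 * (CV * ρ ^ (-α) + c2) * t) := by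
  obtain ⟨β, r0, hβ, hβδ, hr0, hr01, hβr⟩ := exists_beta d α δ hα hδ hδd
  obtain ⟨CV, hCV, hVb⟩ := V_bound d α δ hα hδ hδd
  set V : ℝ → ℝ := fun r => AA d α δ * JJ (δ + α) r / JJ δ r with hV
  have hV0 : ∀ r, 0 < r → 0 ≤ V r := by
    intro r hr
    rw [hV]
    have h1 := AA_pos d hα δ hδd
    have h2 := JJ_pos (δ + α) r (by positivity) hr
    have h3 := JJ_pos δ r hδ hr
    positivity
  have hC : 0 < II β 0 := II_pos β 0 hβ
  have hc : 0 < II β 1 := II_pos β 1 hβ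
  have hD : 0 < II δ 1 := II_pos δ 1 hδ
  have hAβ : 0 < AA d α β := AA_pos d hα β (by linarith)
  have hE : 0 < II (β + α) 0 := II_pos (β + α) 0 (by positivity)
  set C := II β 0 with hCdef
  set c := II β 1 with hcdef
  set D := II δ 1 with hDdef
  set L : ℝ := (8 * C / c) ^ (1 / β) with hL
  have hL0 : 0 < L := by positivity
  have hLβ : L ^ (-β) = c / (8 * C) := by
    rw [hL, ← Real.rpow_mul (by positivity)]
    have : 1 / β * -β = -1 := by field_simp
    rw [this, Real.rpow_neg_one, inv_div]
  have hG : 0 < II δ L := II_pos δ L hδ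
  set G := II δ L with hGdef
  set C3 : ℝ := AA d α β * (II (β + α) 0 * r0 ^ (-(β + α))) with hC3
  have hC30 : 0 < C3 := by positivity
  set C2 : ℝ := C / D + 1 / D + CV * C + CV with hC2
  have hC20 : 0 < C2 := by positivity
  refine ⟨CV, 4 * (1 / c) * (C * L ^ (δ - β) / G), 4 * (1 / c) * C3, r0, hCV, by positivity,
    by positivity, hr0, fun ρ hρ hρr t ht x hx => ?_⟩
  have hρ1 : ρ ≤ 1 := hρr.trans hr01
  have hV1 : ∀ r, 1 ≤ r → V r ≤ CV := by
    intro r hr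
    have := hVb r 1 one_pos le_rfl hr
    simpa using this
  have hJβ1 : ∀ r, 1 ≤ r → JJ β r ≤ C := by
    intro r hr
    refine (JJ_le β r hβ (by linarith)).trans ?_
    have : r ^ (-β) ≤ 1 := Real.rpow_le_one_of_one_le_of_nonpos hr (by linarith)
    nlinarith
  have hsm : ∀ r, 0 < r → r ≤ 1 → r ^ (-δ) ≤ 1 / D * JJ δ r := by
    intro r hr hr1
    have := le_JJ δ r 1 hδ hr hr1
    rw [one_div, ← div_eq_inv_mul, le_div_iff₀ hD]
    linarith
  have main := main_real d hd α δ β hα hα2 hδ hδd hβ hβδ V hV C2 C3 (CV * ρ ^ (-α)) (ρ ^ β / c)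
    (C * (L * ρ) ^ (δ - β) / G) (C * (L * ρ) ^ (-β)) hC20.le hC30.le (by positivity)
    (by positivity) (by positivity) (by positivity) ?_ ?_ ?_ ?_ ?_ ?_ t ht x hx
  · refine main.trans ?_
    have hJ := JJ_pos δ ‖x‖ hδ (norm_pos_iff.2 hx)
    have e1 : 4 * (ρ ^ β / c) * (C * (L * ρ) ^ (δ - β) / G) =
        4 * (1 / c) * (C * L ^ (δ - β) / G) * ρ ^ δ := by
      rw [Real.mul_rpow hL0.le hρ.le]
      have : ρ ^ δ = ρ ^ β * ρ ^ (δ - β) := by rw [← Real.rpow_add hρ]; congr 1; ring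
      rw [this]; ring
    rw [e1]
    have h2 : ρ ^ β ≤ 1 := Real.rpow_le_one hρ.le hρ1 hβ.le
    gcongr
  · intro r hr
    have hJ := JJ_pos β r hβ hr
    have hVr := hV0 r hr
    rcases le_or_gt r r0 with h | h
    · have := hβr r hr h
      change _ ≤ 1 / 4 * (V r * JJ β r) at this
      linarith
    · have h1 := JJ_le (β + α) r (by positivity) hr
      have h2 : r ^ (-(β + α)) ≤ r0 ^ (-(β + α)) :=
        Real.rpow_le_rpow_of_nonpos hr0 h.le (by linarith)
      have h3 : AA d α β * JJ (β + α) r ≤ C3 := by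
        rw [hC3]
        gcongr
        exact h1.trans (by gcongr)
      have : 0 ≤ 1 / 4 * (V r * JJ β r) := by positivity
      linarith
  · intro r hr
    have hJ := JJ_pos β r hβ hr
    have hJ' := JJ_pos δ r hδ hr
    have hVr := hV0 r hr
    rcases le_total r 1 with h | h
    · have h1 : JJ β r ≤ C / D * JJ δ r := by
        have a1 := JJ_le β r hβ hr
        have a2 : r ^ (-β) ≤ r ^ (-δ) :=
          Real.rpow_le_rpow_of_exponent_ge hr h (by linarith)
        calc _ ≤ C * r ^ (-β) := a1
          _ ≤ C * (1 / D * JJ δ r) := by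
            gcongr; exact a2.trans (hsm r hr h)
          _ = _ := by ring
      have hle : C / D ≤ C2 := by
        have : 0 < 1 / D + CV * C + CV := by positivity
        rw [hC2]; linarith
      calc V r * JJ β r ≤ V r * (C2 * JJ δ r) := by
            gcongr
            exact h1.trans (by gcongr)
        _ = C2 * (V r * JJ δ r) := by ring
        _ ≤ _ := by linarith
    · have hle : CV * C ≤ C2 := by
        have : 0 < C / D + 1 / D + CV := by positivity
        rw [hC2]; linarith
      have : 0 ≤ C2 * (V r * JJ δ r) := by positivity
      have : V r * JJ β r ≤ CV * C := mul_le_mul (hV1 r h) (hJβ1 r h) hJ.le hCV.le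
      linarith
  · intro r hr
    have hJ' := JJ_pos δ r hδ hr
    have hVr := hV0 r hr
    rcases le_total r 1 with h | h
    · have h1 : 1 ≤ 1 / D * JJ δ r :=
        (Real.one_le_rpow_of_pos_of_le_one_of_nonpos hr h (by linarith)).trans (hsm r hr h)
      have hle : 1 / D ≤ C2 := by
        have : 0 < C / D + CV * C + CV := by positivity
        rw [hC2]; linarith
      calc V r = V r * 1 := by ring
        _ ≤ V r * (C2 * JJ δ r) := by
            gcongr
            exact h1.trans (by gcongr)
        _ = C2 * (V r * JJ δ r) := by ring
        _ ≤ _ := by linarith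
    · have hle : CV ≤ C2 := by
        have : 0 < C / D + 1 / D + CV * C := by positivity
        rw [hC2]; linarith
      have : 0 ≤ C2 * (V r * JJ δ r) := by positivity
      linarith [hV1 r h]
  · intro r hr
    have hJ := JJ_pos β r hβ hr
    have hVr := hV0 r hr
    rcases le_total r ρ with h | h
    · have h1 : 1 ≤ ρ ^ β / c * JJ β r := by
        have a1 := le_JJ β r 1 hβ hr (h.trans hρ1)
        have a2 : ρ ^ (-β) ≤ r ^ (-β) := Real.rpow_le_rpow_of_nonpos hr h (by linarith)
        calc (1 : ℝ) = ρ ^ β / c * (c * ρ ^ (-β)) := by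
              rw [Real.rpow_neg hρ.le]
              field_simp
          _ ≤ _ := by
              gcongr
              exact le_trans (by gcongr) a1
      have : 0 ≤ CV * ρ ^ (-α) := by positivity
      calc V r = V r * 1 := by ring
        _ ≤ V r * (ρ ^ β / c * JJ β r) := by gcongr
        _ = ρ ^ β / c * (V r * JJ β r) := by ring
        _ ≤ _ := by linarith
    · have h1 := hVb r ρ hρ hρ1 h
      change V r ≤ _ at h1
      have : 0 ≤ ρ ^ β / c * (V r * JJ β r) := by positivity
      linarith
  · intro r hr
    have hJ' := JJ_pos δ r hδ hr
    have hR : 0 < L * ρ := by positivity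
    have a1 := JJ_le β r hβ hr
    rcases le_total r (L * ρ) with h | h
    · have a2 : r ^ (-β) ≤ (L * ρ) ^ (δ - β) * r ^ (-δ) := by
        have : r ^ (-β) = r ^ (δ - β) * r ^ (-δ) := by
          rw [← Real.rpow_add hr]; congr 1; ring
        rw [this]
        have : r ^ (δ - β) ≤ (L * ρ) ^ (δ - β) := Real.rpow_le_rpow hr.le h (by linarith)
        gcongr
      have a3 := le_JJ δ r L hδ hr (h.trans (by nlinarith))
      have a4 : 0 ≤ C * (L * ρ) ^ (-β) := by positivity
      calc JJ β r ≤ C * ((L * ρ) ^ (δ - β) * r ^ (-δ)) := a1.trans (by gcongr)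
        _ = C * (L * ρ) ^ (δ - β) / G * (G * r ^ (-δ)) := by field_simp
        _ ≤ C * (L * ρ) ^ (δ - β) / G * JJ δ r := by gcongr
        _ ≤ _ := by linarith
    · have a2 : r ^ (-β) ≤ (L * ρ) ^ (-β) := Real.rpow_le_rpow_of_nonpos hR h (by linarith)
      have a3 : 0 ≤ C * (L * ρ) ^ (δ - β) / G * JJ δ r := by positivity
      have a4 : JJ β r ≤ C * (L * ρ) ^ (-β) := a1.trans (by gcongr)
      linarith
  · rw [Real.mul_rpow hL0.le hρ.le, hLβ, Real.rpow_neg hρ.le]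
    have := (Real.rpow_pos_of_pos hρ β).ne'
    apply le_of_eq
    field_simp
    norm_num

theorem final (d : ℕ) (α δ : ℝ) (hα : α ∈ Ioo 0 (min 2 (d : ℝ)))
    (hδ : δ ∈ Ioc 0 (((d : ℝ) - α) / 2)) (T : ℝ) (hT : 0 < T) :
    ∃ c : ℝ, 0 < c ∧ ∀ t ∈ Ioc (0 : ℝ) T, ∀ x : Ed d, x ≠ 0 →
      ∀ w : Ed d, ‖w‖ = t ^ (1 / α) →
        (∫ y : Ed d, pert d (relKernel d α 1) (Vbeta d α δ) t x y) ≤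
          c * (1 + hBeta d α δ x / hBeta d α δ w) := by
  have hα0 : 0 < α := hα.1
  have hα2 : α < 2 := hα.2.trans_le (min_le_left _ _)
  have hαd : α < d := hα.2.trans_le (min_le_right _ _)
  have hd : 0 < d := by
    have : (0 : ℝ) < d := hα0.trans hαd
    exact_mod_cast this
  have hδ0 : 0 < δ := hδ.1
  have hδd : δ < d - α := by
    have := hδ.2
    linarith
  obtain ⟨CV, c1, c2, r0, hCV, hc1, hc2, hr0, hmain⟩ := main_rho d hd α δ hα0 hα2 hδ0 hδd
  obtain ⟨ch, hch, hhe⟩ := hBeta_eq d hα0 hα2 δ (by linarith)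
  have hI := II_pos δ 0 hδ0
  set a : ℝ := r0 / T ^ (1 / α) with ha
  have ha0 : 0 < a := by positivity
  refine ⟨4 * (1 + c1 * a ^ δ * II δ 0) * exp (4 * (CV * a ^ (-α) + c2 * T)), by positivity,
    fun t ht x hx w hw => ?_⟩
  have ht0 : 0 < t := ht.1
  have hs0 : 0 < t ^ (1 / α) := by positivity
  have hw0 : w ≠ 0 := by
    rintro rfl
    rw [norm_zero] at hw
    linarith
  have hρ : a * t ^ (1 / α) ≤ r0 := by
    have : t ^ (1 / α) ≤ T ^ (1 / α) := Real.rpow_le_rpow ht0.le ht.2 (by positivity)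
    rw [ha, div_mul_eq_mul_div, div_le_iff₀ (by positivity)]
    gcongr
  refine (hmain (a * t ^ (1 / α)) (by positivity) hρ t ht0 x hx).trans ?_
  rw [hhe x hx, hhe w hw0, hw]
  have hJx := JJ_pos δ ‖x‖ hδ0 (norm_pos_iff.2 hx)
  have hJw := JJ_pos δ (t ^ (1 / α)) hδ0 hs0
  have hJw' := JJ_le δ (t ^ (1 / α)) hδ0 hs0
  rw [mul_div_mul_left _ _ hch.ne']
  have e1 : (a * t ^ (1 / α)) ^ (-α) * t = a ^ (-α) := by
    rw [Real.mul_rpow ha0.le hs0.le, ← Real.rpow_mul ht0.le]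
    have : 1 / α * -α = -1 := by field_simp
    rw [this, Real.rpow_neg_one]
    field_simp
  have e2 : (a * t ^ (1 / α)) ^ δ ≤ a ^ δ * II δ 0 / JJ δ (t ^ (1 / α)) := by
    rw [le_div_iff₀ hJw, Real.mul_rpow ha0.le hs0.le]
    have : (t ^ (1 / α)) ^ δ * (t ^ (1 / α)) ^ (-δ) = 1 := by
      rw [← Real.rpow_add hs0]; simp
    calc _ ≤ a ^ δ * (t ^ (1 / α)) ^ δ * (II δ 0 * (t ^ (1 / α)) ^ (-δ)) := by gcongr
      _ = a ^ δ * II δ 0 * ((t ^ (1 / α)) ^ δ * (t ^ (1 / α)) ^ (-δ)) := by ring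
      _ = _ := by rw [this, mul_one]
  have h1 : 1 + c1 * (a * t ^ (1 / α)) ^ δ * JJ δ ‖x‖ ≤
      (1 + c1 * a ^ δ * II δ 0) * (1 + JJ δ ‖x‖ / JJ δ (t ^ (1 / α))) := by
    set Q := JJ δ ‖x‖ / JJ δ (t ^ (1 / α)) with hQ
    have hQ0 : 0 < Q := by positivity
    have h2 : c1 * (a * t ^ (1 / α)) ^ δ * JJ δ ‖x‖ ≤ c1 * a ^ δ * II δ 0 * Q := by
      calc _ ≤ c1 * (a ^ δ * II δ 0 / JJ δ (t ^ (1 / α))) * JJ δ ‖x‖ := by gcongr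
        _ = _ := by rw [hQ]; ring
    have h3 : 0 < c1 * a ^ δ * II δ 0 := by positivity
    nlinarith
  have h2 : 4 * (CV * (a * t ^ (1 / α)) ^ (-α) + c2) * t ≤ 4 * (CV * a ^ (-α) + c2 * T) := by
    have : 4 * (CV * (a * t ^ (1 / α)) ^ (-α) + c2) * t =
        4 * (CV * ((a * t ^ (1 / α)) ^ (-α) * t) + c2 * t) := by ring
    rw [this, e1]
    have := ht.2
    gcongr
  calc _ ≤ 4 * ((1 + c1 * a ^ δ * II δ 0) * (1 + JJ δ ‖x‖ / JJ δ (t ^ (1 / α)))) *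
        exp (4 * (CV * a ^ (-α) + c2 * T)) := by
        gcongr
    _ = _ := by ring

end HardyAux

/-- Upper bound of the total mass of `p̃(t,x,·)` by `H(t,x) = 1 + h_δ(x)/h_δ(t^{1/α})`
(Proposition 4.3); since `h_δ` is radial, its profile value at `t^{1/α}` is `h_δ(w)` for
any `w` with `‖w‖ = t^{1/α}`. -/
theorem stmt_16 (d : ℕ) (α δ : ℝ) (hα : α ∈ Ioo 0 (min 2 (d : ℝ)))
    (hδ : δ ∈ Ioc 0 (((d : ℝ) - α) / 2)) (T : ℝ) (hT : 0 < T) :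
    ∃ c : ℝ, 0 < c ∧ ∀ t ∈ Ioc (0 : ℝ) T, ∀ x : Ed d, x ≠ 0 →
      ∀ w : Ed d, ‖w‖ = t ^ (1 / α) →
        (∫ y : Ed d, pert d (relKernel d α 1) (Vbeta d α δ) t x y) ≤
          c * (1 + hBeta d α δ x / hBeta d α δ w) := by
  exact HardyAux.final d α δ hα hδ T hT
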